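/- arXiv:2605.28781 — 2 statements merged into one kernel-verified Lean document; each statement's English description precedes it below -/
import Mathlib

section
/- There exists a constant c > 0 such that, for all sufficiently large primes p, there exists a set A ⊆ 𝔽_p with p^c < |A| < p^{1/2} and max(|A+A|, |AA|) ≤ |A|^{2−c}. -/
open Pointwise

/-- A set of `k` residues lying both in an interval of length `N` and in a geometric progression
of length `M`, found by pigeonholing over the dilates of the progression. -/
theorem ZMod.exists_card_eq_add_mul_card_le {p N M k : ℕ} [Fact p.Prime] (hN : N < p)
    (hM : M < p) (hk : p * k ≤ N * M) :
    ∃ A : Finset (ZMod p), A.card = k ∧ (A + A).card ≤ 2 * N ∧ (A * A).card ≤ 2 * M := by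
  obtain ⟨g, hg⟩ := IsCyclic.exists_generator (α := (ZMod p)ˣ)
  have hord : orderOf g = p - 1 := by
    rw [orderOf_eq_card_of_forall_mem_zpowers hg, Nat.card_eq_fintype_card, ZMod.card_units]
  have hcast : ∀ i j : ℕ, i < N → j < N → ((i + 1 : ℕ) : ZMod p) = ((j + 1 : ℕ) : ZMod p) →
      i = j := by
    intro i j hi hj h
    rw [ZMod.natCast_eq_natCast_iff] at h
    have := Nat.ModEq.eq_of_lt_of_lt h (by omega) (by omega)
    omega
  have hne : ∀ i : ℕ, i < N → ((i + 1 : ℕ) : ZMod p) ≠ 0 := by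
    intro i hi h
    rw [ZMod.natCast_eq_zero_iff] at h
    have := Nat.le_of_dvd (by omega) h
    omega
  choose! u hu using fun (i : ℕ) (hi : i < N) => (hne i hi).isUnit
  obtain ⟨y, -, hy⟩ := Finset.exists_le_card_fiber_of_mul_le_card_of_maps_to
    (s := Finset.range N ×ˢ Finset.range M) (t := (Finset.univ : Finset (ZMod p)ˣ))
    (f := fun x => u x.1 * (g ^ x.2)⁻¹) (n := k) (fun _ _ => Finset.mem_univ _)
    Finset.univ_nonempty (by
      rw [Finset.card_univ, ZMod.card_units, Finset.card_product, Finset.card_range,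
        Finset.card_range]
      exact (Nat.mul_le_mul_right _ (Nat.sub_le _ _)).trans hk)
  obtain ⟨S, hS, hSk⟩ := Finset.exists_subset_card_eq hy
  have hmem : ∀ x ∈ S, x.1 < N ∧ x.2 < M ∧ u x.1 = y * g ^ x.2 := by
    intro x hx
    have := hS hx
    simp only [Finset.mem_filter, Finset.mem_product, Finset.mem_range] at this
    exact ⟨this.1.1, this.1.2, mul_inv_eq_iff_eq_mul.1 this.2⟩
  refine ⟨S.image fun x => ((x.1 + 1 : ℕ) : ZMod p), ?_, ?_, ?_⟩
  · rw [Finset.card_image_of_injOn, hSk]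
    rintro ⟨i, j⟩ hx ⟨i', j'⟩ hx' h
    obtain ⟨hi, hj, e⟩ := hmem _ hx
    obtain ⟨hi', hj', e'⟩ := hmem _ hx'
    dsimp only at *
    obtain rfl := hcast _ _ hi hi' h
    rw [e] at e'
    have := pow_injOn_Iio_orderOf (x := g) (by rw [hord]; exact Set.mem_Iio.2 (by omega))
      (by rw [hord]; exact Set.mem_Iio.2 (by omega)) (mul_left_cancel e')
    rw [this]
  · calc _ ≤ ((Finset.range (2 * N)).image fun i => ((i + 2 : ℕ) : ZMod p)).card := by
          refine Finset.card_le_card fun z hz => ?_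
          obtain ⟨a, ha, b, hb, rfl⟩ := Finset.mem_add.1 hz
          obtain ⟨x, hx, rfl⟩ := Finset.mem_image.1 ha
          obtain ⟨x', hx', rfl⟩ := Finset.mem_image.1 hb
          have h := hmem x hx
          have h' := hmem x' hx'
          refine Finset.mem_image.2 ⟨x.1 + x'.1, Finset.mem_range.2 (by omega), ?_⟩
          push_cast
          ring
      _ ≤ _ := Finset.card_image_le.trans (Finset.card_range _).le
  · calc _ ≤ ((Finset.range (2 * M)).image fun j => ((y * y * g ^ j : (ZMod p)ˣ) : ZMod p)).card := by
          refine Finset.card_le_card fun z hz => ?_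
          obtain ⟨a, ha, b, hb, rfl⟩ := Finset.mem_mul.1 hz
          obtain ⟨x, hx, rfl⟩ := Finset.mem_image.1 ha
          obtain ⟨x', hx', rfl⟩ := Finset.mem_image.1 hb
          have h := hmem x hx
          have h' := hmem x' hx'
          refine Finset.mem_image.2 ⟨x.2 + x'.2, Finset.mem_range.2 (by omega), ?_⟩
          rw [← hu _ h.1, ← hu _ h'.1, h.2.2, h'.2.2]
          push_cast
          ring
      _ ≤ _ := Finset.card_image_le.trans (Finset.card_range _).le

/-- There exists a constant `c > 0` such that for all sufficiently large primes `p`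
there exists `A ⊆ 𝔽_p` with `p^c < |A| < p^{1/2}` and
`max(|A+A|, |AA|) ≤ |A|^{2-c}`. -/
theorem statement7 :
    ∃ c : ℝ, 0 < c ∧
      ∃ p₀ : ℕ, ∀ p : ℕ, p.Prime → p₀ ≤ p →
        ∃ A : Set (ZMod p),
          (p : ℝ) ^ c < (A.ncard : ℝ) ∧ (A.ncard : ℝ) < (p : ℝ) ^ ((1 : ℝ) / 2) ∧
          max ((A + A).ncard : ℝ) ((A * A).ncard : ℝ) ≤ (A.ncard : ℝ) ^ ((2 : ℝ) - c) := by
  refine ⟨1 / 8, by norm_num, 4096 ^ 10, fun p hp hp₀ => ?_⟩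
  have : Fact p.Prime := ⟨hp⟩
  obtain ⟨n, hn, hn'⟩ : ∃ n : ℕ, n ^ 10 ≤ p ∧ p < (n + 1) ^ 10 :=
    ⟨Nat.nthRoot 10 p, Nat.pow_nthRoot_le (by norm_num), Nat.lt_pow_nthRoot_add_one (by norm_num) p⟩
  have hn_large : 4096 ≤ n := by
    have := lt_of_pow_lt_pow_left₀ 10 (by omega) (hp₀.trans_lt hn')
    omega
  have hp_lt : p < 2 ^ 10 * n ^ 10 := by
    refine hn'.trans_le ?_
    rw [← mul_pow]
    exact Nat.pow_le_pow_left (by omega) 10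
  have hN : 32 * n ^ 7 < p := by
    refine lt_of_lt_of_le ?_ hn
    have h3 : 32 < n ^ 3 := lt_of_lt_of_le (by norm_num) (Nat.pow_le_pow_left hn_large 3)
    calc 32 * n ^ 7 < n ^ 3 * n ^ 7 := Nat.mul_lt_mul_of_pos_right h3 (by positivity)
      _ = n ^ 10 := by ring
  obtain ⟨A, hA, hadd, hmul⟩ := ZMod.exists_card_eq_add_mul_card_le (k := n ^ 4) hN hN
    (calc p * n ^ 4 ≤ 2 ^ 10 * n ^ 10 * n ^ 4 := Nat.mul_le_mul_right _ hp_lt.le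
      _ = 32 * n ^ 7 * (32 * n ^ 7) := by ring)
  have hn_real : (4096 : ℝ) ≤ n := by exact_mod_cast hn_large
  have hn_pos : (0 : ℝ) < n := by linarith
  have hbound : (2 * (32 * n ^ 7) : ℝ) ≤ ((n : ℝ) ^ 4) ^ ((2 : ℝ) - 1 / 8) := by
    have h64 : (64 : ℝ) ≤ (n : ℝ) ^ ((1 : ℝ) / 2) := by
      rw [← Real.sqrt_eq_rpow]
      exact Real.le_sqrt_of_sq_le (by linarith)
    calc (2 * (32 * n ^ 7) : ℝ) = 64 * (n : ℝ) ^ 7 := by ring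
      _ ≤ (n : ℝ) ^ ((1 : ℝ) / 2) * (n : ℝ) ^ 7 := by gcongr
      _ = ((n : ℝ) ^ 4) ^ ((2 : ℝ) - 1 / 8) := by
        rw [← Real.rpow_natCast, ← Real.rpow_natCast, ← Real.rpow_mul hn_pos.le,
          ← Real.rpow_add hn_pos]
        norm_num
  refine ⟨(A : Set (ZMod p)), ?_, ?_, ?_⟩
  · rw [Set.ncard_coe_finset, hA, one_div]
    refine (Real.rpow_inv_lt_iff_of_pos (by positivity) (by positivity) (by norm_num)).2 ?_
    rw [show (8 : ℝ) = ((8 : ℕ) : ℝ) by norm_num, Real.rpow_natCast]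
    have : p < (n ^ 4) ^ 8 := by
      calc p < 2 ^ 10 * n ^ 10 := hp_lt
        _ ≤ n ^ 10 * n ^ 10 := by gcongr; omega
        _ = n ^ 20 := by ring
        _ ≤ n ^ 32 := Nat.pow_le_pow_right (by omega) (by norm_num)
        _ = (n ^ 4) ^ 8 := by ring
    exact_mod_cast this
  · rw [Set.ncard_coe_finset, hA, ← Real.sqrt_eq_rpow]
    refine Real.lt_sqrt_of_sq_lt ?_
    have : (n ^ 4) ^ 2 < p := by
      calc (n ^ 4) ^ 2 = n ^ 8 := by ring
        _ < n ^ 10 := Nat.pow_lt_pow_right (by omega) (by norm_num)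
        _ ≤ p := hn
    exact_mod_cast this
  · rw [← Finset.coe_add, ← Finset.coe_mul, Set.ncard_coe_finset, Set.ncard_coe_finset,
      Set.ncard_coe_finset, hA]
    push_cast
    refine max_le (le_trans ?_ hbound) (le_trans ?_ hbound)
    · exact_mod_cast hadd
    · exact_mod_cast hmul
end

section
/- There exists an absolute constant c > 0 such that for every prime p and every power q of p, there exist arbitrarily large finite sets A ⊆ 𝔽_q((t)) with max(|A+A|, |AA|) ≤ |A|^{2 − c/log p}; that is, for every N there is a finite A ⊆ 𝔽_q((t)) with |A| ≥ N satisfying this bound. -/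
open Pointwise

/-- The factor `1 + z ^ (Q - 1)`, so that `z ^ Q + z = z * (1 + z ^ (Q - 1))`. -/
def unitFactor {K : Type*} [Field K] (Q : ℕ) (z : K) : K := 1 + z ^ (Q - 1)

/-- The recursion satisfied by the generators of the Garcia-Stichtenoth tower. -/
structure IsTower {K : Type*} [Field K] (Q m : ℕ) (x : ℕ → K) : Prop where
  ne_zero : ∀ j ≤ m, x j ≠ 0
  rel : ∀ j < m, (x (j + 1) ^ Q + x (j + 1)) * unitFactor Q (x j) = x j ^ Q

/-- The possible sizes `X j = v (x j)` and `H j = v (1 + x j ^ (Q - 1))` along a tower at a place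
where the tower is not everywhere a unit: small values before index `a`, a value `1` at `a`,
poles after `a`. -/
structure PoleType {Γ : Type*} [LinearOrderedCommGroupWithZero Γ] (Q m a : ℕ) (X H : ℕ → Γ) :
    Prop where
  small : ∀ j < a, j ≤ m → X j < 1
  small_unit : ∀ j < a, j ≤ m → H j = 1
  small_succ : ∀ j, j + 1 < a → j + 1 ≤ m → X (j + 1) = X j ^ Q
  mid : a ≤ m → X a = 1
  mid_lt : a ≤ m → H a < 1
  mid_eq : ∀ j, j + 1 = a → a ≤ m → H a = X j ^ Q
  pole : ∀ j, a < j → j ≤ m → 1 < X j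
  pole_unit : ∀ j, a < j → j ≤ m → H j = X j ^ (Q - 1)
  pole_first : a < m → X (a + 1) ^ Q * H a = 1
  pole_succ : ∀ j, a < j → j < m → X (j + 1) ^ Q = X j

section Abstract

variable {Γ : Type*} [LinearOrderedCommGroupWithZero Γ]

theorem PoleType.of_recursion {Q m : ℕ} (hQ : 2 ≤ Q) {X H : ℕ → Γ}
    (h_small : ∀ j ≤ m, X j < 1 → H j = 1) (h_large : ∀ j ≤ m, 1 < X j → H j = X j ^ (Q - 1))
    (h_one : ∀ j ≤ m, X j = 1 → H j ≤ 1)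
    (h_rel : ∀ j < m, X (j + 1) * H (j + 1) * H j = X j ^ Q)
    (h_ne : ∀ j ≤ m, X j ≠ 0) (h0 : X 0 ≤ 1) :
    (∀ j ≤ m, X j = 1 ∧ H j = 1) ∨ ∃ a ≤ m + 1, PoleType Q m a X H := by
  have hQ1 : Q - 1 ≠ 0 := by omega
  have hQ0 : Q ≠ 0 := by omega
  have hpow (y : Γ) : y * y ^ (Q - 1) = y ^ Q := by
    rw [← pow_succ', Nat.sub_add_cancel (by omega)]
  -- the least index which is not small
  obtain ⟨a, ham, hsm, ha⟩ : ∃ a ≤ m + 1, (∀ j < a, X j < 1) ∧ (a ≤ m → 1 ≤ X a) := by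
    by_cases hall : ∀ j ≤ m, X j < 1
    · exact ⟨m + 1, le_rfl, fun j hj => hall j (by omega), by omega⟩
    · push Not at hall
      classical
      have hex : ∃ j, j ≤ m ∧ 1 ≤ X j := hall
      refine ⟨Nat.find hex, (Nat.find_spec hex).1.trans (by omega), fun j hj => ?_,
        fun _ => (Nat.find_spec hex).2⟩
      have := Nat.find_min hex hj
      push Not at this
      exact this (hj.le.trans (Nat.find_spec hex).1)
  have hsucc : ∀ j < a, j + 1 ≤ m → X (j + 1) * H (j + 1) = X j ^ Q := fun j hj hjm => by
    have := h_rel j (by omega)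
    rwa [h_small j (by omega) (hsm j hj), mul_one] at this
  have hmid : a ≤ m → X a = 1 := by
    intro ham'
    refine le_antisymm ?_ (ha ham')
    rcases Nat.eq_zero_or_pos a with rfl | hpos
    · exact h0
    · obtain ⟨b, rfl⟩ := Nat.exists_eq_succ_of_ne_zero hpos.ne'
      by_contra! hlt
      have h1 := hsucc b (by omega) ham'
      simp only [Nat.succ_eq_add_one] at *
      rw [h_large _ ham' hlt, hpow] at h1
      have h2 := one_lt_pow₀ hlt hQ0
      rw [h1] at h2
      exact absurd (pow_lt_one₀ zero_le (hsm b (by omega)) hQ0) (by simpa using h2.le)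
  have hmideq : ∀ j, j + 1 = a → a ≤ m → H a = X j ^ Q := by
    rintro j rfl hm'
    have := hsucc j (by omega) hm'
    rwa [hmid hm', one_mul] at this
  by_cases hgen : a ≤ m ∧ H a = 1
  · left
    have ha0 : a = 0 := by
      by_contra hne
      obtain ⟨b, rfl⟩ := Nat.exists_eq_succ_of_ne_zero hne
      have h1 := hmideq b rfl hgen.1
      rw [hgen.2] at h1
      exact absurd (pow_lt_one₀ zero_le (hsm b (by omega)) hQ0) (by rw [← h1]; simp)
    subst ha0
    intro j
    induction j with
    | zero => exact fun _ => ⟨hmid hgen.1, hgen.2⟩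
    | succ j ih =>
      intro hj
      have h1 := h_rel j (by omega)
      rw [(ih (by omega)).1, (ih (by omega)).2, mul_one, one_pow] at h1
      rcases lt_trichotomy (X (j + 1)) 1 with h | h | h
      · rw [h_small _ hj h, mul_one] at h1
        exact absurd h1 h.ne
      · rw [h, one_mul] at h1
        exact ⟨h, h1⟩
      · rw [h_large _ hj h, hpow] at h1
        exact absurd h1 (one_lt_pow₀ h hQ0).ne'
  · right
    have hlt : a ≤ m → H a < 1 := fun h =>
      lt_of_le_of_ne (h_one a h (hmid h)) fun he => hgen ⟨h, he⟩
    have hfirst : a < m → 1 < X (a + 1) ∧ X (a + 1) ^ Q * H a = 1 := by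
      intro h
      have h1 := h_rel a h
      rw [hmid h.le, one_pow] at h1
      have key : 1 < X (a + 1) * H (a + 1) := by
        by_contra! hc
        have := mul_lt_mul_of_le_of_lt_of_nonneg_of_pos hc (hlt h.le) zero_le zero_lt_one
        rw [h1, one_mul] at this
        exact lt_irrefl _ this
      rcases lt_trichotomy (X (a + 1)) 1 with h' | h' | h'
      · rw [h_small _ h h', mul_one] at key
        exact absurd key h'.not_gt
      · rw [h', one_mul] at key
        exact absurd key (h_one _ h h').not_gt
      · refine ⟨h', ?_⟩
        rwa [h_large _ h h', hpow] at h1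
    have hstep : ∀ j < m, 1 < X j → 1 < X (j + 1) ∧ X (j + 1) ^ Q = X j := by
      intro j hj h
      have h1 := h_rel j hj
      rw [h_large j hj.le h, ← hpow (X j)] at h1
      have h2 : X (j + 1) * H (j + 1) = X j :=
        mul_right_cancel₀ (pow_ne_zero _ (h_ne j hj.le)) h1
      rcases lt_trichotomy (X (j + 1)) 1 with h' | h' | h'
      · rw [h_small _ hj h', mul_one] at h2
        exact absurd (h2 ▸ h') h.not_gt
      · rw [h', one_mul] at h2
        exact absurd (h2 ▸ h_one _ hj h') h.not_ge
      · refine ⟨h', ?_⟩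
        rwa [h_large _ hj h', hpow] at h2
    have hpole : ∀ j, a < j → j ≤ m → 1 < X j := by
      intro j hj
      induction j, hj using Nat.le_induction with
      | base => exact fun h => (hfirst h).1
      | succ j hj ih => exact fun h => (hstep j h (ih (by omega))).1
    exact ⟨a, ham,
      { small := fun j hj _ => hsm j hj
        small_unit := fun j hj hm => h_small j hm (hsm j hj)
        small_succ := fun j hj hm => by
          have := hsucc j (by omega) hm
          rwa [h_small _ hm (hsm _ hj), mul_one] at this
        mid := hmid
        mid_lt := hlt
        mid_eq := hmideq
        pole := hpole
        pole_unit := fun j hj hm => h_large j hm (hpole j hj hm)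
        pole_first := fun h => (hfirst h).2
        pole_succ := fun j hj hm => (hstep j hm (hpole j hj hm.le)).2 }⟩

namespace PoleType

variable {Q m a : ℕ} {X H : ℕ → Γ}

theorem small_antitone (P : PoleType Q m a X H) (hQ : 2 ≤ Q) {i j : ℕ} (hij : i ≤ j) (hj : j < a)
    (hjm : j ≤ m) : X j ≤ X i := by
  induction j, hij using Nat.le_induction with
  | base => exact le_rfl
  | succ j hij ih =>
    rw [P.small_succ j hj hjm]
    exact (pow_le_of_le_one zero_le (P.small j (by omega) (by omega)).le (by omega)).trans
      (ih (by omega) (by omega))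

theorem small_eq_pow (P : PoleType Q m a X H) {j : ℕ} (hj : j < a)
    (hjm : j ≤ m) : X j = X 0 ^ Q ^ j := by
  induction j with
  | zero => simp
  | succ j ih => rw [P.small_succ j hj hjm, ih (by omega) (by omega), pow_succ, pow_mul]

theorem pole_eq_pow (P : PoleType Q m a X H) {n : ℕ} (h : a + 1 + n ≤ m) :
    X (a + 1) = X (a + 1 + n) ^ Q ^ n := by
  induction n with
  | zero => simp
  | succ n ih =>
    rw [ih (by omega), ← P.pole_succ (a + 1 + n) (by omega) (by omega), ← pow_mul, pow_succ']
    rfl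

theorem pole_first_mul (P : PoleType Q m a X H) (hQ : 2 ≤ Q) {t : ℕ} (h : a < m) (ht : t + 1 = a) :
    X (a + 1) * X t = 1 := by
  have h1 := P.pole_first h
  rw [P.mid_eq t ht h.le, ← mul_pow] at h1
  exact (pow_left_inj₀ zero_le zero_le (show Q ≠ 0 by omega)).1 (by rw [h1, one_pow])

theorem pole_mul_mirror (P : PoleType Q m a X H) (hQ : 2 ≤ Q) {l t : ℕ} (h : a + 1 + l ≤ m)
    (ht : t + 1 + l = a) : X (a + 1 + l) * X t = 1 := by
  induction l generalizing t with
  | zero => exact P.pole_first_mul hQ (by omega) (by omega)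
  | succ l ih =>
    refine (pow_left_inj₀ zero_le zero_le (show Q ≠ 0 by omega)).1 ?_
    rw [one_pow, mul_pow, ← add_assoc, P.pole_succ (a + 1 + l) (by omega) (by omega),
      ← P.small_succ t (by omega) (by omega)]
    exact ih (by omega) (by omega)

theorem one_le_pole_first_mul (P : PoleType Q m a X H) (hQ : 2 ≤ Q) {t : ℕ} (h : a < m)
    (ht : t < a) : 1 ≤ X (a + 1) * X t := by
  rw [← P.pole_first_mul hQ (t := a - 1) h (by omega)]
  gcongr
  exact P.small_antitone hQ (by omega) (by omega) (by omega)

theorem prod_unit_small (P : PoleType Q m a X H) {b : ℕ} (hb : b ≤ a) (hbm : b ≤ m + 1) :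
    ∏ t ∈ Finset.range b, H t = 1 :=
  Finset.prod_eq_one fun t ht => by
    have := Finset.mem_range.1 ht
    exact P.small_unit t (by omega) (by omega)

theorem prod_unit_pole (P : PoleType Q m a X H) (hQ : 2 ≤ Q) {b : ℕ} (hb : a < b) (hbm : b ≤ m) :
    (∏ t ∈ Finset.range b, H t) * X b ^ Q = 1 := by
  induction b, hb using Nat.le_induction with
  | base =>
    rw [Nat.succ_eq_add_one, Finset.prod_range_succ, P.prod_unit_small le_rfl (by omega), one_mul,
      mul_comm, P.pole_first (by omega)]
  | succ b hb ih =>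
    rw [Finset.prod_range_succ, P.pole_unit b hb (by omega), P.pole_succ b hb (by omega), mul_assoc,
      ← pow_succ, Nat.sub_add_cancel (by omega), ih (by omega)]

/-- The correction term attached to an index `b ≠ a` is integral. -/
theorem correction_le_one (P : PoleType Q m a X H) (hQ : 2 ≤ Q) (hX : ∀ j ≤ m, X j ≠ 0) {b i : ℕ}
    (hib : i < b) (hba : b ≠ a) (hbm : b ≤ m) :
    X b ^ 2 * (∏ t ∈ Finset.range b, H t) ^ Q ^ m * (X i)⁻¹ ≤ 1 := by
  have hXi : X i ≠ 0 := hX i (by omega)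
  rcases lt_or_gt_of_ne hba with hb | hb
  · rw [P.prod_unit_small hb.le (by omega), one_pow, mul_one, sq, mul_assoc]
    refine mul_le_one' (P.small b hb hbm).le ?_
    rw [← div_eq_mul_inv]
    exact div_le_one_of_le₀ (P.small_antitone hQ hib.le hb hbm) zero_le
  · have hXb := P.pole b hb hbm
    have hXa : X (a + 1) ≤ X b ^ Q ^ m := by
      obtain ⟨n, rfl⟩ := Nat.exists_eq_add_of_le (show a + 1 ≤ b from hb)
      rw [P.pole_eq_pow hbm]
      exact pow_le_pow_right₀ hXb.le (Nat.pow_le_pow_right (by omega) (by omega))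
    have hinv : (X i)⁻¹ ≤ X b ^ Q ^ m := by
      rcases lt_trichotomy i a with h | rfl | h
      · have h1 := P.one_le_pole_first_mul hQ (by omega) h
        refine le_trans ?_ hXa
        rwa [inv_le_iff_one_le_mul₀ (zero_lt_iff.2 hXi)]
      · rw [P.mid (by omega), inv_one]
        exact one_le_pow₀ hXb.le
      · exact (inv_le_one_of_one_le₀ (P.pole i h (by omega)).le).trans (one_le_pow₀ hXb.le)
    have hE : (∏ t ∈ Finset.range b, H t) ^ Q ^ m * X b ^ (Q * Q ^ m) = 1 := by
      rw [pow_mul, ← mul_pow, P.prod_unit_pole hQ hb hbm, one_pow]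
    have hexp : 2 + Q ^ m ≤ Q * Q ^ m := by
      have : 2 ≤ Q ^ m := hQ.trans (Nat.le_self_pow (by omega) Q)
      nlinarith
    calc X b ^ 2 * (∏ t ∈ Finset.range b, H t) ^ Q ^ m * (X i)⁻¹
        ≤ X b ^ 2 * (∏ t ∈ Finset.range b, H t) ^ Q ^ m * X b ^ Q ^ m := by gcongr
      _ = (∏ t ∈ Finset.range b, H t) ^ Q ^ m * X b ^ (2 + Q ^ m) := by
          rw [pow_add]; ac_rfl
      _ ≤ (∏ t ∈ Finset.range b, H t) ^ Q ^ m * X b ^ (Q * Q ^ m) := by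
          gcongr
          exact hXb.le
      _ = 1 := hE

/-- A product in which the `j`-th factor is bounded by `1` for `j ≤ 2 a` and by `X j` after that
is integral after multiplication with `X 0 * H 0`. -/
theorem prod_le_one (P : PoleType Q m a X H) (hQ : 2 ≤ Q) (h0 : X 0 ≤ 1) (hH0 : H 0 ≤ 1)
    {Y : ℕ → Γ} {d : ℕ → ℕ}
    (hd : ∀ j, d j < Q) (hY1 : ∀ j, 1 ≤ j → j ≤ m → j ≤ 2 * a → Y j ≤ 1)
    (hY2 : ∀ j, 1 ≤ j → j ≤ m → 2 * a < j → Y j ≤ X j) :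
    X 0 * H 0 * ∏ j ∈ Finset.range m, Y (j + 1) ^ d (j + 1) ≤ 1 := by
  have hle : ∀ n ≤ m, n ≤ 2 * a → ∏ j ∈ Finset.range n, Y (j + 1) ^ d (j + 1) ≤ 1 :=
    fun n hn hna => Finset.prod_le_one' fun j hj => by
      have := Finset.mem_range.1 hj
      exact pow_le_one₀ zero_le (hY1 (j + 1) (by omega) (by omega) (by omega))
  by_cases hma : m ≤ 2 * a
  · exact mul_le_one' (mul_le_one' h0 hH0) (hle m le_rfl hma)
  have key : ∀ n ≤ m, 2 * a ≤ n → 1 ≤ n →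
      X 0 * H 0 * (∏ j ∈ Finset.range n, Y (j + 1) ^ d (j + 1)) * X n ≤ 1 := by
    intro n
    induction n with
    | zero => omega
    | succ n ih =>
      intro hn hna _
      by_cases hn2 : n + 1 = 2 * a
      · obtain ⟨l, rfl⟩ := Nat.exists_eq_add_of_le (show 1 ≤ a by omega)
        have h1 := P.pole_mul_mirror hQ (l := l) (t := 0) (by omega) (by omega)
        rw [P.small_unit 0 (by omega) (by omega), mul_one, mul_right_comm,
          show n + 1 = 1 + l + 1 + l by omega, mul_comm (X 0), h1, one_mul]
        exact hle _ (by omega) (by omega)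
      · have hXn := P.pole (n + 1) (by omega) hn
        have h1 : Y (n + 1) ^ d (n + 1) * X (n + 1) ≤ X (n + 1) ^ Q := calc
          _ ≤ X (n + 1) ^ d (n + 1) * X (n + 1) := by
            gcongr
            exact hY2 (n + 1) (by omega) hn (by omega)
          _ = X (n + 1) ^ (d (n + 1) + 1) := (pow_succ _ _).symm
          _ ≤ X (n + 1) ^ Q := pow_le_pow_right₀ hXn.le (hd _)
        rw [Finset.prod_range_succ, ← mul_assoc, mul_assoc _ _ (X (n + 1))]
        refine (mul_le_mul_right h1 _).trans ?_
        rcases Nat.eq_zero_or_pos n with rfl | hpos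
        · have ha0 : a = 0 := by omega
          subst ha0
          have := P.pole_first (by omega)
          rw [zero_add] at this ⊢
          rw [Finset.prod_range_zero, mul_one, P.mid (by omega), one_mul, mul_comm, this]
        · rw [P.pole_succ n (by omega) (by omega)]
          exact ih (by omega) (by omega) hpos
  calc _ ≤ X 0 * H 0 * (∏ j ∈ Finset.range m, Y (j + 1) ^ d (j + 1)) * X m :=
        le_mul_of_one_le_right zero_le (P.pole m (by omega) le_rfl).le
    _ ≤ 1 := key m le_rfl (by omega) (by omega)

theorem denominator_mul_le_one (P : PoleType Q m a X H) (hQ : 2 ≤ Q) (h0 : X 0 ≤ 1) (hH0 : H 0 ≤ 1)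
    {j : ℕ} (hj : j ≤ m) : (X 0 * H 0) ^ Q ^ m * X j ≤ 1 := by
  have hQm : Q ^ m ≠ 0 := pow_ne_zero _ (by omega)
  rcases lt_trichotomy j a with h | rfl | h
  · exact mul_le_one' (pow_le_one₀ zero_le (mul_le_one' h0 hH0)) (P.small j h hj).le
  · rw [P.mid hj, mul_one]
    exact pow_le_one₀ zero_le (mul_le_one' h0 hH0)
  · have hja : X j ≤ X (a + 1) := by
      obtain ⟨n, rfl⟩ := Nat.exists_eq_add_of_le (show a + 1 ≤ j from h)
      rw [P.pole_eq_pow hj]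
      exact le_self_pow₀ (P.pole _ h hj).le (pow_ne_zero _ (by omega))
    refine (mul_le_mul_right hja _).trans ?_
    rcases Nat.eq_zero_or_pos a with rfl | hpos
    · have h1 := P.pole_first (by omega)
      rw [P.mid (by omega), one_mul, zero_add]
      rw [zero_add] at h1
      calc H 0 ^ Q ^ m * X 1 ≤ H 0 ^ 1 * X 1 ^ Q := by
            gcongr ?_ * ?_
            · exact pow_le_pow_right_of_le_one' hH0 (Nat.one_le_iff_ne_zero.2 hQm)
            · exact le_self_pow₀ (P.pole 1 (by omega) (by omega)).le (by omega)
        _ = 1 := by rw [pow_one, mul_comm, h1]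
    · rw [P.small_unit 0 hpos (by omega), mul_one]
      have h1 := P.pole_first_mul hQ (t := a - 1) (by omega) (by omega)
      rw [P.small_eq_pow (j := a - 1) (by omega) (by omega)] at h1
      rw [← h1, mul_comm (X (a + 1))]
      gcongr ?_ * _
      exact pow_le_pow_right_of_le_one' h0 (Nat.pow_le_pow_right (by omega) (by omega))

end PoleType

end Abstract

section Valuation

variable {K : Type*} [Field K] {Γ : Type*} [LinearOrderedCommGroupWithZero Γ] {Q m : ℕ}

theorem mul_unitFactor (hQ : 2 ≤ Q) (z : K) : z * unitFactor Q z = z ^ Q + z := by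
  rw [unitFactor, mul_add, mul_one, ← pow_succ', Nat.sub_add_cancel (by omega), add_comm]

theorem unitFactor_of_lt_one (hQ : 2 ≤ Q) (v : Valuation K Γ) {z : K} (hz : v z < 1) :
    v (unitFactor Q z) = 1 := by
  rw [unitFactor, v.map_add_eq_of_lt_left, map_one]
  rw [map_one, map_pow]
  exact pow_lt_one₀ zero_le hz (by omega)

theorem unitFactor_of_one_lt (hQ : 2 ≤ Q) (v : Valuation K Γ) {z : K} (hz : 1 < v z) :
    v (unitFactor Q z) = v z ^ (Q - 1) := by
  rw [unitFactor, v.map_add_eq_of_lt_right, map_pow]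
  rw [map_one, map_pow]
  exact one_lt_pow₀ hz (by omega)

theorem unitFactor_le_one (v : Valuation K Γ) {z : K} (hz : v z ≤ 1) :
    v (unitFactor Q z) ≤ 1 := by
  refine v.map_add_le (by rw [map_one]) ?_
  rw [map_pow]
  exact pow_le_one₀ zero_le hz

theorem le_one_of_artinSchreier_le_one (hQ : 2 ≤ Q) (v : Valuation K Γ) {z : K}
    (hz : v (z ^ Q + z) ≤ 1) : v z ≤ 1 := by
  by_contra! h
  rw [← mul_unitFactor hQ, map_mul, unitFactor_of_one_lt hQ v h, ← pow_succ',
    Nat.sub_add_cancel (by omega)] at hz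
  exact absurd hz (one_lt_pow₀ h (by omega)).not_ge

/-- The `Q ^ m`-th power of a product of initial factors. -/
def towerPower (Q m : ℕ) (x : ℕ → K) (b : ℕ) : K :=
  (∏ t ∈ Finset.range b, unitFactor Q (x t)) ^ Q ^ m

/-- The generator `x j`, corrected by a lower order term so as to have fewer poles. -/
def corrected (Q m : ℕ) (x : ℕ → K) (j : ℕ) : K :=
  x j + ∑ b ∈ Finset.range j with j ≤ 2 * b, x b ^ 2 * towerPower Q m x b * (x (2 * b - j))⁻¹

/-- The polynomial `x 0 ^ Q + x 0` in `x 0`. -/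
def denominator (Q : ℕ) (x : ℕ → K) : K := x 0 * unitFactor Q (x 0)

variable {x : ℕ → K}

namespace IsTower

theorem unitFactor_ne_zero (T : IsTower Q m x) {j : ℕ} (hj : j < m) : unitFactor Q (x j) ≠ 0 := by
  intro h
  have := T.rel j hj
  rw [h, mul_zero] at this
  exact pow_ne_zero _ (T.ne_zero j hj.le) this.symm

theorem artinSchreier_succ (T : IsTower Q m x) {j : ℕ} (hj : j < m) :
    x (j + 1) ^ Q + x (j + 1) = x j ^ Q / unitFactor Q (x j) := by
  rw [eq_div_iff (T.unitFactor_ne_zero hj), T.rel j hj]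

theorem artinSchreier_inv (T : IsTower Q m x) (hQ : 2 ≤ Q) {j : ℕ} (hj : j ≤ m) :
    (x j)⁻¹ ^ Q + (x j)⁻¹ = (x j)⁻¹ ^ Q * unitFactor Q (x j) := by
  obtain ⟨k, rfl⟩ : ∃ k, Q = k + 1 := ⟨Q - 1, by omega⟩
  have := T.ne_zero j hj
  rw [unitFactor, Nat.add_sub_cancel, mul_add, mul_one, pow_succ (x j)⁻¹ k, mul_right_comm, ← mul_pow,
    inv_mul_cancel₀ this, one_pow, one_mul]

theorem type_or (T : IsTower Q m x) (hQ : 2 ≤ Q) (v : Valuation K Γ) (h0 : v (x 0) ≤ 1) :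
    (∀ j ≤ m, v (x j) = 1 ∧ v (unitFactor Q (x j)) = 1) ∨
      ∃ a ≤ m + 1, PoleType Q m a (fun j => v (x j)) (fun j => v (unitFactor Q (x j))) := by
  refine PoleType.of_recursion hQ (fun j _ h => unitFactor_of_lt_one hQ v h)
    (fun j _ h => unitFactor_of_one_lt hQ v h) (fun j _ h => unitFactor_le_one v h.le) ?_
    (fun j hj => (Valuation.ne_zero_iff v).2 (T.ne_zero j hj)) h0
  intro j hj
  rw [← map_mul, ← map_mul, ← map_pow, mul_unitFactor hQ, T.rel j hj]

end IsTower

theorem sub_pow_of_add_pow {n : ℕ} (hadd : ∀ a b : K, (a + b) ^ n = a ^ n + b ^ n) (a b : K) :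
    (a - b) ^ n = a ^ n - b ^ n := by
  rw [eq_sub_iff_add_eq, ← hadd, sub_add_cancel]

theorem sub_pow_pow_of_add_pow (hadd : ∀ a b : K, (a + b) ^ Q = a ^ Q + b ^ Q) (n : ℕ) (a b : K) :
    (a - b) ^ Q ^ n = a ^ Q ^ n - b ^ Q ^ n := by
  induction n with
  | zero => simp
  | succ n ih => rw [pow_succ, pow_mul, ih, sub_pow_of_add_pow hadd, ← pow_mul, ← pow_mul]

/-- The reflected sums `x (a + l) + x a ^ 2 / x (a - l)` are integral. -/
theorem IsTower.mirror_le_one (T : IsTower Q m x) (hQ : 2 ≤ Q)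
    (hadd : ∀ a b : K, (a + b) ^ Q = a ^ Q + b ^ Q) (v : Valuation K Γ) {a : ℕ}
    (P : PoleType Q m a (fun j => v (x j)) (fun j => v (unitFactor Q (x j)))) {l i : ℕ}
    (hil : i + 1 + l = a) (hm : a + 1 + l ≤ m) :
    v (x (a + 1 + l) + x a ^ 2 * (x i)⁻¹) ≤ 1 := by
  have hva : v (x a) = 1 := P.mid (by omega)
  set η := x a ^ Q + x a with hη
  have hηlt : v η < 1 := by
    rw [hη, ← mul_unitFactor hQ, map_mul, hva, one_mul]
    exact P.mid_lt (by omega)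
  have hη0 : η ≠ 0 := by
    rw [hη, ← mul_unitFactor hQ]
    exact mul_ne_zero (T.ne_zero a (by omega)) (T.unitFactor_ne_zero (by omega))
  have hβ : x a ^ Q = η - x a := by rw [hη]; ring
  have htwist (u : K) : (x a ^ 2 * u) ^ Q + x a ^ 2 * u =
      x a ^ 2 * (u ^ Q + u) + (η - x a - x a) * (η * u ^ Q) := by
    rw [mul_pow, ← pow_mul, mul_comm 2 Q, pow_mul, hβ]
    ring
  have hcoef : v (η - x a - x a) ≤ 1 :=
    (v.map_sub_le (v.map_sub_le hηlt.le hva.le) hva.le)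
  have hηa : v η = v (x (a - 1)) ^ Q := by
    rw [hη, ← mul_unitFactor hQ, map_mul, hva, one_mul]
    exact P.mid_eq (a - 1) (by omega) (by omega)
  induction l generalizing i with
  | zero =>
    refine le_one_of_artinSchreier_le_one hQ v ?_
    have hi : i + 1 = a := by omega
    have h1 : (x i)⁻¹ ^ Q + (x i)⁻¹ = η⁻¹ := by
      rw [T.artinSchreier_inv hQ (by omega), hη, ← hi, T.artinSchreier_succ (by omega), inv_div,
        inv_pow]
      ring
    have h2 : x (a + 1) ^ Q + x (a + 1) = (η - x a) * x a / η := by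
      rw [T.artinSchreier_succ (by omega), hβ, hη, ← mul_unitFactor hQ]
      have := T.ne_zero a (by omega)
      have := T.unitFactor_ne_zero (j := a) (by omega)
      field_simp
    have h3 : (x (a + 1 + 0) + x a ^ 2 * (x i)⁻¹) ^ Q + (x (a + 1 + 0) + x a ^ 2 * (x i)⁻¹) =
        x a + (η - x a - x a) * (η * (x i)⁻¹ ^ Q) := by
      rw [add_zero, hadd, add_add_add_comm, htwist, h1, h2]
      field_simp
      ring
    rw [h3]
    refine v.map_add_le hva.le ?_
    rw [map_mul]
    refine mul_le_one' hcoef ?_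
    rw [map_mul, hηa, map_pow, map_inv₀, ← mul_pow, show a - 1 = i by omega, mul_inv_cancel₀,
      one_pow]
    exact (Valuation.ne_zero_iff v).2 (T.ne_zero i (by omega))
  | succ l ih =>
    refine le_one_of_artinSchreier_le_one hQ v ?_
    have hprev := ih (i := i + 1) (by omega) (by omega)
    set j := a + 1 + l with hj
    have hxi := T.ne_zero (i + 1) (by omega)
    have hxj := T.ne_zero j (by omega)
    have hui := T.unitFactor_ne_zero (j := i + 1) (by omega)
    have huj := T.unitFactor_ne_zero (j := j) (by omega)
    have h1 : (x i)⁻¹ ^ Q + (x i)⁻¹ = (x (i + 1))⁻¹ -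
        x (i + 1) ^ (Q - 2) * (unitFactor Q (x (i + 1)))⁻¹ := by
      have hrel := T.rel i (by omega)
      rw [← mul_unitFactor hQ] at hrel
      have hx0 := T.ne_zero i (by omega)
      have hu0 := T.unitFactor_ne_zero (j := i) (by omega)
      have e1 : (x i)⁻¹ ^ Q + (x i)⁻¹ = (x (i + 1) * unitFactor Q (x (i + 1)))⁻¹ := by
        rw [T.artinSchreier_inv hQ (by omega), inv_pow, ← hrel]
        field_simp
      have e2 : x (i + 1) * x (i + 1) ^ (Q - 2) = unitFactor Q (x (i + 1)) - 1 := by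
        rw [unitFactor, ← pow_succ', show Q - 2 + 1 = Q - 1 by omega, add_sub_cancel_left]
      rw [e1]
      field_simp
      rw [e2]
      ring
    have h2 : x (j + 1) ^ Q + x (j + 1) = x j - x j * (unitFactor Q (x j))⁻¹ := by
      rw [T.artinSchreier_succ (by omega)]
      have e2 : x j ^ Q = x j * (unitFactor Q (x j) - 1) := by
        rw [unitFactor, add_sub_cancel_left, ← pow_succ', Nat.sub_add_cancel (by omega)]
      rw [e2]
      field_simp
    have h3 : (x (j + 1) + x a ^ 2 * (x i)⁻¹) ^ Q + (x (j + 1) + x a ^ 2 * (x i)⁻¹) =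
        (x j + x a ^ 2 * (x (i + 1))⁻¹) - x j * (unitFactor Q (x j))⁻¹ -
          x a ^ 2 * (x (i + 1) ^ (Q - 2) * (unitFactor Q (x (i + 1)))⁻¹) +
          (η - x a - x a) * (η * (x i)⁻¹ ^ Q) := by
      rw [hadd, add_add_add_comm, htwist, h1, h2]
      ring
    rw [show a + 1 + (l + 1) = j + 1 by omega, h3]
    have hPj : 1 < v (x j) := P.pole j (by omega) (by omega)
    have hHj : v (unitFactor Q (x j)) = v (x j) ^ (Q - 1) := P.pole_unit j (by omega) (by omega)
    have hHi : v (unitFactor Q (x (i + 1))) = 1 := P.small_unit (i + 1) (by omega) (by omega)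
    have hPi : v (x (i + 1)) < 1 := P.small (i + 1) (by omega) (by omega)
    have hQi : v (x (i + 1)) = v (x i) ^ Q := P.small_succ i (by omega) (by omega)
    have hmono : v (x (a - 1)) ≤ v (x (i + 1)) :=
      P.small_antitone hQ (i := i + 1) (j := a - 1) (by omega) (by omega) (by omega)
    refine v.map_add_le (v.map_sub_le (v.map_sub_le hprev ?_) ?_) ?_
    · rw [map_mul, map_inv₀, hHj, ← div_eq_mul_inv]
      exact div_le_one_of_le₀ (le_self_pow₀ hPj.le (by omega)) zero_le
    · rw [map_mul, map_pow, hva, one_pow, one_mul, map_mul, map_inv₀, hHi, inv_one, mul_one, map_pow]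
      exact pow_le_one₀ zero_le hPi.le
    · rw [map_mul]
      refine mul_le_one' hcoef ?_
      rw [map_mul, map_pow, map_inv₀, inv_pow, ← hQi, ← div_eq_mul_inv, hηa]
      refine div_le_one_of_le₀ ?_ zero_le
      exact (pow_le_of_le_one zero_le (hmono.trans hPi.le) (by omega)).trans hmono

theorem PoleType.prod_unitFactor_sub_one_le (v : Valuation K Γ) (hQ : 2 ≤ Q) {a : ℕ}
    (P : PoleType Q m a (fun j => v (x j)) (fun j => v (unitFactor Q (x j)))) {n : ℕ}
    (hn : n ≤ a) (hnm : n ≤ m + 1) :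
    v (∏ t ∈ Finset.range n, unitFactor Q (x t) - 1) ≤ v (x 0) := by
  induction n with
  | zero => simp
  | succ n ih =>
    have h1 : v (unitFactor Q (x n)) = 1 := P.small_unit n hn (by omega)
    rw [Finset.prod_range_succ, show ∀ a b : K, a * b - 1 = (a - 1) * b + (b - 1) by intros; ring]
    refine v.map_add_le ?_ ?_
    · rw [map_mul, h1, mul_one]
      exact ih (by omega) (by omega)
    · rw [unitFactor, add_sub_cancel_left, map_pow]
      exact (pow_le_of_le_one zero_le (P.small n hn (by omega)).le (by omega)).trans
        (P.small_antitone hQ (Nat.zero_le n) hn (by omega))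

variable (T : IsTower Q m x) (hQ : 2 ≤ Q)

include T hQ

/-- A single correction term, up to the one which compensates a pole, is integral. -/
theorem IsTower.correction_le_one (v : Valuation K Γ) {a : ℕ}
    (P : PoleType Q m a (fun j => v (x j)) (fun j => v (unitFactor Q (x j)))) {b i : ℕ}
    (hib : i < b) (hba : b ≠ a) (hbm : b ≤ m) :
    v (x b ^ 2 * towerPower Q m x b * (x i)⁻¹) ≤ 1 := by
  have := P.correction_le_one hQ (fun j hj => (Valuation.ne_zero_iff v).2 (T.ne_zero j hj)) hib hba
    hbm
  simpa [towerPower, map_mul, map_pow, map_prod, map_inv₀] using this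

theorem IsTower.corrected_le (hadd : ∀ a b : K, (a + b) ^ Q = a ^ Q + b ^ Q) (v : Valuation K Γ)
    {a : ℕ} (P : PoleType Q m a (fun j => v (x j)) (fun j => v (unitFactor Q (x j)))) {j : ℕ}
    (hj1 : 1 ≤ j) (hjm : j ≤ m) :
    (j ≤ 2 * a → v (corrected Q m x j) ≤ 1) ∧ (2 * a < j → v (corrected Q m x j) ≤ v (x j)) := by
  have hterm : ∀ b ∈ (Finset.range j).filter (j ≤ 2 * ·), b ≠ a →
      v (x b ^ 2 * towerPower Q m x b * (x (2 * b - j))⁻¹) ≤ 1 := by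
    intro b hb hba
    obtain ⟨h1, h2⟩ := Finset.mem_filter.1 hb
    have := Finset.mem_range.1 h1
    exact T.correction_le_one hQ v P (by omega) hba (by omega)
  constructor
  · intro hja
    by_cases haj : a < j
    · have hmem : a ∈ (Finset.range j).filter (j ≤ 2 * ·) := by simp [haj, hja]
      rw [corrected, ← Finset.add_sum_erase _ _ hmem, ← add_assoc]
      refine v.map_add_le ?_ (v.map_sum_le fun b hb =>
        hterm b (Finset.mem_of_mem_erase hb) (Finset.ne_of_mem_erase hb))
      obtain ⟨l, rfl⟩ := Nat.exists_eq_add_of_le (show a + 1 ≤ j from haj)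
      set i := 2 * a - (a + 1 + l) with hi
      have hmir := T.mirror_le_one hQ hadd v P (l := l) (i := i) (by omega) hjm
      have hva : v (x a) = 1 := P.mid (by omega)
      have hsplit : x (a + 1 + l) + x a ^ 2 * towerPower Q m x a * (x i)⁻¹ =
          (x (a + 1 + l) + x a ^ 2 * (x i)⁻¹) +
            x a ^ 2 * ((towerPower Q m x a - 1) * (x i)⁻¹) := by ring
      rw [hsplit]
      refine v.map_add_le hmir ?_
      rw [map_mul, map_pow, hva, one_pow, one_mul, map_mul, map_inv₀, ← div_eq_mul_inv]
      refine div_le_one_of_le₀ ?_ zero_le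
      have h0 : v (x 0) < 1 := P.small 0 (by omega) (by omega)
      have hxi : v (x i) = v (x 0) ^ Q ^ i := P.small_eq_pow (j := i) (by omega) (by omega)
      rw [towerPower, ← one_pow (Q ^ m), ← sub_pow_pow_of_add_pow hadd, map_pow, hxi]
      calc _ ≤ v (x 0) ^ Q ^ m := by
            gcongr
            exact P.prod_unitFactor_sub_one_le v hQ le_rfl (by omega)
        _ ≤ _ := pow_le_pow_right_of_le_one' h0.le (Nat.pow_le_pow_right (by omega) (by omega))
    · have hxj : v (x j) ≤ 1 := by
        rcases Nat.lt_or_eq_of_le (not_lt.1 haj) with h | rfl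
        · exact (P.small j h hjm).le
        · exact (P.mid hjm).le
      refine v.map_add_le hxj (v.map_sum_le fun b hb => hterm b hb ?_)
      have := Finset.mem_range.1 (Finset.mem_filter.1 hb).1
      omega
  · intro haj
    refine v.map_add_le le_rfl (v.map_sum_le fun b hb => (hterm b hb ?_).trans ?_)
    · have := (Finset.mem_filter.1 hb).2
      omega
    · exact (P.pole j (by omega) hjm).le

omit T hQ in
theorem denominator_le_one (v : Valuation K Γ) (h0 : v (x 0) ≤ 1) : v (denominator Q x) ≤ 1 := by
  rw [denominator, map_mul]
  exact mul_le_one' h0 (unitFactor_le_one v h0)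

theorem IsTower.denominator_mul_prod_corrected_le_one
    (hadd : ∀ a b : K, (a + b) ^ Q = a ^ Q + b ^ Q) (v : Valuation K Γ) (h0 : v (x 0) ≤ 1)
    {d : ℕ → ℕ} (hd : ∀ j, d j < Q) :
    v (denominator Q x * ∏ j ∈ Finset.range m, corrected Q m x (j + 1) ^ d (j + 1)) ≤ 1 := by
  rcases T.type_or hQ v h0 with hgen | ⟨a, -, P⟩
  · rw [map_mul, map_prod]
    refine mul_le_one' (denominator_le_one v h0) (Finset.prod_le_one' fun j hj => ?_)
    have hjm := Finset.mem_range.1 hj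
    rw [map_pow]
    refine pow_le_one₀ zero_le (v.map_add_le (hgen _ hjm).1.le (v.map_sum_le fun b hb => ?_))
    obtain ⟨h1, h2⟩ := Finset.mem_filter.1 hb
    have hb1 := Finset.mem_range.1 h1
    rw [map_mul, map_mul, map_pow, towerPower, map_pow, map_prod, map_inv₀, (hgen b (by omega)).1,
      (hgen _ (by omega)).1, Finset.prod_eq_one]
    · simp
    · intro t ht
      have := Finset.mem_range.1 ht
      exact (hgen t (by omega)).2
  · have h1 : v (unitFactor Q (x 0)) ≤ 1 := unitFactor_le_one v h0
    have := P.prod_le_one hQ h0 h1 (Y := fun j => v (corrected Q m x j)) hd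
      (fun j hj1 hjm => (T.corrected_le hQ hadd v P hj1 hjm).1)
      (fun j hj1 hjm => (T.corrected_le hQ hadd v P hj1 hjm).2)
    simpa [denominator, map_mul, map_prod, map_pow] using this

theorem IsTower.denominator_pow_mul_le_one (v : Valuation K Γ) (h0 : v (x 0) ≤ 1) {j : ℕ}
    (hj : j ≤ m) : v (denominator Q x ^ Q ^ m * x j) ≤ 1 := by
  rcases T.type_or hQ v h0 with hgen | ⟨a, -, P⟩
  · rw [map_mul, map_pow, (hgen j hj).1, mul_one]
    exact pow_le_one₀ zero_le (denominator_le_one v h0)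
  · have := P.denominator_mul_le_one hQ h0 (unitFactor_le_one v h0) hj
    simpa [denominator, map_mul, map_pow] using this

end Valuation

section Combinations

variable {K : Type*} [Field K]

/-- Combinations of the first `n` terms of the sequence `e` with coefficients in `Y`. -/
def combination (Y : Subring K) (e : ℕ → K) (n : ℕ) : AddSubgroup K where
  carrier := {f | ∃ σ : ℕ → K, (∀ i, σ i ∈ Y) ∧ f = ∑ i ∈ Finset.range n, σ i * e i}
  zero_mem' := ⟨fun _ => 0, fun _ => Y.zero_mem, by simp⟩
  add_mem' := by
    rintro _ _ ⟨σ, hσ, rfl⟩ ⟨τ, hτ, rfl⟩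
    exact ⟨fun i => σ i + τ i, fun i => Y.add_mem (hσ i) (hτ i), by
      simp only [add_mul, Finset.sum_add_distrib]⟩
  neg_mem' := by
    rintro _ ⟨σ, hσ, rfl⟩
    exact ⟨fun i => -σ i, fun i => Y.neg_mem (hσ i), by simp⟩

namespace combination

variable {Y Y' : Subring K} {e : ℕ → K} {n n' : ℕ}

theorem mul_mem {y f : K} (hy : y ∈ Y) (hf : f ∈ combination Y e n) :
    y * f ∈ combination Y e n := by
  obtain ⟨σ, hσ, rfl⟩ := hf
  exact ⟨fun i => y * σ i, fun i => Y.mul_mem hy (hσ i), by simp only [Finset.mul_sum, mul_assoc]⟩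

theorem basis_mem {i : ℕ} (hi : i < n) : e i ∈ combination Y e n :=
  ⟨fun j => if j = i then 1 else 0, fun j => by
    dsimp only
    split_ifs
    exacts [Y.one_mem, Y.zero_mem], by simp [hi]⟩

theorem le_of (hY : Y ≤ Y') (hn : n ≤ n') : combination Y e n ≤ combination Y' e n' := by
  rintro _ ⟨σ, hσ, rfl⟩
  refine AddSubgroup.sum_mem _ fun i hi => mul_mem (hY (hσ i)) (basis_mem ?_)
  exact (Finset.mem_range.1 hi).trans_le hn

theorem le_of_forall {V : AddSubgroup K} (hV : ∀ y ∈ Y, ∀ i < n, y * e i ∈ V) :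
    combination Y e n ≤ V := by
  rintro _ ⟨σ, hσ, rfl⟩
  exact AddSubgroup.sum_mem _ fun i hi => hV _ (hσ i) i (Finset.mem_range.1 hi)

/-- Reduction modulo a triangular family: if `t i` agrees with `N * e i` up to lower terms, every
combination of the `e i` is, modulo combinations of the `t i`, a combination with coefficients
reduced modulo `N`. -/
theorem exists_reduced {t : ℕ → K} {N : K} {red : Set K}
    (hred : ∀ y ∈ Y, ∃ ρ ∈ red, ∃ π ∈ Y, y = π * N + ρ)
    (ht : ∀ i < n, t i - N * e i ∈ combination Y e i) {f : K} (hf : f ∈ combination Y e n) :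
    ∃ ρ : ℕ → K, (∀ i < n, ρ i ∈ red) ∧ f - ∑ i ∈ Finset.range n, ρ i * e i ∈ combination Y t n := by
  induction n generalizing f with
  | zero =>
    obtain ⟨σ, -, rfl⟩ := hf
    exact ⟨fun _ => 0, by simp, by simp⟩
  | succ n ih =>
    obtain ⟨σ, hσ, rfl⟩ := hf
    obtain ⟨ρn, hρn, π, hπ, hdiv⟩ := hred (σ n) (hσ n)
    have hlow : ∑ i ∈ Finset.range n, σ i * e i - π * (t n - N * e n) ∈ combination Y e n :=
      AddSubgroup.sub_mem _ ⟨σ, hσ, rfl⟩ (mul_mem hπ (ht n (by omega)))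
    obtain ⟨ρ, hρ, hmem⟩ := ih (fun i hi => ht i (by omega)) hlow
    refine ⟨Function.update ρ n ρn, fun i hi => ?_, ?_⟩
    · rcases Nat.lt_succ_iff_lt_or_eq.1 hi with h | rfl
      · rw [Function.update_of_ne h.ne]
        exact hρ i h
      · rwa [Function.update_self]
    · have hsum : ∑ i ∈ Finset.range n, Function.update ρ n ρn i * e i =
          ∑ i ∈ Finset.range n, ρ i * e i := Finset.sum_congr rfl fun i hi => by
        rw [Function.update_of_ne (Finset.mem_range.1 hi).ne]
      rw [Finset.sum_range_succ, Finset.sum_range_succ, hsum, Function.update_self, hdiv]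
      have h1 := AddSubgroup.add_mem _ (le_of (le_refl Y) (Nat.le_succ n) hmem)
        (mul_mem hπ (basis_mem (Y := Y) (e := t) (Nat.lt_succ_self n)))
      convert h1 using 1
      ring

end combination

variable {Γ : Type*} [LinearOrderedCommGroupWithZero Γ]

/-- A sum of elements of distinct valuations has the valuation of one of them. -/
theorem Valuation.exists_map_sum_eq {ι : Type*} (w : Valuation K Γ) (s : Finset ι) (f : ι → K)
    (hf : ∀ i ∈ s, ∀ i' ∈ s, f i ≠ 0 → f i' ≠ 0 → w (f i) = w (f i') → i = i')
    (hne : ∃ i ∈ s, f i ≠ 0) : ∃ i ∈ s, f i ≠ 0 ∧ w (∑ i ∈ s, f i) = w (f i) := by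
  classical
  induction s using Finset.induction_on with
  | empty => simp at hne
  | insert a s ha ih =>
    rw [Finset.sum_insert ha]
    by_cases hs : ∃ i ∈ s, f i ≠ 0
    · obtain ⟨i, hi, hfi, hw⟩ := ih (fun i hi i' hi' =>
        hf i (Finset.mem_insert_of_mem hi) i' (Finset.mem_insert_of_mem hi')) hs
      by_cases hfa : f a = 0
      · exact ⟨i, Finset.mem_insert_of_mem hi, hfi, by rw [hfa, zero_add, hw]⟩
      have hne' : w (f a) ≠ w (∑ i ∈ s, f i) := by
        rw [hw]
        intro h
        have := hf a (Finset.mem_insert_self a s) i (Finset.mem_insert_of_mem hi) hfa hfi h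
        exact ha (this ▸ hi)
      rcases lt_or_gt_of_ne hne' with h | h
      · exact ⟨i, Finset.mem_insert_of_mem hi, hfi, by rw [w.map_add_eq_of_lt_right h, hw]⟩
      · exact ⟨a, Finset.mem_insert_self a s, hfa, w.map_add_eq_of_lt_left h⟩
    · push Not at hs
      obtain ⟨i, hi, hfi⟩ := hne
      rcases Finset.mem_insert.1 hi with rfl | h
      · exact ⟨i, hi, hfi, by rw [Finset.sum_eq_zero hs, add_zero]⟩
      · exact absurd (hs i h) hfi

end Combinations

section Ring

open Polynomial

variable {K : Type*} [Field K] (p : ℕ) [Algebra (ZMod p) K] {Q m : ℕ}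

/-- The elements of `K` which a power of `D` multiplies into `R`. -/
def Subring.localizedAt (R : Subring K) {D : K} (hD : D ∈ R) : Subring K where
  carrier := {f | ∃ B : ℕ, D ^ B * f ∈ R}
  mul_mem' := by
    rintro f g ⟨B, hB⟩ ⟨C, hC⟩
    refine ⟨B + C, ?_⟩
    rw [pow_add, mul_mul_mul_comm]
    exact R.mul_mem hB hC
  one_mem' := ⟨0, by simp⟩
  add_mem' := by
    rintro f g ⟨B, hB⟩ ⟨C, hC⟩
    refine ⟨B + C, ?_⟩
    have : D ^ (B + C) * (f + g) = D ^ C * (D ^ B * f) + D ^ B * (D ^ C * g) := by ring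
    rw [this]
    exact R.add_mem (R.mul_mem (R.pow_mem hD _) hB) (R.mul_mem (R.pow_mem hD _) hC)
  zero_mem' := ⟨0, by simp⟩
  neg_mem' := by
    rintro f ⟨B, hB⟩
    exact ⟨B, by rw [mul_neg]; exact R.neg_mem hB⟩

/-- The ring of polynomials in `x 0` over the prime field. -/
noncomputable def polyRing (x : ℕ → K) : Subring K := (aeval (R := ZMod p) (x 0)).toRingHom.range

variable {p} in
theorem mem_polyRing {x : ℕ → K} {f : K} :
    f ∈ polyRing p x ↔ ∃ P : (ZMod p)[X], aeval (x 0) P = f := Iff.rfl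

theorem gen_mem_polyRing (x : ℕ → K) : x 0 ∈ polyRing p x := ⟨X, by simp⟩

theorem denominator_mem_polyRing (Q : ℕ) (x : ℕ → K) : denominator Q x ∈ polyRing p x :=
  Subring.mul_mem _ (gen_mem_polyRing p x) (Subring.add_mem _ (Subring.one_mem _)
    (Subring.pow_mem _ (gen_mem_polyRing p x) _))

/-- Polynomials in `x 0` with powers of the denominator inverted. -/
noncomputable def baseRing (Q : ℕ) (x : ℕ → K) : Subring K :=
  (polyRing p x).localizedAt (denominator_mem_polyRing p Q x)

/-- The rings obtained by adjoining the generators of the tower one at a time. -/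
noncomputable def towerRing (Q : ℕ) (x : ℕ → K) : ℕ → Subring K
  | 0 => baseRing p Q x
  | j + 1 => (eval₂RingHom (towerRing Q x j).subtype (x (j + 1))).range

variable {p} {x : ℕ → K}

theorem mem_baseRing {f : K} :
    f ∈ baseRing p Q x ↔ ∃ B : ℕ, denominator Q x ^ B * f ∈ polyRing p x := Iff.rfl

theorem polyRing_le_baseRing : polyRing p x ≤ baseRing p Q x := fun f hf => ⟨0, by simpa using hf⟩

theorem towerRing_le_succ (j : ℕ) : towerRing p Q x j ≤ towerRing p Q x (j + 1) :=
  fun f hf => ⟨C ⟨f, hf⟩, by simp⟩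

theorem towerRing_mono {i j : ℕ} (h : i ≤ j) : towerRing p Q x i ≤ towerRing p Q x j := by
  induction j, h using Nat.le_induction with
  | base => exact le_rfl
  | succ j _ ih => exact ih.trans (towerRing_le_succ j)

theorem gen_succ_mem_towerRing (j : ℕ) : x (j + 1) ∈ towerRing p Q x (j + 1) := ⟨X, by simp⟩

/-- The value `x j ^ Q / (1 + x j ^ (Q - 1))` of the Artin-Schreier polynomial at `x (j + 1)`. -/
def towerConst (Q : ℕ) (x : ℕ → K) (j : ℕ) : K := x j ^ Q / unitFactor Q (x j)

theorem inv_denominator_mem_baseRing : (denominator Q x)⁻¹ ∈ baseRing p Q x := by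
  refine ⟨1, ?_⟩
  rw [pow_one]
  by_cases h : denominator Q x = 0
  · simp [h]
  · rw [mul_inv_cancel₀ h]
    exact Subring.one_mem _

namespace IsTower

theorem units_mem (T : IsTower Q m x) (hQ : 2 ≤ Q) {j : ℕ} (hj : j ≤ m) :
    x j ∈ towerRing p Q x j ∧ (x j)⁻¹ ∈ towerRing p Q x j ∧
      (unitFactor Q (x j))⁻¹ ∈ towerRing p Q x j := by
  have hfac : ∀ j, x j ∈ towerRing p Q x j → unitFactor Q (x j) ∈ towerRing p Q x j := fun j h =>
    Subring.add_mem _ (Subring.one_mem _) (Subring.pow_mem _ h _)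
  induction j with
  | zero =>
    have hx : x 0 ∈ towerRing p Q x 0 := polyRing_le_baseRing (gen_mem_polyRing p x)
    have hD : (denominator Q x)⁻¹ ∈ towerRing p Q x 0 := inv_denominator_mem_baseRing
    have h0 := T.ne_zero 0 hj
    by_cases hu : unitFactor Q (x 0) = 0
    · refine ⟨hx, ?_, by simp [hu]⟩
      have hxx : (x 0)⁻¹ = -(x 0) ^ (Q - 2) := by
        rw [inv_eq_iff_eq_inv, eq_comm, inv_eq_of_mul_eq_one_right]
        rw [neg_mul, ← pow_succ, show Q - 2 + 1 = Q - 1 by omega]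
        rw [unitFactor] at hu
        linear_combination -hu
      rw [hxx]
      exact Subring.neg_mem _ (Subring.pow_mem _ hx _)
    · refine ⟨hx, ?_, ?_⟩
      · have : (x 0)⁻¹ = unitFactor Q (x 0) * (denominator Q x)⁻¹ := by
          rw [denominator]
          field_simp
        rw [this]
        exact Subring.mul_mem _ (hfac 0 hx) hD
      · have : (unitFactor Q (x 0))⁻¹ = x 0 * (denominator Q x)⁻¹ := by
          rw [denominator]
          field_simp
        rw [this]
        exact Subring.mul_mem _ hx hD
  | succ j ih =>
    obtain ⟨h1, h2, h3⟩ := ih (by omega)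
    have hx : x (j + 1) ∈ towerRing p Q x (j + 1) := gen_succ_mem_towerRing j
    have hc : x (j + 1) * unitFactor Q (x (j + 1)) = x j ^ Q / unitFactor Q (x j) := by
      rw [mul_unitFactor hQ, T.artinSchreier_succ hj]
    have hc' : (x (j + 1) * unitFactor Q (x (j + 1)))⁻¹ ∈ towerRing p Q x (j + 1) := by
      rw [hc, inv_div, div_eq_mul_inv, ← inv_pow]
      exact towerRing_le_succ j (Subring.mul_mem _ (hfac j h1) (Subring.pow_mem _ h2 _))
    have hx0 := T.ne_zero (j + 1) hj
    have hu0 : unitFactor Q (x (j + 1)) ≠ 0 := by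
      intro h
      rw [h, mul_zero] at hc
      exact div_ne_zero (pow_ne_zero _ (T.ne_zero j (by omega))) (T.unitFactor_ne_zero hj) hc.symm
    refine ⟨hx, ?_, ?_⟩
    · have : (x (j + 1))⁻¹ = unitFactor Q (x (j + 1)) *
          (x (j + 1) * unitFactor Q (x (j + 1)))⁻¹ := by field_simp
      rw [this]
      exact Subring.mul_mem _ (hfac _ hx) hc'
    · have : (unitFactor Q (x (j + 1)))⁻¹ = x (j + 1) *
          (x (j + 1) * unitFactor Q (x (j + 1)))⁻¹ := by field_simp
      rw [this]
      exact Subring.mul_mem _ hx hc'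

theorem towerConst_mem (T : IsTower Q m x) (hQ : 2 ≤ Q) {j : ℕ} (hj : j ≤ m) :
    towerConst Q x j ∈ towerRing p Q x j := by
  obtain ⟨h1, -, h3⟩ := T.units_mem (p := p) hQ hj
  rw [towerConst, div_eq_mul_inv]
  exact Subring.mul_mem _ (Subring.pow_mem _ h1 _) h3

end IsTower

/-- The Artin-Schreier polynomial `X ^ Q + X - c`. -/
noncomputable def asPoly {R : Type*} [CommRing R] (Q : ℕ) (c : R) : R[X] := X ^ Q + (X - C c)

theorem asPoly_monic {R : Type*} [CommRing R] (hQ : 2 ≤ Q) (c : R) : (asPoly Q c).Monic := by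
  nontriviality R
  refine monic_X_pow_add ?_
  refine (degree_X_sub_C_le c).trans_lt ?_
  exact_mod_cast (by omega : 1 < Q)

theorem natDegree_asPoly {R : Type*} [CommRing R] [Nontrivial R] (hQ : 2 ≤ Q) (c : R) :
    (asPoly Q c).natDegree = Q := by
  rw [asPoly, natDegree_add_eq_left_of_natDegree_lt]
  · simp
  · rw [natDegree_X_sub_C, natDegree_X_pow]
    omega

theorem IsTower.mem_towerRing_succ (T : IsTower Q m x) (hQ : 2 ≤ Q) {j : ℕ} (hj : j < m) {f : K} :
    f ∈ towerRing p Q x (j + 1) ↔ f ∈ combination (towerRing p Q x j) (fun s => x (j + 1) ^ s) Q := by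
  constructor
  · rintro ⟨P, rfl⟩
    have hc := T.towerConst_mem (p := p) hQ hj.le
    set F : (towerRing p Q x j)[X] := asPoly Q ⟨towerConst Q x j, hc⟩ with hF
    have hFm : F.Monic := asPoly_monic hQ _
    have hF0 : eval₂ (towerRing p Q x j).subtype (x (j + 1)) F = 0 := by
      rw [hF, asPoly]
      simp only [eval₂_add, eval₂_sub, eval₂_pow, eval₂_X, eval₂_C, Subring.subtype_apply]
      rw [towerConst, ← T.artinSchreier_succ hj]
      ring
    have hlt : (P %ₘ F).natDegree < Q := by
      have := natDegree_modByMonic_lt P hFm (by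
        intro h1
        have := natDegree_asPoly hQ (⟨towerConst Q x j, hc⟩ : towerRing p Q x j)
        rw [← hF, h1, natDegree_one] at this
        omega)
      rwa [hF, natDegree_asPoly hQ] at this
    have hval : eval₂ (towerRing p Q x j).subtype (x (j + 1)) P =
        eval₂ (towerRing p Q x j).subtype (x (j + 1)) (P %ₘ F) := by
      conv_lhs => rw [← modByMonic_add_div P F, eval₂_add, eval₂_mul, hF0, zero_mul, add_zero]
    refine ⟨fun s => ((P %ₘ F).coeff s : K), fun s => ((P %ₘ F).coeff s).2, ?_⟩
    rw [coe_eval₂RingHom, hval, eval₂_eq_sum_range' _ hlt]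
    rfl
  · rintro ⟨σ, hσ, rfl⟩
    exact Subring.sum_mem _ fun s _ => Subring.mul_mem _ (towerRing_le_succ j (hσ s))
      (Subring.pow_mem _ (gen_succ_mem_towerRing j) s)

end Ring

section Monomials

variable {K : Type*} [Field K]

/-- The monomial in `y 1, …, y j` whose exponents are the base `Q` digits of `i`. -/
def digitMonomial (Q : ℕ) (y : ℕ → K) : ℕ → ℕ → K
  | 0, _ => 1
  | j + 1, i => digitMonomial Q y j (i % Q ^ j) * y (j + 1) ^ (i / Q ^ j)

/-- The number obtained by reversing the `j` lowest base `Q` digits of `i`. -/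
def digitReverse (Q : ℕ) : ℕ → ℕ → ℕ
  | 0, _ => 0
  | j + 1, i => Q * digitReverse Q j (i % Q ^ j) + i / Q ^ j

theorem digitReverse_lt {Q : ℕ} {j i : ℕ} (hQ : 0 < Q) (hi : i < Q ^ j) :
    digitReverse Q j i < Q ^ j := by
  induction j generalizing i with
  | zero => simp [digitReverse]
  | succ j ih =>
    have h1 := ih (Nat.mod_lt i (pow_pos hQ j))
    have h2 : i / Q ^ j < Q := Nat.div_lt_of_lt_mul (by rwa [← pow_succ])
    rw [digitReverse, pow_succ']
    calc _ < Q * digitReverse Q j (i % Q ^ j) + Q := by omega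
      _ = Q * (digitReverse Q j (i % Q ^ j) + 1) := by ring
      _ ≤ Q * Q ^ j := Nat.mul_le_mul_left _ h1

theorem digitReverse_injOn {Q : ℕ} {j i i' : ℕ} (hQ : 0 < Q) (hi : i < Q ^ j) (hi' : i' < Q ^ j)
    (h : digitReverse Q j i = digitReverse Q j i') : i = i' := by
  induction j generalizing i i' with
  | zero => simp at hi hi'; omega
  | succ j ih =>
    have h2 : i / Q ^ j < Q := Nat.div_lt_of_lt_mul (by rwa [← pow_succ])
    have h2' : i' / Q ^ j < Q := Nat.div_lt_of_lt_mul (by rwa [← pow_succ])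
    simp only [digitReverse] at h
    have e1 : i / Q ^ j = i' / Q ^ j := by
      have := congrArg (· % Q) h
      simpa [Nat.mul_add_mod, Nat.mod_eq_of_lt h2, Nat.mod_eq_of_lt h2'] using this
    rw [e1, Nat.add_right_cancel_iff] at h
    have e2 := ih (Nat.mod_lt i (pow_pos hQ j)) (Nat.mod_lt i' (pow_pos hQ j))
      (Nat.eq_of_mul_eq_mul_left hQ h)
    rw [← Nat.mod_add_div i (Q ^ j), ← Nat.mod_add_div i' (Q ^ j), e1, e2]

theorem digitMonomial_succ_mul_add {Q : ℕ} (y : ℕ → K) {j i : ℕ} (hi : i < Q ^ j) (s : ℕ) :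
    digitMonomial Q y (j + 1) (s * Q ^ j + i) = digitMonomial Q y j i * y (j + 1) ^ s := by
  rw [digitMonomial, mul_comm s, Nat.mul_add_mod, Nat.mod_eq_of_lt hi, Nat.mul_add_div (by omega),
    Nat.div_eq_of_lt hi, add_zero]

theorem exists_digitMonomial_eq_prod {Q : ℕ} (hQ : 0 < Q) (y : ℕ → K) {j i : ℕ} (hi : i < Q ^ j) :
    ∃ d : ℕ → ℕ, (∀ l, d l < Q) ∧
      digitMonomial Q y j i = ∏ l ∈ Finset.range j, y (l + 1) ^ d (l + 1) := by
  induction j generalizing i with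
  | zero => exact ⟨fun _ => 0, fun _ => hQ, by simp [digitMonomial]⟩
  | succ j ih =>
    obtain ⟨d, hd, h⟩ := ih (Nat.mod_lt i (pow_pos hQ j))
    refine ⟨Function.update d (j + 1) (i / Q ^ j), fun l => ?_, ?_⟩
    · rcases eq_or_ne l (j + 1) with rfl | hl
      · rw [Function.update_self]
        exact Nat.div_lt_of_lt_mul (by rwa [← pow_succ])
      · rw [Function.update_of_ne hl]
        exact hd l
    · rw [Finset.prod_range_succ, Function.update_self, digitMonomial, h]
      congr 1
      refine Finset.prod_congr rfl fun l hl => ?_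
      rw [Function.update_of_ne]
      have := Finset.mem_range.1 hl
      omega

end Monomials

section Values

open Polynomial

variable {K : Type*} [Field K] {p : ℕ} [Algebra (ZMod p) K] [Fact p.Prime] {Q m : ℕ} {x : ℕ → K}
  {Γ : Type*} [LinearOrderedCommGroupWithZero Γ] {w : Valuation K Γ}

theorem Valuation.map_algebraMap_zmod (w : Valuation K Γ) {c : ZMod p} (hc : c ≠ 0) :
    w (algebraMap (ZMod p) K c) = 1 := by
  have hp : p - 1 ≠ 0 := by
    have := (Fact.out : p.Prime).two_le
    omega
  refine (pow_left_inj₀ zero_le zero_le hp).1 ?_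
  rw [one_pow, ← map_pow, ← map_pow, ZMod.pow_card_sub_one_eq_one hc, map_one, map_one]

theorem Valuation.map_algebraMap_zmod_le (w : Valuation K Γ) (c : ZMod p) :
    w (algebraMap (ZMod p) K c) ≤ 1 := by
  by_cases hc : c = 0
  · simp [hc]
  · exact (w.map_algebraMap_zmod hc).le

theorem Valuation.map_aeval_le (w : Valuation K Γ) {y : K} (hy : 1 ≤ w y) (P : (ZMod p)[X]) {n : ℕ}
    (hn : P.natDegree ≤ n) : w (aeval y P) ≤ w y ^ n := by
  rw [aeval_eq_sum_range]
  refine w.map_sum_le fun i hi => ?_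
  rw [Algebra.smul_def, map_mul, map_pow]
  refine (mul_le_mul_left (w.map_algebraMap_zmod_le _) _).trans ?_
  rw [one_mul]
  exact pow_le_pow_right₀ hy ((Nat.lt_succ_iff.1 (Finset.mem_range.1 hi)).trans hn)

theorem Valuation.map_aeval_eq (w : Valuation K Γ) {y : K} (hy : 1 < w y) {P : (ZMod p)[X]}
    (hP : P ≠ 0) : w (aeval y P) = w y ^ P.natDegree := by
  have hlead : w (algebraMap (ZMod p) K P.leadingCoeff * y ^ P.natDegree) = w y ^ P.natDegree := by
    rw [map_mul, map_pow, w.map_algebraMap_zmod (leadingCoeff_ne_zero.2 hP), one_mul]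
  rw [aeval_eq_sum_range, Finset.sum_range_succ, Algebra.smul_def (P.coeff P.natDegree)]
  by_cases h0 : P.natDegree = 0
  · simpa [h0, leadingCoeff] using hlead
  · rw [w.map_add_eq_of_lt_right]
    · exact hlead
    · refine lt_of_le_of_lt ?_ (hlead.symm ▸ pow_lt_pow_right₀ hy (Nat.sub_one_lt h0) :
        w y ^ (P.natDegree - 1) < _)
      refine w.map_sum_le fun i hi => ?_
      rw [Algebra.smul_def, map_mul, map_pow]
      refine (mul_le_mul_left (w.map_algebraMap_zmod_le _) _).trans ?_
      rw [one_mul]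
      have := Finset.mem_range.1 hi
      exact pow_le_pow_right₀ hy.le (by omega)

theorem aeval_injective_of_one_lt (hy : 1 < w (x 0)) :
    Function.Injective (aeval (R := ZMod p) (x 0)) := by
  rw [injective_iff_map_eq_zero]
  intro P hP
  by_contra h
  have := w.map_aeval_eq hy h
  rw [hP, map_zero] at this
  exact (pow_pos (zero_lt_one.trans hy) _).ne this

theorem map_denominator (hQ : 2 ≤ Q) (hx : 1 < w (x 0)) : w (denominator Q x) = w (x 0) ^ Q := by
  rw [denominator, map_mul, unitFactor_of_one_lt hQ w hx, ← pow_succ', Nat.sub_add_cancel (by omega)]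

theorem denominator_ne_zero (hQ : 2 ≤ Q) (hx : 1 < w (x 0)) : denominator Q x ≠ 0 := by
  rw [← Valuation.ne_zero_iff w, map_denominator hQ hx]
  exact pow_ne_zero _ (zero_lt_one.trans hx).ne'

theorem exists_map_eq_pow_of_mem_polyRing (hx : 1 < w (x 0)) {f : K} (hf : f ∈ polyRing p x)
    (h0 : f ≠ 0) : ∃ n : ℕ, w f = w (x 0) ^ n := by
  obtain ⟨P, rfl⟩ := mem_polyRing.1 hf
  refine ⟨P.natDegree, w.map_aeval_eq hx ?_⟩
  rintro rfl
  exact h0 (map_zero _)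

theorem exists_map_eq_zpow_of_mem_baseRing (hQ : 2 ≤ Q) (hx : 1 < w (x 0)) {f : K}
    (hf : f ∈ baseRing p Q x) (h0 : f ≠ 0) : ∃ n : ℤ, w f = w (x 0) ^ n := by
  obtain ⟨B, hB⟩ := mem_baseRing.1 hf
  have hD := denominator_ne_zero hQ hx
  obtain ⟨n, hn⟩ := exists_map_eq_pow_of_mem_polyRing hx hB (mul_ne_zero (pow_ne_zero _ hD) h0)
  rw [map_mul, map_pow, map_denominator hQ hx, ← pow_mul] at hn
  have hx0 : w (x 0) ≠ 0 := (zero_lt_one.trans hx).ne'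
  refine ⟨n - (Q * B : ℕ), ?_⟩
  rw [zpow_sub₀ hx0, zpow_natCast, zpow_natCast, ← hn, mul_div_cancel_left₀ _ (pow_ne_zero _ hx0)]

namespace IsTower

theorem pole_of_pole (T : IsTower Q m x) (hQ : 2 ≤ Q) {j : ℕ} (hj : j < m) (h : 1 < w (x j)) :
    1 < w (x (j + 1)) ∧ w (x (j + 1)) ^ Q = w (x j) := by
  have hpow (y : Γ) : y * y ^ (Q - 1) = y ^ Q := by
    rw [← pow_succ', Nat.sub_add_cancel (by omega)]
  have h1 := congrArg w (T.rel j hj)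
  rw [← mul_unitFactor hQ, map_mul, map_mul, map_pow, unitFactor_of_one_lt hQ w h, ← hpow] at h1
  have h2 := mul_right_cancel₀ (pow_ne_zero _ (zero_lt_one.trans h).ne') h1
  rcases lt_trichotomy (w (x (j + 1))) 1 with h' | h' | h'
  · rw [unitFactor_of_lt_one hQ w h', mul_one] at h2
    exact absurd (h2 ▸ h') h.not_gt
  · rw [h', one_mul] at h2
    exact absurd (h2 ▸ unitFactor_le_one w h'.le) h.not_ge
  · refine ⟨h', ?_⟩
    rwa [unitFactor_of_one_lt hQ w h', hpow] at h2

theorem one_lt_map (T : IsTower Q m x) (hQ : 2 ≤ Q) (hx : 1 < w (x 0)) {j : ℕ} (hj : j ≤ m) :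
    1 < w (x j) := by
  induction j with
  | zero => exact hx
  | succ j ih => exact (T.pole_of_pole hQ hj (ih (by omega))).1

theorem map_succ_pow (T : IsTower Q m x) (hQ : 2 ≤ Q) (hx : 1 < w (x 0)) {j : ℕ} (hj : j < m) :
    w (x (j + 1)) ^ Q = w (x j) :=
  (T.pole_of_pole hQ hj (T.one_lt_map hQ hx hj.le)).2

theorem map_zero_eq (T : IsTower Q m x) (hQ : 2 ≤ Q) (hx : 1 < w (x 0)) {j : ℕ} (hj : j ≤ m) :
    w (x 0) = w (x j) ^ Q ^ j := by
  induction j with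
  | zero => simp
  | succ j ih => rw [ih (by omega), ← T.map_succ_pow hQ hx hj, ← pow_mul, pow_succ']

theorem map_digitMonomial (T : IsTower Q m x) (hQ : 2 ≤ Q) (hx : 1 < w (x 0)) {j : ℕ} (hj : j ≤ m)
    (i : ℕ) : w (digitMonomial Q x j i) = w (x j) ^ digitReverse Q j i := by
  induction j generalizing i with
  | zero => simp [digitMonomial, digitReverse]
  | succ j ih =>
    rw [digitMonomial, digitReverse, map_mul, ih (by omega), map_pow, ← T.map_succ_pow hQ hx hj,
      ← pow_mul, ← pow_add]

theorem exists_map_sum_digitMonomial (T : IsTower Q m x) (hQ : 2 ≤ Q) (hx : 1 < w (x 0)) {j : ℕ}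
    (hj : j ≤ m) {σ : ℕ → K} (hσ : ∀ i, σ i ∈ baseRing p Q x) (hne : ∃ i < Q ^ j, σ i ≠ 0) :
    ∃ i < Q ^ j, σ i ≠ 0 ∧ w (∑ i ∈ Finset.range (Q ^ j), σ i * digitMonomial Q x j i) =
      w (σ i) * w (x j) ^ digitReverse Q j i := by
  have hxj := T.one_lt_map hQ hx hj
  have hxj0 : w (x j) ≠ 0 := (zero_lt_one.trans hxj).ne'
  have hmon : ∀ i, digitMonomial Q x j i ≠ 0 := fun i => by
    rw [← Valuation.ne_zero_iff w, T.map_digitMonomial hQ hx hj]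
    exact pow_ne_zero _ hxj0
  obtain ⟨i, hi, hi0, hw⟩ := w.exists_map_sum_eq (Finset.range (Q ^ j))
    (fun i => σ i * digitMonomial Q x j i) (by
      intro i hi i' hi' h h' hww
      have hi := Finset.mem_range.1 hi
      have hi' := Finset.mem_range.1 hi'
      obtain ⟨n, hn⟩ := exists_map_eq_zpow_of_mem_baseRing hQ hx (hσ i) (left_ne_zero_of_mul h)
      obtain ⟨n', hn'⟩ := exists_map_eq_zpow_of_mem_baseRing hQ hx (hσ i') (left_ne_zero_of_mul h')
      rw [map_mul, map_mul, hn, hn', T.map_digitMonomial hQ hx hj, T.map_digitMonomial hQ hx hj,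
        T.map_zero_eq hQ hx hj, ← zpow_natCast, ← zpow_mul, ← zpow_mul, ← zpow_natCast,
        ← zpow_natCast, ← zpow_add₀ hxj0, ← zpow_add₀ hxj0] at hww
      have hinj := zpow_right_injective₀ (zero_lt_one.trans hxj) hxj.ne' hww
      have hlt := digitReverse_lt (by omega : 0 < Q) hi
      have hlt' := digitReverse_lt (by omega : 0 < Q) hi'
      refine digitReverse_injOn (by omega) hi hi' ?_
      have := congrArg (· % ((Q ^ j : ℕ) : ℤ)) hinj
      simp only [Int.add_emod, Int.mul_emod_right, zero_add, Int.emod_emod_of_dvd _ dvd_rfl] at this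
      rw [Int.emod_eq_of_lt (by positivity) (by exact_mod_cast hlt),
        Int.emod_eq_of_lt (by positivity) (by exact_mod_cast hlt')] at this
      exact_mod_cast this)
    (by
      obtain ⟨i, hi, h⟩ := hne
      exact ⟨i, Finset.mem_range.2 hi, mul_ne_zero h (hmon i)⟩)
  refine ⟨i, Finset.mem_range.1 hi, left_ne_zero_of_mul hi0, ?_⟩
  rw [hw, map_mul, T.map_digitMonomial hQ hx hj]

theorem mul_pow_mem_combination {Y : Subring K} {j : ℕ} {g : K}
    (hg : g ∈ combination Y (digitMonomial Q x j) (Q ^ j)) {k s : ℕ} (hk : k < s) :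
    g * x (j + 1) ^ k ∈ combination Y (digitMonomial Q x (j + 1)) (s * Q ^ j) := by
  obtain ⟨σ, hσ, rfl⟩ := hg
  rw [Finset.sum_mul]
  refine AddSubgroup.sum_mem _ fun i hi => ?_
  have hi := Finset.mem_range.1 hi
  rw [mul_assoc, ← digitMonomial_succ_mul_add x hi]
  refine combination.mul_mem (hσ i) (combination.basis_mem ?_)
  calc k * Q ^ j + i < (k + 1) * Q ^ j := by rw [Nat.succ_mul]; omega
    _ ≤ s * Q ^ j := Nat.mul_le_mul_right _ hk

omit [Fact p.Prime] in
theorem mem_combination_of_mem (T : IsTower Q m x) (hQ : 2 ≤ Q) {j : ℕ} (hj : j ≤ m) {f : K}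
    (hf : f ∈ towerRing p Q x j) :
    f ∈ combination (baseRing p Q x) (digitMonomial Q x j) (Q ^ j) := by
  induction j generalizing f with
  | zero => exact ⟨fun _ => f, fun _ => hf, by simp [digitMonomial]⟩
  | succ j ih =>
    obtain ⟨g, hg, rfl⟩ := (T.mem_towerRing_succ hQ hj).1 hf
    rw [pow_succ']
    exact AddSubgroup.sum_mem _ fun s hs =>
      mul_pow_mem_combination (ih (by omega) (hg s)) (Finset.mem_range.1 hs)

theorem exists_map_eq_zpow (T : IsTower Q m x) (hQ : 2 ≤ Q) (hx : 1 < w (x 0)) {j : ℕ} (hj : j ≤ m)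
    {f : K} (hf : f ∈ towerRing p Q x j) (h0 : f ≠ 0) : ∃ n : ℤ, w f = w (x j) ^ n := by
  obtain ⟨σ, hσ, rfl⟩ := T.mem_combination_of_mem hQ hj hf
  have hne : ∃ i < Q ^ j, σ i ≠ 0 := by
    by_contra! h
    exact h0 (Finset.sum_eq_zero fun i hi => by rw [h i (Finset.mem_range.1 hi), zero_mul])
  obtain ⟨i, -, hi0, hw⟩ := T.exists_map_sum_digitMonomial hQ hx hj hσ hne
  obtain ⟨n, hn⟩ := exists_map_eq_zpow_of_mem_baseRing hQ hx (hσ i) hi0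
  refine ⟨(Q ^ j : ℕ) * n + digitReverse Q j i, ?_⟩
  rw [hw, hn, T.map_zero_eq hQ hx hj, zpow_add₀ (zero_lt_one.trans (T.one_lt_map hQ hx hj)).ne',
    zpow_mul, zpow_natCast, zpow_natCast]

theorem one_le_map_of_mem_combination (T : IsTower Q m x) (hQ : 2 ≤ Q) (hx : 1 < w (x 0)) {f : K}
    (hf : f ∈ combination (polyRing p x) (digitMonomial Q x m) (Q ^ m)) (h0 : f ≠ 0) :
    1 ≤ w f := by
  obtain ⟨σ, hσ, rfl⟩ := hf
  have hne : ∃ i < Q ^ m, σ i ≠ 0 := by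
    by_contra! h
    exact h0 (Finset.sum_eq_zero fun i hi => by rw [h i (Finset.mem_range.1 hi), zero_mul])
  obtain ⟨i, -, hi0, hw⟩ := T.exists_map_sum_digitMonomial hQ hx le_rfl
    (fun i => polyRing_le_baseRing (hσ i)) hne
  obtain ⟨n, hn⟩ := exists_map_eq_pow_of_mem_polyRing hx (hσ i) hi0
  rw [hw, hn]
  exact one_le_mul (one_le_pow₀ hx.le) (one_le_pow₀ (T.one_lt_map hQ hx le_rfl).le)

/-- The powers of `x (j + 1)` below the `Q`-th are linearly independent over the previous ring. -/
theorem eq_zero_of_sum_pow_eq_zero (T : IsTower Q m x) (hQ : 2 ≤ Q) (hx : 1 < w (x 0)) {j : ℕ}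
    (hj : j < m) {g : ℕ → K} (hg : ∀ s, g s ∈ towerRing p Q x j)
    (hsum : ∑ s ∈ Finset.range Q, g s * x (j + 1) ^ s = 0) {s : ℕ} (hs : s < Q) : g s = 0 := by
  by_contra hgs
  have hxj := T.one_lt_map hQ hx (j := j + 1) hj
  have hxj0 : w (x (j + 1)) ≠ 0 := (zero_lt_one.trans hxj).ne'
  have hx0 := (Valuation.ne_zero_iff w).1 hxj0
  obtain ⟨i, -, hi0, hw⟩ := w.exists_map_sum_eq (Finset.range Q) (fun s => g s * x (j + 1) ^ s) (by
      intro i hi i' hi' h h' hww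
      have hi := Finset.mem_range.1 hi
      have hi' := Finset.mem_range.1 hi'
      obtain ⟨n, hn⟩ := T.exists_map_eq_zpow hQ hx hj.le (hg i) (left_ne_zero_of_mul h)
      obtain ⟨n', hn'⟩ := T.exists_map_eq_zpow hQ hx hj.le (hg i') (left_ne_zero_of_mul h')
      rw [map_mul, map_mul, hn, hn', ← T.map_succ_pow hQ hx hj, map_pow, map_pow, ← zpow_natCast,
        ← zpow_mul, ← zpow_mul, ← zpow_natCast, ← zpow_natCast, ← zpow_add₀ hxj0,
        ← zpow_add₀ hxj0] at hww
      have hinj := zpow_right_injective₀ (zero_lt_one.trans hxj) hxj.ne' hww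
      have := congrArg (· % (Q : ℤ)) hinj
      simp only [Int.add_emod, Int.mul_emod_right, zero_add, Int.emod_emod_of_dvd _ dvd_rfl] at this
      rw [Int.emod_eq_of_lt (by positivity) (by exact_mod_cast hi),
        Int.emod_eq_of_lt (by positivity) (by exact_mod_cast hi')] at this
      exact_mod_cast this)
    ⟨s, Finset.mem_range.2 hs, mul_ne_zero hgs (pow_ne_zero _ hx0)⟩
  rw [hsum, map_zero] at hw
  exact (Valuation.ne_zero_iff w).2 hi0 hw.symm

end IsTower

end Values

section RiemannRoch

open Polynomial

variable {K : Type*} [Field K]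

/-- The elements of `K` which are integral over the ring generated by `x 0`. -/
noncomputable def integralRing (x : ℕ → K) : Subring K :=
  (integralClosure (Subring.closure {x 0}) K).toSubring

theorem mem_integralRing_of_forall {x : ℕ → K} {f : K}
    (h : ∀ V : ValuationSubring K, V.valuation (x 0) ≤ 1 → V.valuation f ≤ 1) :
    f ∈ integralRing x := by
  rw [integralRing, ← iInf_valuationSubring_superset, Subring.mem_iInf]
  rintro ⟨V, hV⟩
  have hx : x 0 ∈ V := hV (Set.mem_singleton _)
  exact (V.valuation_le_one_iff f).1 (h V ((V.valuation_le_one_iff _).2 hx))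

theorem exists_pow_mem_combination {Y : Subring K} {f : K} (hf : IsIntegral Y f) :
    ∃ n : ℕ, ∀ j : ℕ, f ^ j ∈ combination Y (fun i => f ^ i) n := by
  obtain ⟨P, hP, hPf⟩ := hf
  refine ⟨P.natDegree, fun j => ?_⟩
  have hne : P ≠ 1 := by
    rintro rfl
    simp at hPf
  have hval : f ^ j = eval₂ (algebraMap Y K) f (X ^ j %ₘ P) := by
    have := congrArg (eval₂ (algebraMap Y K) f) (modByMonic_add_div (X ^ j) P)
    rw [eval₂_add, eval₂_mul, hPf, zero_mul, add_zero, eval₂_pow, eval₂_X] at this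
    exact this.symm
  refine ⟨fun i => ((X ^ j %ₘ P).coeff i : K), fun i => ((X ^ j %ₘ P).coeff i).2, ?_⟩
  rw [hval, eval₂_eq_sum_range' _ (natDegree_modByMonic_lt _ hP hne)]
  rfl

theorem exists_uniform_pow_mul_mem {D : K} {V : ℕ → AddSubgroup K}
    (hV : ∀ i, ∀ f ∈ V i, D * f ∈ V i) {f : ℕ → K} {n : ℕ}
    (hf : ∀ i < n, ∃ B : ℕ, D ^ B * f i ∈ V i) : ∃ B : ℕ, ∀ i < n, D ^ B * f i ∈ V i := by
  have hpow : ∀ i, ∀ f ∈ V i, ∀ k : ℕ, D ^ k * f ∈ V i := by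
    intro i f hf k
    induction k with
    | zero => simpa using hf
    | succ k ih => rw [pow_succ', mul_assoc]; exact hV i _ ih
  induction n with
  | zero => exact ⟨0, by simp⟩
  | succ n ih =>
    obtain ⟨B, hB⟩ := ih fun i hi => hf i (by omega)
    obtain ⟨B', hB'⟩ := hf n (by omega)
    refine ⟨B + B', fun i hi => ?_⟩
    rcases Nat.lt_succ_iff_lt_or_eq.1 hi with h | rfl
    · rw [add_comm, pow_add, mul_assoc]
      exact hpow i _ (hB i h) _
    · rw [pow_add, mul_assoc]
      exact hpow i _ hB' _

variable {p : ℕ} [Algebra (ZMod p) K] {Q m : ℕ} {x : ℕ → K}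

variable (p) in
/-- Values at `x 0` of the polynomials of degree less than `n`. -/
def polyLT (x : ℕ → K) (n : ℕ) : Set K := aeval (R := ZMod p) (x 0) '' {P | P ∈ degreeLT (ZMod p) n}

theorem polyLT_subset {n : ℕ} {y : K} (hy : y ∈ polyLT p x n) : y ∈ polyRing p x := by
  obtain ⟨P, -, rfl⟩ := hy
  exact ⟨P, rfl⟩

theorem aeval_asPoly_zero (hQ : 2 ≤ Q) : aeval (x 0) (asPoly Q (0 : ZMod p)) = denominator Q x := by
  rw [denominator, mul_unitFactor hQ, asPoly]
  simp

variable [Fact p.Prime] {Γ : Type*} [LinearOrderedCommGroupWithZero Γ] {w : Valuation K Γ}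

theorem exists_division (hQ : 2 ≤ Q) (n : ℕ) {y : K} (hy : y ∈ polyRing p x) :
    ∃ ρ ∈ polyLT p x (n * Q), ∃ π ∈ polyRing p x, y = π * denominator Q x ^ n + ρ := by
  obtain ⟨P, rfl⟩ := mem_polyRing.1 hy
  have hmon : ((asPoly Q (0 : ZMod p)) ^ n).Monic := (asPoly_monic hQ _).pow n
  have hdeg : ((asPoly Q (0 : ZMod p)) ^ n).natDegree = n * Q := by
    rw [(asPoly_monic hQ _).natDegree_pow, natDegree_asPoly hQ]
  refine ⟨_, ⟨P %ₘ asPoly Q (0 : ZMod p) ^ n, ?_, rfl⟩, aeval (x 0) (P /ₘ asPoly Q (0 : ZMod p) ^ n),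
    ⟨_, rfl⟩, ?_⟩
  · rw [Set.mem_ofPred_eq, mem_degreeLT, ← hdeg, ← degree_eq_natDegree hmon.ne_zero]
    exact degree_modByMonic_lt _ hmon
  · conv_lhs => rw [← modByMonic_add_div P (asPoly Q (0 : ZMod p) ^ n)]
    rw [map_add, map_mul, map_pow, aeval_asPoly_zero hQ]
    ring

omit [Fact p.Prime] in
theorem closure_le_polyRing : Subring.closure {x 0} ≤ polyRing p x :=
  Subring.closure_le.2 (Set.singleton_subset_iff.2 (gen_mem_polyRing p x))

omit [Fact p.Prime] in
theorem exists_pow_mul_mem_combination_polyRing {e : ℕ → K} {n : ℕ} {f : K}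
    (hf : f ∈ combination (baseRing p Q x) e n) :
    ∃ B : ℕ, denominator Q x ^ B * f ∈ combination (polyRing p x) e n := by
  obtain ⟨σ, hσ, rfl⟩ := hf
  obtain ⟨B, hB⟩ := exists_uniform_pow_mul_mem (D := denominator Q x)
    (V := fun _ => (polyRing p x).toAddSubgroup)
    (fun _ f hf => Subring.mul_mem _ (denominator_mem_polyRing p Q x) hf) (n := n)
    fun i _ => mem_baseRing.1 (hσ i)
  refine ⟨B, ?_⟩
  rw [Finset.mul_sum]
  refine AddSubgroup.sum_mem _ fun i hi => ?_
  rw [← mul_assoc]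
  exact combination.mul_mem (hB i (Finset.mem_range.1 hi))
    (combination.basis_mem (Finset.mem_range.1 hi))

/-- An element of the tower ring which is integral away from the distinguished place cannot vanish
there. -/
theorem IsTower.one_le_map_of_integral (T : IsTower Q m x) (hQ : 2 ≤ Q) (hx : 1 < w (x 0)) {f : K}
    (hf : f ∈ towerRing p Q x m) (hfi : f ∈ integralRing x) (h0 : f ≠ 0) : 1 ≤ w f := by
  by_contra! hlt
  obtain ⟨n, hn⟩ := exists_pow_mem_combination (Y := Subring.closure {x 0}) (f := f) hfi
  set V := combination (polyRing p x) (digitMonomial Q x m) (Q ^ m) with hVdef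
  obtain ⟨B, hB⟩ := exists_uniform_pow_mul_mem (D := denominator Q x) (V := fun _ => V)
    (fun _ f hf => combination.mul_mem (denominator_mem_polyRing p Q x) hf) (f := fun i => f ^ i)
    (n := n) fun i _ => exists_pow_mul_mem_combination_polyRing
      (T.mem_combination_of_mem hQ le_rfl (Subring.pow_mem _ hf i))
  have hall : ∀ j : ℕ, denominator Q x ^ B * f ^ j ∈ V := by
    intro j
    obtain ⟨σ, hσ, hj⟩ := hn j
    rw [hj, Finset.mul_sum]
    refine AddSubgroup.sum_mem _ fun i hi => ?_
    rw [mul_left_comm]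
    exact combination.mul_mem (closure_le_polyRing (hσ i)) (hB i (Finset.mem_range.1 hi))
  have hxm := T.one_lt_map hQ hx le_rfl
  have hxm0 : w (x m) ≠ 0 := (zero_lt_one.trans hxm).ne'
  obtain ⟨k, hk⟩ := T.exists_map_eq_zpow hQ hx le_rfl hf h0
  have hk0 : k < 0 := by
    rw [hk, ← zpow_zero (w (x m))] at hlt
    exact (zpow_lt_zpow_iff_right₀ hxm).1 hlt
  have key := T.one_le_map_of_mem_combination hQ hx (hall (Q ^ m * Q * B + 1))
    (mul_ne_zero (pow_ne_zero _ (denominator_ne_zero hQ hx)) (pow_ne_zero _ h0))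
  rw [map_mul, map_pow, map_pow, map_denominator hQ hx, T.map_zero_eq hQ hx le_rfl, hk, ← pow_mul,
    ← pow_mul, ← zpow_natCast, ← zpow_natCast, ← zpow_mul, ← zpow_add₀ hxm0,
    ← zpow_zero (w (x m)), zpow_le_zpow_iff_right₀ hxm] at key
  push_cast at key
  have hnn : (0 : ℤ) ≤ (Q : ℤ) ^ m * Q * B := by positivity
  nlinarith

variable (p) in
/-- The elements of the tower ring which are integral away from the distinguished place, with a
pole of bounded order there. -/
noncomputable def poleSpace (Q m : ℕ) (x : ℕ → K) (w : Valuation K Γ) (E : ℕ) : AddSubgroup K where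
  carrier := {f | f ∈ towerRing p Q x m ∧ f ∈ integralRing x ∧ w f ≤ w (x 0) ^ E}
  zero_mem' := ⟨Subring.zero_mem _, Subring.zero_mem _, by simp⟩
  add_mem' := fun ⟨h1, h2, h3⟩ ⟨h1', h2', h3'⟩ =>
    ⟨Subring.add_mem _ h1 h1', Subring.add_mem _ h2 h2', w.map_add_le h3 h3'⟩
  neg_mem' := fun ⟨h1, h2, h3⟩ =>
    ⟨Subring.neg_mem _ h1, Subring.neg_mem _ h2, by rwa [Valuation.map_neg]⟩

/-- A valuation for which an additive subgroup of bounded pole order is as small as if the residue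
field had `p` elements and `g` were the inverse of a uniformizer. -/
def BoundsPoles (p : ℕ) (w : Valuation K Γ) (g : Γ) : Prop :=
  ∀ (V : AddSubgroup K) (n : ℕ), (∀ f ∈ V, f ≠ 0 → 1 ≤ w f ∧ w f ≤ g ^ n) →
    Finite V ∧ Nat.card V ≤ p ^ (n + 1)

theorem IsTower.card_poleSpace_le (T : IsTower Q m x) (hQ : 2 ≤ Q) (hx : 1 < w (x 0))
    (hw : BoundsPoles p w (w (x m))) (E : ℕ) :
    Finite (poleSpace p Q m x w E) ∧ Nat.card (poleSpace p Q m x w E) ≤ p ^ (Q ^ m * E + 1) :=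
  hw _ _ fun _ hf h0 => ⟨T.one_le_map_of_integral hQ hx hf.1 hf.2.1 h0, by
    rw [pow_mul, ← T.map_zero_eq hQ hx le_rfl]
    exact hf.2.2⟩

theorem card_polyLT (hx : 1 < w (x 0)) (n : ℕ) : Finite (polyLT p x n) ∧
    Nat.card (polyLT p x n) = p ^ n := by
  have e1 : polyLT p x n ≃ degreeLT (ZMod p) n :=
    (Equiv.Set.image _ _ (aeval_injective_of_one_lt hx)).symm
  have e2 := (degreeLTEquiv (ZMod p) n).toEquiv
  refine ⟨Finite.of_equiv _ (e1.trans e2).symm, ?_⟩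
  rw [Nat.card_congr (e1.trans e2)]
  simp

theorem map_le_of_mem_polyLT (hx : 1 < w (x 0)) {n : ℕ} {y : K} (hy : y ∈ polyLT p x (n + 1)) :
    w y ≤ w (x 0) ^ n := by
  obtain ⟨P, hP, rfl⟩ := hy
  refine w.map_aeval_le hx.le P ?_
  rcases eq_or_ne P 0 with rfl | h0
  · simp
  · rw [Set.mem_ofPred_eq, mem_degreeLT] at hP
    exact Nat.lt_succ_iff.1 ((natDegree_lt_iff_degree_lt h0).2 hP)

namespace IsTower

omit [Fact p.Prime] in
theorem corrected_sub_mem (T : IsTower Q m x) (hQ : 2 ≤ Q) {j : ℕ} (hj : j < m) :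
    corrected Q m x (j + 1) - x (j + 1) ∈ towerRing p Q x j := by
  have hmem : ∀ i ≤ j, x i ∈ towerRing p Q x j ∧ (x i)⁻¹ ∈ towerRing p Q x j := fun i hi =>
    have h := T.units_mem (p := p) hQ (hi.trans hj.le)
    ⟨towerRing_mono hi h.1, towerRing_mono hi h.2.1⟩
  rw [corrected, add_sub_cancel_left]
  refine Subring.sum_mem _ fun b hb => ?_
  have hb1 := Finset.mem_range.1 (Finset.mem_filter.1 hb).1
  refine Subring.mul_mem _ (Subring.mul_mem _ (Subring.pow_mem _ (hmem b (by omega)).1 _)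
    (Subring.pow_mem _ (Subring.prod_mem _ fun t ht => ?_) _)) (hmem _ (by omega)).2
  have := Finset.mem_range.1 ht
  exact Subring.add_mem _ (Subring.one_mem _) (Subring.pow_mem _ (hmem t (by omega)).1 _)

omit [Fact p.Prime] in
theorem digitMonomial_mem (T : IsTower Q m x) (hQ : 2 ≤ Q) {j : ℕ} (hj : j ≤ m) (i : ℕ) :
    digitMonomial Q x j i ∈ towerRing p Q x j ∧
      digitMonomial Q (corrected Q m x) j i ∈ towerRing p Q x j := by
  induction j generalizing i with
  | zero => exact ⟨Subring.one_mem _, Subring.one_mem _⟩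
  | succ j ih =>
    obtain ⟨h1, h2⟩ := ih (by omega) (i % Q ^ j)
    have hg : x (j + 1) ∈ towerRing p Q x (j + 1) := gen_succ_mem_towerRing j
    have hc := towerRing_le_succ j (T.corrected_sub_mem (p := p) hQ hj)
    refine ⟨Subring.mul_mem _ (towerRing_le_succ j h1) (Subring.pow_mem _ hg _),
      Subring.mul_mem _ (towerRing_le_succ j h2) (Subring.pow_mem _ ?_ _)⟩
    simpa using Subring.add_mem _ hc hg

omit [Fact p.Prime] in
/-- The corrected monomials agree with the monomials up to lower terms. -/
theorem digitMonomial_corrected_sub_mem (T : IsTower Q m x) (hQ : 2 ≤ Q) {j : ℕ} (hj : j ≤ m)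
    {i : ℕ} (hi : i < Q ^ j) :
    digitMonomial Q (corrected Q m x) j i - digitMonomial Q x j i ∈
      combination (baseRing p Q x) (digitMonomial Q x j) i := by
  induction j generalizing i with
  | zero => simp [digitMonomial]
  | succ j ih =>
    have hpos : 0 < Q ^ j := pow_pos (by omega) j
    obtain ⟨s, i', hi', rfl⟩ : ∃ s i', i' < Q ^ j ∧ s * Q ^ j + i' = i :=
      ⟨i / Q ^ j, i % Q ^ j, Nat.mod_lt i hpos, Nat.div_add_mod' i _⟩
    rw [digitMonomial_succ_mul_add _ hi', digitMonomial_succ_mul_add _ hi']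
    set b := digitMonomial Q x j i' with hb
    set b' := digitMonomial Q (corrected Q m x) j i' with hb'
    set κ := corrected Q m x (j + 1) - x (j + 1) with hκ
    have hy : corrected Q m x (j + 1) = x (j + 1) + κ := by rw [hκ]; ring
    have hsplit : b' * corrected Q m x (j + 1) ^ s - b * x (j + 1) ^ s =
        (∑ k ∈ Finset.range s, b' * (κ ^ (s - k) * (s.choose k : K)) * x (j + 1) ^ k) +
          (b' - b) * x (j + 1) ^ s := by
      rw [hy, add_pow, Finset.sum_range_succ, Nat.sub_self, pow_zero, Nat.choose_self, Nat.cast_one,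
        mul_add, Finset.mul_sum]
      have : ∀ k ∈ Finset.range s, b' * (x (j + 1) ^ k * κ ^ (s - k) * (s.choose k : K)) =
          b' * (κ ^ (s - k) * (s.choose k : K)) * x (j + 1) ^ k := fun k _ => by ring
      rw [Finset.sum_congr rfl this]
      ring
    rw [hsplit]
    refine AddSubgroup.add_mem _ (AddSubgroup.sum_mem _ fun k hk => ?_) ?_
    · refine combination.le_of le_rfl (Nat.le_add_right _ _) (mul_pow_mem_combination
        (T.mem_combination_of_mem hQ (by omega) ?_) (Finset.mem_range.1 hk))
      exact Subring.mul_mem _ (T.digitMonomial_mem hQ (by omega) i').2 (Subring.mul_mem _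
        (Subring.pow_mem _ (T.corrected_sub_mem hQ hj) _) (natCast_mem _ _))
    · obtain ⟨σ, hσ, h⟩ := ih (by omega) hi'
      rw [h, Finset.sum_mul]
      refine AddSubgroup.sum_mem _ fun k hk => ?_
      have hk' := Finset.mem_range.1 hk
      rw [mul_assoc, ← digitMonomial_succ_mul_add x (hk'.trans hi')]
      exact combination.mul_mem (hσ k) (combination.basis_mem (by omega))

end IsTower

end RiemannRoch

section LowerBound

open Polynomial

variable {K : Type*} [Field K] {p : ℕ} [Algebra (ZMod p) K] [Fact p.Prime] {Q m : ℕ} {x : ℕ → K}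
  {Γ : Type*} [LinearOrderedCommGroupWithZero Γ] {w : Valuation K Γ}

omit [Fact p.Prime] in
theorem polyRing_le_integralRing : polyRing p x ≤ integralRing x := by
  rintro _ ⟨P, rfl⟩
  change aeval (x 0) P ∈ _
  rw [aeval_eq_sum_range]
  refine Subring.sum_mem _ fun i _ => ?_
  rw [Algebra.smul_def]
  refine Subring.mul_mem _ ?_ (Subring.pow_mem _ ?_ _)
  · obtain ⟨n, hn⟩ := ZMod.intCast_surjective (P.coeff i)
    rw [← hn, map_intCast]
    exact intCast_mem _ _
  · exact mem_integralRing_of_forall fun V h => h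

namespace IsTower

theorem eq_zero_of_sum_digitMonomial_eq_zero (T : IsTower Q m x) (hQ : 2 ≤ Q) (hx : 1 < w (x 0))
    {σ : ℕ → K} (hσ : ∀ i, σ i ∈ baseRing p Q x)
    (hsum : ∑ i ∈ Finset.range (Q ^ m), σ i * digitMonomial Q x m i = 0) {i : ℕ} (hi : i < Q ^ m) :
    σ i = 0 := by
  by_contra hne
  obtain ⟨k, -, hk, hw⟩ := T.exists_map_sum_digitMonomial hQ hx le_rfl hσ ⟨i, hi, hne⟩
  rw [hsum, map_zero] at hw
  exact mul_ne_zero ((Valuation.ne_zero_iff w).2 hk)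
    (pow_ne_zero _ (zero_lt_one.trans (T.one_lt_map hQ hx le_rfl)).ne') hw.symm

omit [Fact p.Prime] in
theorem combination_le_integralRing (T : IsTower Q m x) (hQ : 2 ≤ Q)
    (hadd : ∀ a b : K, (a + b) ^ Q = a ^ Q + b ^ Q) :
    combination (polyRing p x)
      (fun i => denominator Q x * digitMonomial Q (corrected Q m x) m i) (Q ^ m) ≤
      (integralRing x).toAddSubgroup := by
  refine combination.le_of_forall fun y hy i hi => Subring.mul_mem _ ?_ ?_
  · exact polyRing_le_integralRing hy
  · obtain ⟨d, hd, h⟩ := exists_digitMonomial_eq_prod (by omega) (corrected Q m x) hi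
    rw [h]
    exact mem_integralRing_of_forall fun V h0 =>
      T.denominator_mul_prod_corrected_le_one hQ hadd _ h0 hd

theorem le_card_poleSpace (T : IsTower Q m x) (hQ : 2 ≤ Q)
    (hadd : ∀ a b : K, (a + b) ^ Q = a ^ Q + b ^ Q) (hx : 1 < w (x 0)) {E : ℕ} (hE : Q ≤ E)
    [Finite (poleSpace p Q m x w E)] :
    p ^ (Q ^ m * (E - Q)) ≤ Nat.card (poleSpace p Q m x w E) := by
  classical
  set D := denominator Q x with hDdef
  have hD0 : D ≠ 0 := denominator_ne_zero hQ hx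
  set b := digitMonomial Q (corrected Q m x) m with hb
  obtain ⟨B, hB⟩ := exists_uniform_pow_mul_mem (D := D)
    (V := fun i => combination (polyRing p x) (digitMonomial Q x m) i)
    (fun _ f hf => combination.mul_mem (denominator_mem_polyRing p Q x) hf)
    (f := fun i => b i - digitMonomial Q x m i) (n := Q ^ m)
    fun i hi => exists_pow_mul_mem_combination_polyRing
      (T.digitMonomial_corrected_sub_mem hQ le_rfl hi)
  set e : ℕ → K := fun i => (D ^ B)⁻¹ * digitMonomial Q x m i with he
  set t : ℕ → K := fun i => D * b i with ht
  have htri : ∀ i < Q ^ m, t i - D ^ (B + 1) * e i ∈ combination (polyRing p x) e i := by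
    intro i hi
    obtain ⟨σ, hσ, h⟩ := hB i hi
    refine ⟨fun k => D * σ k, fun k => Subring.mul_mem _ (denominator_mem_polyRing p Q x) (hσ k), ?_⟩
    have h2 : ∑ k ∈ Finset.range i, D * σ k * e k =
        D * (D ^ B)⁻¹ * ∑ k ∈ Finset.range i, σ k * digitMonomial Q x m k := by
      rw [Finset.mul_sum]
      exact Finset.sum_congr rfl fun k _ => by rw [he]; ring
    rw [h2, ← h, ht, he]
    field_simp
    ring
  set R : Set K := polyLT p x (E + B * Q) with hR
  set S : Set K := polyLT p x ((B + 1) * Q) with hS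
  obtain ⟨hRfin, hRcard⟩ := card_polyLT (p := p) hx (E + B * Q)
  obtain ⟨hSfin, hScard⟩ := card_polyLT (p := p) hx ((B + 1) * Q)
  have : Fintype R := Fintype.ofFinite R
  have : Fintype S := Fintype.ofFinite S
  let ext : (Fin (Q ^ m) → R) → ℕ → K := fun c i => if h : i < Q ^ m then c ⟨i, h⟩ else 0
  have hext : ∀ c i, ext c i ∈ polyRing p x := by
    intro c i
    by_cases h : i < Q ^ m
    · simpa [ext, h] using polyLT_subset (c ⟨i, h⟩).2
    · simp [ext, h]
  let F : (Fin (Q ^ m) → R) → K := fun c => ∑ i ∈ Finset.range (Q ^ m), ext c i * e i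
  have hred : ∀ c, ∃ ρ : Fin (Q ^ m) → S,
      F c - ∑ i : Fin (Q ^ m), (ρ i : K) * e i ∈ combination (polyRing p x) t (Q ^ m) := by
    intro c
    obtain ⟨ρ, hρ, h⟩ := combination.exists_reduced (fun y hy => exists_division hQ (B + 1) hy) htri
      (f := F c) ⟨ext c, hext c, rfl⟩
    refine ⟨fun i => ⟨ρ i, hρ i i.2⟩, ?_⟩
    rwa [Finset.sum_range] at h
  choose ρ hρ using hred
  have hcard : Fintype.card (Fin (Q ^ m) → S) * p ^ (Q ^ m * (E - Q)) ≤
      Fintype.card (Fin (Q ^ m) → R) := by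
    rw [Fintype.card_fun, Fintype.card_fun, Fintype.card_fin, ← Nat.card_eq_fintype_card (α := R),
      ← Nat.card_eq_fintype_card (α := S), hRcard, hScard, ← pow_mul, ← pow_mul, ← pow_add]
    refine Nat.pow_le_pow_right (Fact.out : p.Prime).pos (le_of_eq ?_)
    rw [mul_comm (Q ^ m), ← add_mul]
    congr 1
    have : (B + 1) * Q = B * Q + Q := by ring
    omega
  have hne : Nonempty (Fin (Q ^ m) → S) := by
    refine ⟨fun _ => ⟨0, 0, Submodule.zero_mem (degreeLT (ZMod p) _), map_zero _⟩⟩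
  obtain ⟨r, hr⟩ := Fintype.exists_le_card_fiber_of_mul_le_card ρ hcard
  set fib := Finset.univ.filter fun c => ρ c = r with hfib
  have hpos : 0 < p ^ (Q ^ m * (E - Q)) := pow_pos (Fact.out : p.Prime).pos _
  obtain ⟨c₀, hc₀⟩ := Finset.card_pos.1 (hpos.trans_le hr)
  have hmem : ∀ c ∈ fib, F c - F c₀ ∈ poleSpace p Q m x w E := by
    intro c hc
    have h1 := (Finset.mem_filter.1 hc).2
    have h0 := (Finset.mem_filter.1 hc₀).2
    have hcomb : F c - F c₀ ∈ combination (polyRing p x) t (Q ^ m) := by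
      have := AddSubgroup.sub_mem _ (hρ c) (hρ c₀)
      rw [h1, h0] at this
      simpa using this
    refine ⟨?_, T.combination_le_integralRing hQ hadd hcomb, ?_⟩
    · refine (combination.le_of_forall (V := (towerRing p Q x m).toAddSubgroup) fun y hy i hi => ?_)
        hcomb
      have h0 : ∀ y ∈ polyRing p x, y ∈ towerRing p Q x m := fun y hy =>
        towerRing_mono (Nat.zero_le m) (polyRing_le_baseRing hy)
      exact Subring.mul_mem _ (h0 _ hy) (Subring.mul_mem _ (h0 _ (denominator_mem_polyRing p Q x))
        (T.digitMonomial_mem hQ le_rfl i).2)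
    · have hF : ∀ c, w (F c) ≤ w (x 0) ^ E := by
        intro c
        refine w.map_sum_le fun i hi => ?_
        have hi := Finset.mem_range.1 hi
        have hext : w (ext c i) ≤ w (x 0) ^ (E - 1 + B * Q) := by
          have h : (c ⟨i, hi⟩ : K) ∈ polyLT p x (E - 1 + B * Q + 1) := by
            rw [show E - 1 + B * Q + 1 = E + B * Q by omega]
            exact (c ⟨i, hi⟩).2
          simpa [ext, hi] using map_le_of_mem_polyLT hx h
        have hmon : w (digitMonomial Q x m i) ≤ w (x 0) := by
          rw [T.map_digitMonomial hQ hx le_rfl, T.map_zero_eq hQ hx le_rfl]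
          exact pow_le_pow_right₀ (T.one_lt_map hQ hx le_rfl).le
            (digitReverse_lt (by omega) hi).le
        have hx0 : w (x 0) ≠ 0 := (zero_lt_one.trans hx).ne'
        calc w (ext c i * e i) = w (ext c i) * ((w (x 0) ^ (B * Q))⁻¹ *
              w (digitMonomial Q x m i)) := by
              rw [he, map_mul, map_mul, map_inv₀, map_pow, hDdef, map_denominator hQ hx, ← pow_mul,
                mul_comm Q]
          _ ≤ w (x 0) ^ (E - 1 + B * Q) * ((w (x 0) ^ (B * Q))⁻¹ * w (x 0)) := by gcongr
          _ = w (x 0) ^ E := by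
              rw [pow_add]
              field_simp
              rw [← pow_succ, Nat.sub_add_cancel (by omega)]
      exact w.map_sub_le (hF c) (hF c₀)
  have hinj : Function.Injective
      (fun c : fib => (⟨F c - F c₀, hmem c c.2⟩ : poleSpace p Q m x w E)) := by
    intro c c' h
    have h1 : F c = F c' := sub_left_injective (Subtype.ext_iff.1 h)
    have h2 : ∑ i ∈ Finset.range (Q ^ m), (ext c i - ext c' i) * digitMonomial Q x m i = 0 := by
      have h3 : (D ^ B)⁻¹ * ∑ i ∈ Finset.range (Q ^ m),
          (ext c i - ext c' i) * digitMonomial Q x m i = 0 := by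
        rw [← sub_eq_zero.2 h1, ← Finset.sum_sub_distrib, Finset.mul_sum]
        exact Finset.sum_congr rfl fun i _ => by rw [he]; ring
      exact (mul_eq_zero.1 h3).resolve_left (inv_ne_zero (pow_ne_zero _ hD0))
    refine Subtype.ext (funext fun i => Subtype.ext ?_)
    have h4 := T.eq_zero_of_sum_digitMonomial_eq_zero hQ hx (fun i => polyRing_le_baseRing
      (Subring.sub_mem _ (hext c i) (hext c' i))) h2 i.2
    simpa [ext, sub_eq_zero] using h4
  calc _ ≤ fib.card := hr
    _ = Nat.card fib := by simp
    _ ≤ _ := Nat.card_le_card_of_injective _ hinj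

omit [Fact p.Prime] in
theorem exists_denominator_pow_mul_mem (T : IsTower Q m x) (hQ : 2 ≤ Q) {f : K}
    (hf : f ∈ towerRing p Q x m) : ∃ B : ℕ, denominator Q x ^ B * f ∈ integralRing x := by
  suffices h : ∀ j ≤ m, towerRing p Q x j ≤ (integralRing x).localizedAt
      (polyRing_le_integralRing (denominator_mem_polyRing p Q x)) from h m le_rfl hf
  intro j hj
  induction j with
  | zero => exact fun f ⟨B, hB⟩ => ⟨B, polyRing_le_integralRing hB⟩
  | succ j ih =>
    intro f hf
    obtain ⟨σ, hσ, rfl⟩ := (T.mem_towerRing_succ hQ hj).1 hf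
    refine Subring.sum_mem _ fun i _ => Subring.mul_mem _ (ih (by omega) (hσ i))
      (Subring.pow_mem _ ?_ _)
    refine ⟨Q ^ m, ?_⟩
    exact mem_integralRing_of_forall fun V h0 => T.denominator_pow_mul_le_one hQ _ h0 hj

end IsTower

omit [Fact p.Prime] in
theorem mul_mem_poleSpace {f g : K} {E F : ℕ} (hf : f ∈ poleSpace p Q m x w E)
    (hg : g ∈ poleSpace p Q m x w F) : f * g ∈ poleSpace p Q m x w (E + F) :=
  ⟨Subring.mul_mem _ hf.1 hg.1, Subring.mul_mem _ hf.2.1 hg.2.1, by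
    rw [map_mul, pow_add]
    exact mul_le_mul' hf.2.2 hg.2.2⟩

theorem IsTower.mem_poleSpace_of_aeval_mul_mem (T : IsTower Q m x) (hQ : 2 ≤ Q) (hx : 1 < w (x 0))
    {P : (ZMod p)[X]} (hP : P ≠ 0) (hcop : IsCoprime P (asPoly Q 0)) {E : ℕ} (hE : P.natDegree ≤ E)
    {g : K} (hg : g ∈ towerRing p Q x m) (hPg : aeval (x 0) P * g ∈ poleSpace p Q m x w E) :
    g ∈ poleSpace p Q m x w (E - P.natDegree) := by
  have hx0 : w (x 0) ≠ 0 := (zero_lt_one.trans hx).ne'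
  refine ⟨hg, ?_, ?_⟩
  · obtain ⟨B, hB⟩ := T.exists_denominator_pow_mul_mem hQ hg
    obtain ⟨u, v, huv⟩ := hcop.pow_right (n := B)
    have h := congrArg (aeval (x 0)) huv
    rw [map_add, map_mul, map_mul, map_pow, aeval_asPoly_zero hQ, map_one] at h
    have hg' : g = aeval (x 0) u * (aeval (x 0) P * g) +
        aeval (x 0) v * (denominator Q x ^ B * g) := by
      linear_combination -g * h
    rw [hg']
    exact Subring.add_mem _ (Subring.mul_mem _ (polyRing_le_integralRing ⟨u, rfl⟩) hPg.2.1)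
      (Subring.mul_mem _ (polyRing_le_integralRing ⟨v, rfl⟩) hB)
  · have h := hPg.2.2
    rw [map_mul, w.map_aeval_eq hx hP, ← Nat.add_sub_cancel' hE, pow_add] at h
    exact le_of_mul_le_mul_left h (pow_pos (zero_lt_one.trans hx) _)

end LowerBound

section Evaluation

open Polynomial

/-- A polynomial with as many roots, pairwise differing by units, as coefficients, vanishes. -/
theorem eq_zero_of_sum_mul_pow_eq_zero {R : Type*} [CommRing R] {n : ℕ} (z : Fin n → R)
    (hz : ∀ i j, i ≠ j → IsUnit (z i - z j)) (g : Fin n → R)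
    (h : ∀ i, ∑ s, g s * z i ^ (s : ℕ) = 0) : g = 0 := by
  have hdet : IsUnit (Matrix.vandermonde z).det := by
    rw [Matrix.det_vandermonde, IsUnit.prod_iff]
    refine fun i _ => IsUnit.prod_iff.2 fun j hj => hz j i ?_
    exact (Finset.mem_Ioi.1 hj).ne'
  refine Matrix.mulVec_injective_of_isUnit ((Matrix.isUnit_iff_isUnit_det _).2 hdet) ?_
  ext i
  simpa [Matrix.mulVec, dotProduct, mul_comm] using h i

/-- In a field with `Q ^ 2` elements the Artin-Schreier equation over the subfield with `Q`
elements has `Q` solutions. -/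
theorem exists_injective_pow_add_eq {F : Type*} [Field F] [Fintype F] {Q : ℕ} (hQ : 2 ≤ Q)
    (hcard : Fintype.card F = Q ^ 2) (p k : ℕ) [CharP F p] [Fact p.Prime] (hp : Q = p ^ k) {γ : F}
    (hγ : γ ^ Q = γ) : ∃ α : Fin Q → F, Function.Injective α ∧ ∀ i, α i ^ Q + α i = γ := by
  classical
  have hdvd : asPoly Q γ ∣ X ^ Fintype.card F - X := by
    refine ⟨asPoly Q γ ^ (Q - 1) - 1, ?_⟩
    rw [mul_sub, ← pow_succ', Nat.sub_add_cancel (by omega), mul_one, asPoly, hp,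
      add_pow_char_pow, sub_pow_char_pow, ← hp, ← C_pow, hγ, hcard, sq, pow_mul]
    ring
  have hne := FiniteField.X_pow_card_sub_X_ne_zero F (Fintype.one_lt_card (α := F))
  have hsplit : (asPoly Q γ).Splits := by
    refine Splits.of_dvd (splits_iff_card_roots.2 ?_) hne hdvd
    rw [FiniteField.roots_X_pow_card_sub_X,
      FiniteField.X_pow_card_sub_X_natDegree_eq F Fintype.one_lt_card]
    rfl
  have hpc : p ∣ Fintype.card F := by
    rw [← CharP.cast_eq_zero_iff F p, FiniteField.cast_card_eq_zero]
  have hnodup := nodup_roots ((galois_poly_separable p _ hpc).of_dvd hdvd)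
  have hroots : (asPoly Q γ).roots.toFinset.card = Q := by
    rw [Multiset.toFinset_card_of_nodup hnodup, ← hsplit.natDegree_eq_card_roots, natDegree_asPoly hQ]
  refine ⟨fun i => ((asPoly Q γ).roots.toFinset.equivFinOfCardEq hroots).symm i,
    Subtype.val_injective.comp (Equiv.injective _), fun i => ?_⟩
  have h := ((asPoly Q γ).roots.toFinset.equivFinOfCardEq hroots).symm i |>.2
  have h0 := (mem_roots'.1 (Multiset.mem_toFinset.1 h)).2
  simp only [asPoly, IsRoot.def, eval_add, eval_sub, eval_pow, eval_X, eval_C] at h0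
  rw [← add_sub_assoc, sub_eq_zero] at h0
  exact h0

open TrivSqZeroExt in
theorem DualNumber.pow_eq_inl {F : Type*} [Field F] {Q : ℕ} (hQ : (Q : F) = 0) (b : DualNumber F) :
    b ^ Q = inl (b.fst ^ Q) := by
  ext
  · simp
  · rw [snd_pow, snd_inl, ← Nat.cast_smul_eq_nsmul F, hQ, zero_smul]

end Evaluation

section Homs

open Polynomial

variable {K : Type*} [Field K] {p : ℕ} [Algebra (ZMod p) K] {Q m : ℕ} {x : ℕ → K}

theorem gen_mem_towerRing (j : ℕ) : x j ∈ towerRing p Q x j := by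
  cases j with
  | zero => exact polyRing_le_baseRing (gen_mem_polyRing p x)
  | succ j => exact gen_succ_mem_towerRing j

variable (p Q x) in
/-- The generator `x j` as an element of the `j`-th ring of the tower. -/
noncomputable def towerGen (j : ℕ) : towerRing p Q x j := ⟨x j, gen_mem_towerRing j⟩

variable {Γ : Type*} [LinearOrderedCommGroupWithZero Γ] {w : Valuation K Γ}

namespace IsTower

theorem exists_extension [Fact p.Prime] (T : IsTower Q m x) (hQ : 2 ≤ Q) (hx : 1 < w (x 0)) {j : ℕ}
    (hj : j < m) {R : Type*} [CommRing R] (ψ : towerRing p Q x j →+* R) {z : R}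
    (hz : z ^ Q + z = ψ ⟨towerConst Q x j, T.towerConst_mem hQ hj.le⟩) :
    ∃ ψ' : towerRing p Q x (j + 1) →+* R, ψ' (towerGen p Q x (j + 1)) = z ∧
      ∀ f, ψ' (Subring.inclusion (towerRing_le_succ j) f) = ψ f := by
  set ev : (towerRing p Q x j)[X] →+* towerRing p Q x (j + 1) :=
    (eval₂RingHom (towerRing p Q x j).subtype (x (j + 1))).rangeRestrict with hev
  have hsurj : Function.Surjective ev := RingHom.rangeRestrict_surjective _
  have hcoe : ∀ P, (ev P : K) = eval₂ (towerRing p Q x j).subtype (x (j + 1)) P := fun P => rfl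
  set G : (towerRing p Q x j)[X] := asPoly Q ⟨towerConst Q x j, T.towerConst_mem hQ hj.le⟩ with hG
  have hGm : G.Monic := asPoly_monic hQ _
  have hG0 : eval₂ (towerRing p Q x j).subtype (x (j + 1)) G = 0 := by
    rw [hG, asPoly]
    simp only [eval₂_add, eval₂_sub, eval₂_pow, eval₂_X, eval₂_C, Subring.subtype_apply]
    rw [towerConst, ← T.artinSchreier_succ hj]
    ring
  have hker : RingHom.ker ev ≤ RingHom.ker (eval₂RingHom ψ z) := by
    intro P hP
    have hP0 : eval₂ (towerRing p Q x j).subtype (x (j + 1)) P = 0 := by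
      rw [← hcoe, (RingHom.mem_ker).1 hP]
      rfl
    have hlt : (P %ₘ G).natDegree < Q := by
      have := natDegree_modByMonic_lt P hGm (by
        intro h1
        have := natDegree_asPoly hQ (⟨towerConst Q x j, T.towerConst_mem hQ hj.le⟩ :
          towerRing p Q x j)
        rw [← hG, h1, natDegree_one] at this
        omega)
      rwa [hG, natDegree_asPoly hQ] at this
    have hmod : P %ₘ G = 0 := by
      rw [← modByMonic_add_div P G, eval₂_add, eval₂_mul, hG0, zero_mul, add_zero,
        eval₂_eq_sum_range' _ hlt] at hP0
      ext s
      by_cases hs : s < Q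
      · exact T.eq_zero_of_sum_pow_eq_zero (p := p) hQ hx hj
          (g := fun s => ((P %ₘ G).coeff s : K)) (fun s => ((P %ₘ G).coeff s).2) hP0 hs
      · rw [coeff_eq_zero_of_natDegree_lt (by omega)]
        rfl
    rw [RingHom.mem_ker, coe_eval₂RingHom, ← modByMonic_add_div P G, hmod, zero_add, eval₂_mul]
    have : eval₂ ψ z G = 0 := by
      rw [hG, asPoly]
      simp only [eval₂_add, eval₂_sub, eval₂_pow, eval₂_X, eval₂_C]
      linear_combination hz
    rw [this, zero_mul]
  refine ⟨ev.liftOfSurjective hsurj ⟨_, hker⟩, ?_, fun f => ?_⟩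
  · have h : towerGen p Q x (j + 1) = ev X := Subtype.ext (by simp [hcoe, towerGen])
    rw [h, RingHom.liftOfSurjective_comp_apply]
    simp
  · have h : Subring.inclusion (towerRing_le_succ j) f = ev (C f) :=
      Subtype.ext (by simp [hcoe])
    rw [h, RingHom.liftOfSurjective_comp_apply]
    simp

end IsTower

variable {F : Type*} [Field F]

/-- The residue of `x j` under the homomorphism solves `z ^ Q + z ≠ 0`. -/
def IsUnramified {j : ℕ} (ψ : towerRing p Q x j →+* DualNumber F) : Prop :=
  (ψ (towerGen p Q x j)).fst ^ Q + (ψ (towerGen p Q x j)).fst ≠ 0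

namespace IsTower

theorem fst_towerConst (T : IsTower Q m x) (hQ : 2 ≤ Q) [Fintype F]
    (hcard : Fintype.card F = Q ^ 2) (k : ℕ) [CharP F p] [Fact p.Prime] (hp : Q = p ^ k)
    {j : ℕ} (hj : j < m) {ψ : towerRing p Q x j →+* DualNumber F} (hψ : IsUnramified ψ) {γ : F}
    (hγ : γ = (ψ ⟨towerConst Q x j, T.towerConst_mem hQ hj.le⟩).fst) : γ ^ Q = γ ∧ γ ≠ 0 := by
  set α := (ψ (towerGen p Q x j)).fst with hα
  have hne : α ^ Q + α ≠ 0 := hψ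
  have hα0 : α ≠ 0 := by
    intro h
    rw [h, zero_pow (by omega), add_zero] at hne
    exact hne rfl
  have hrel : γ * (α ^ Q + α) = α ^ (Q + 1) := by
    have h : (⟨towerConst Q x j, T.towerConst_mem hQ hj.le⟩ : towerRing p Q x j) *
        (towerGen p Q x j ^ Q + towerGen p Q x j) = towerGen p Q x j ^ (Q + 1) := by
      refine Subtype.ext ?_
      have hu := T.unitFactor_ne_zero hj
      simp only [Subring.coe_mul, Subring.coe_add, Subring.coe_pow, towerGen, towerConst]
      rw [← mul_unitFactor hQ]
      field_simp
      rw [pow_succ]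
    have h2 := congrArg (fun f => (ψ f).fst) h
    simpa [← hγ, ← hα] using h2
  have hfrob : α ^ (Q * Q) = α := by rw [← sq, ← hcard, FiniteField.pow_card]
  have hadd : (α ^ Q + α) ^ Q = α ^ Q + α := by
    rw [hp, add_pow_char_pow, ← hp, ← pow_mul, hfrob, add_comm]
  constructor
  · refine mul_right_cancel₀ hne ?_
    have := congrArg (· ^ Q) hrel
    simp only [mul_pow, hadd] at this
    rw [this, hrel, ← pow_mul, add_mul, one_mul, pow_add, hfrob, pow_succ']
  · rintro rfl
    rw [zero_mul] at hrel
    exact pow_ne_zero _ hα0 hrel.symm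

/-- The homomorphisms above a given one separate polynomials in the new generator. -/
theorem exists_unramified_extensions (T : IsTower Q m x) (hQ : 2 ≤ Q) [Fintype F]
    (hcard : Fintype.card F = Q ^ 2) (k : ℕ) [CharP F p] [Fact p.Prime] (hp : Q = p ^ k)
    (hx : 1 < w (x 0)) {j : ℕ} (hj : j < m) {ψ : towerRing p Q x j →+* DualNumber F}
    (hψ : IsUnramified ψ) :
    ∃ Ψ : Fin Q → (towerRing p Q x (j + 1) →+* DualNumber F), (∀ i, IsUnramified (Ψ i)) ∧
      ∀ g : ℕ → towerRing p Q x j,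
        (∀ i, Ψ i (∑ s ∈ Finset.range Q, Subring.inclusion (towerRing_le_succ j) (g s) *
          towerGen p Q x (j + 1) ^ s) = 0) → ∀ s < Q, ψ (g s) = 0 := by
  set c := ψ ⟨towerConst Q x j, T.towerConst_mem hQ hj.le⟩ with hc
  obtain ⟨hfix, hc0⟩ := T.fst_towerConst hQ hcard k hp hj hψ (γ := c.fst) rfl
  obtain ⟨α, hinj, hα⟩ := exists_injective_pow_add_eq hQ hcard p k hp hfix
  have hQ0 : (Q : F) = 0 := by
    have hk : k ≠ 0 := by
      rintro rfl
      simp at hp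
      omega
    rw [hp, Nat.cast_pow, CharP.cast_eq_zero, zero_pow hk]
  let z : Fin Q → DualNumber F := fun i => TrivSqZeroExt.inl (α i) + TrivSqZeroExt.inr c.snd
  have hz : ∀ i, z i ^ Q + z i = c := by
    intro i
    rw [DualNumber.pow_eq_inl hQ0]
    ext
    · simp [z, hα]
    · simp [z]
  choose Ψ hΨz hΨ using fun i => T.exists_extension hQ hx hj ψ (hz i)
  refine ⟨Ψ, fun i => ?_, fun g hg => ?_⟩
  · rw [IsUnramified, hΨz]
    simpa [z, hα] using hc0
  · have h := eq_zero_of_sum_mul_pow_eq_zero z (fun i i' hii => ?_) (fun s => ψ (g s)) fun i => ?_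
    · intro s hs
      exact congrFun h ⟨s, hs⟩
    · rw [TrivSqZeroExt.isUnit_iff_isUnit_fst, isUnit_iff_ne_zero]
      simpa [z, sub_eq_zero] using hinj.ne hii
    · have := hg i
      rw [map_sum, Finset.sum_range] at this
      simpa [hΨ, hΨz] using this

/-- Homomorphisms to the dual numbers separating elements up to a factor extend up the tower. -/
theorem exists_separating_homs (T : IsTower Q m x) (hQ : 2 ≤ Q) [Fintype F]
    (hcard : Fintype.card F = Q ^ 2) (k : ℕ) [CharP F p] [Fact p.Prime] (hp : Q = p ^ k)
    (hx : 1 < w (x 0)) {s : K} {ι : Type} [Fintype ι]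
    (ψ : ι → (towerRing p Q x 0 →+* DualNumber F)) (hψ : ∀ i, IsUnramified (ψ i))
    (hs : ∀ f, (∀ i, ψ i f = 0) → ∃ g ∈ towerRing p Q x 0, (f : K) = s * g) {j : ℕ} (hj : j ≤ m) :
    ∃ Ψ : ι × (Fin j → Fin Q) → (towerRing p Q x j →+* DualNumber F), (∀ i, IsUnramified (Ψ i)) ∧
      ∀ f, (∀ i, Ψ i f = 0) → ∃ g ∈ towerRing p Q x j, (f : K) = s * g := by
  induction j with
  | zero => exact ⟨fun i => ψ i.1, fun i => hψ i.1, fun f hf => hs f fun i => hf (i, Fin.elim0)⟩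
  | succ j ih =>
    obtain ⟨Ψ, hΨ, hker⟩ := ih (by omega)
    choose Φ hΦ hΦker using fun i => T.exists_unramified_extensions hQ hcard k hp hx hj (hΨ i)
    refine ⟨fun i => Φ (i.1, Fin.init i.2) (i.2 (Fin.last j)), fun i => hΦ _ _, fun f hf => ?_⟩
    obtain ⟨g, hg, hfg⟩ := (T.mem_towerRing_succ hQ hj).1 f.2
    have hf' : f = ∑ t ∈ Finset.range Q, Subring.inclusion (towerRing_le_succ j) ⟨g t, hg t⟩ *
        towerGen p Q x (j + 1) ^ t := by
      refine Subtype.ext ?_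
      rw [hfg]
      simp [towerGen]
    have hzero : ∀ t < Q, ∀ i, Ψ i ⟨g t, hg t⟩ = 0 := fun t ht i =>
      hΦker i (fun t => ⟨g t, hg t⟩) (fun r => by
        rw [← hf']
        simpa using hf (i.1, Fin.snoc i.2 r)) t ht
    have hdiv : ∀ t, ∃ h ∈ towerRing p Q x j, t < Q → g t = s * h := by
      intro t
      by_cases ht : t < Q
      · obtain ⟨h, hh, h'⟩ := hker _ (hzero t ht)
        exact ⟨h, hh, fun _ => h'⟩
      · exact ⟨0, Subring.zero_mem _, fun h => absurd h ht⟩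
    choose h hh hgh using hdiv
    refine ⟨∑ t ∈ Finset.range Q, h t * x (j + 1) ^ t, Subring.sum_mem _ fun t _ =>
      Subring.mul_mem _ (towerRing_le_succ j (hh t)) (Subring.pow_mem _ (gen_mem_towerRing _) _), ?_⟩
    rw [hfg, Finset.mul_sum]
    exact Finset.sum_congr rfl fun t ht => by rw [hgh t (Finset.mem_range.1 ht), mul_assoc]

end IsTower

end Homs

section BaseHoms

open Polynomial TrivSqZeroExt

variable {p : ℕ} [Fact p.Prime] {F : Type*} [Field F] [Fintype F] [Algebra (ZMod p) F]

theorem minpoly_sq_dvd {a : F} {P : (ZMod p)[X]}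
    (h : aeval (inl a + DualNumber.eps : DualNumber F) P = 0) : minpoly (ZMod p) a ^ 2 ∣ P := by
  have h_int : IsIntegral (ZMod p) a := Algebra.IsIntegral.isIntegral a
  have hinl : ∀ R : (ZMod p)[X], aeval (inl a : DualNumber F) R = inl (aeval a R) := fun R =>
    aeval_algHom_apply (inlAlgHom (ZMod p) F F) a R
  have key : ∀ R : (ZMod p)[X], aeval (inl a + DualNumber.eps : DualNumber F) R =
      inl (aeval a R) + inr (aeval a (derivative R)) := by
    intro R
    rw [aeval_add_of_sq_eq_zero _ _ _ (by rw [sq, DualNumber.eps_mul_eps]), hinl, hinl]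
    ext <;> simp
  rw [key] at h
  have h0 : aeval a P = 0 := by simpa using congrArg fst h
  have h1 : aeval a (derivative P) = 0 := by simpa using congrArg snd h
  obtain ⟨R, rfl⟩ := (minpoly.dvd_iff).2 h0
  have hsep : aeval a (derivative (minpoly (ZMod p) a)) ≠ 0 :=
    (PerfectField.separable_of_irreducible (minpoly.irreducible h_int)).aeval_derivative_ne_zero
      (minpoly.aeval _ _)
  rw [derivative_mul, map_add, map_mul, map_mul, minpoly.aeval, zero_mul, add_zero] at h1
  rw [sq]
  exact mul_dvd_mul_left _ ((minpoly.dvd_iff).2 ((mul_eq_zero.1 h1).resolve_left hsep))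

variable {ι : Type} [Fintype ι] (p) in
/-- The product of the squares of the minimal polynomials of a family of points. -/
noncomputable def doubledPoints (a : ι → F) : (ZMod p)[X] := ∏ i, minpoly (ZMod p) (a i) ^ 2

variable {ι : Type} [Fintype ι] {a : ι → F}

theorem doubledPoints_ne_zero : doubledPoints p a ≠ 0 :=
  Finset.prod_ne_zero_iff.2 fun i _ => pow_ne_zero _
    (minpoly.ne_zero (Algebra.IsIntegral.isIntegral (a i)))

theorem natDegree_doubledPoints {d : ℕ} (hd : ∀ i, (minpoly (ZMod p) (a i)).natDegree = d) :
    (doubledPoints p a).natDegree = Fintype.card ι * (2 * d) := by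
  rw [doubledPoints, natDegree_prod_of_monic]
  · simp [natDegree_pow, hd]
  · exact fun i _ => (minpoly.monic (Algebra.IsIntegral.isIntegral (a i))).pow 2

theorem isCoprime_doubledPoints {Q : ℕ} (hne : ∀ i, a i ^ Q + a i ≠ 0) :
    IsCoprime (doubledPoints p a) (asPoly Q 0) := by
  refine IsCoprime.prod_left fun i _ => IsCoprime.pow_left ?_
  rw [(minpoly.irreducible (Algebra.IsIntegral.isIntegral (a i))).coprime_iff_not_dvd,
    minpoly.dvd_iff]
  simpa [asPoly] using hne i

theorem doubledPoints_dvd (hinj : Function.Injective fun i => minpoly (ZMod p) (a i)) {P : (ZMod p)[X]}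
    (h : ∀ i, aeval (inl (a i) + DualNumber.eps : DualNumber F) P = 0) : doubledPoints p a ∣ P := by
  refine Finset.prod_dvd_of_coprime (fun i _ j _ hij => IsCoprime.pow ?_)
    fun i _ => minpoly_sq_dvd (h i)
  have hi : ∀ i, IsIntegral (ZMod p) (a i) := fun i => Algebra.IsIntegral.isIntegral _
  rw [(minpoly.irreducible (hi i)).coprime_iff_not_dvd]
  intro hdvd
  exact hij (hinj (eq_of_monic_of_associated (minpoly.monic (hi i)) (minpoly.monic (hi j))
    ((minpoly.irreducible (hi i)).associated_of_dvd (minpoly.irreducible (hi j)) hdvd)))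

variable {K : Type*} [Field K] [Algebra (ZMod p) K] {Q m : ℕ} {x : ℕ → K}
  {Γ : Type*} [LinearOrderedCommGroupWithZero Γ] {w : Valuation K Γ}

theorem exists_hom_towerRing_zero (hQ : 2 ≤ Q) (hx : 1 < w (x 0)) {R : Type*} [CommRing R]
    [Algebra (ZMod p) R] {z : R} (hz : IsUnit (z ^ Q + z)) :
    ∃ ψ : towerRing p Q x 0 →+* R, ∀ P : (ZMod p)[X],
      ψ ⟨aeval (x 0) P, polyRing_le_baseRing ⟨P, rfl⟩⟩ = aeval z P := by
  let φ : (ZMod p)[X] →+* towerRing p Q x 0 :=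
    (aeval (R := ZMod p) (x 0)).toRingHom.codRestrict _ fun P => polyRing_le_baseRing ⟨P, rfl⟩
  have hφ : ∀ P, (φ P : K) = aeval (x 0) P := fun P => rfl
  have hφD : (φ (asPoly Q 0) : K) = denominator Q x := by rw [hφ, aeval_asPoly_zero hQ]
  have hD := denominator_ne_zero hQ hx
  let _ := φ.toAlgebra
  have : IsLocalization.Away (asPoly Q (0 : ZMod p)) (towerRing p Q x 0) := by
    refine ⟨?_, ?_, ?_⟩
    · rintro ⟨_, n, rfl⟩
      rw [map_pow]
      refine IsUnit.pow _ (IsUnit.of_mul_eq_one ⟨_, inv_denominator_mem_baseRing⟩ (Subtype.ext ?_))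
      change (φ (asPoly Q 0) : K) * (denominator Q x)⁻¹ = 1
      rw [hφD, mul_inv_cancel₀ hD]
    · rintro ⟨f, hf⟩
      obtain ⟨B, P, hP⟩ := mem_baseRing.1 hf
      refine ⟨(P, ⟨_, B, rfl⟩), Subtype.ext ?_⟩
      change f * (φ (asPoly Q 0 ^ B) : K) = aeval (x 0) P
      rw [map_pow, Subring.coe_pow, hφD, mul_comm]
      exact hP.symm
    · intro P P' h
      exact ⟨1, by rw [aeval_injective_of_one_lt hx (congrArg Subtype.val h)]⟩
  have hu : IsUnit ((aeval (R := ZMod p) z).toRingHom (asPoly Q 0)) := by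
    simpa [asPoly] using hz
  exact ⟨IsLocalization.Away.lift _ hu, fun P => IsLocalization.Away.lift_eq _ hu P⟩

theorem IsTower.exists_homs (T : IsTower Q m x) (hQ : 2 ≤ Q) (hcard : Fintype.card F = Q ^ 2)
    (k : ℕ) (hp : Q = p ^ k) (hx : 1 < w (x 0))
    (hinj : Function.Injective fun i => minpoly (ZMod p) (a i)) (hne : ∀ i, a i ^ Q + a i ≠ 0) :
    ∃ Ψ : ι × (Fin m → Fin Q) → (towerRing p Q x m →+* DualNumber F),
      ∀ f, (∀ i, Ψ i f = 0) → ∃ g ∈ towerRing p Q x m, (f : K) = aeval (x 0) (doubledPoints p a) * g := by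
  have hchar : CharP F p := charP_of_injective_algebraMap (algebraMap (ZMod p) F).injective p
  have hunit : ∀ i, IsUnit ((inl (a i) + DualNumber.eps : DualNumber F) ^ Q +
      (inl (a i) + DualNumber.eps)) := fun i => by
    rw [isUnit_iff_isUnit_fst, isUnit_iff_ne_zero]
    simpa using hne i
  choose ψ hψ using fun i => exists_hom_towerRing_zero (p := p) hQ hx (hunit i)
  have hψu : ∀ i, IsUnramified (ψ i) := fun i => by
    have h := hψ i X
    simp only [aeval_X] at h
    rw [IsUnramified, towerGen, h]
    simpa using hne i
  refine (T.exists_separating_homs hQ hcard k hp hx (s := aeval (x 0) (doubledPoints p a)) ψ hψu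
    (fun f hf => ?_) le_rfl).imp fun _ h => h.2
  obtain ⟨B, P, hP⟩ := mem_baseRing.1 f.2
  have hP' : aeval (x 0) P = denominator Q x ^ B * f := hP
  have hD := denominator_ne_zero hQ hx
  have hdvd : doubledPoints p a ∣ P := doubledPoints_dvd hinj fun i => by
    have h : (⟨aeval (x 0) P, polyRing_le_baseRing ⟨P, rfl⟩⟩ : towerRing p Q x 0) =
        ⟨denominator Q x ^ B, Subring.pow_mem _
          (polyRing_le_baseRing (denominator_mem_polyRing p Q x)) B⟩ * f := Subtype.ext hP'
    rw [← hψ i, h, map_mul, hf i, mul_zero]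
  obtain ⟨R, rfl⟩ := hdvd
  refine ⟨(denominator Q x)⁻¹ ^ B * aeval (x 0) R, Subring.mul_mem _ (Subring.pow_mem _
    inv_denominator_mem_baseRing _) (polyRing_le_baseRing ⟨R, rfl⟩), ?_⟩
  rw [mul_left_comm, ← map_mul, hP', ← mul_assoc, ← mul_pow, inv_mul_cancel₀ hD, one_pow, one_mul]

end BaseHoms

section Counting

theorem AddMonoidHom.card_preimage_mul_card {G H : Type*} [AddGroup G] [AddGroup H] [Finite G]
    [Finite H] (f : G →+ H) (hf : Function.Surjective f) (T : Set H) :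
    (f ⁻¹' T).ncard * Nat.card H = Nat.card G * T.ncard := by
  classical
  have := Fintype.ofFinite G
  have := Fintype.ofFinite H
  have key : ∀ T : Finset H, (Finset.univ.filter fun g => f g ∈ T).card =
      T.card * (Finset.univ.filter fun g => f g = 0).card := fun T => by
    rw [Finset.card_eq_sum_card_fiberwise (f := f) (t := T) (fun g hg => by simpa using hg),
      Finset.sum_const_nat fun t ht => ?_]
    rw [← AddMonoidHom.card_fiber_eq_of_mem_range f (hf t) (hf 0), Finset.filter_filter]
    congr 1
    ext g
    simp only [Finset.mem_filter, Finset.mem_univ, true_and]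
    exact ⟨fun h => h.2, fun h => ⟨h ▸ ht, h⟩⟩
  have hG := key Finset.univ
  simp only [Finset.mem_univ, Finset.filter_true, Finset.card_univ] at hG
  have hT := key T.toFinset
  have h1 : (f ⁻¹' T).ncard = (Finset.univ.filter fun g => f g ∈ T.toFinset).card := by
    rw [← Set.ncard_coe_finset]
    congr 1
    ext g
    simp
  rw [h1, hT, Nat.card_eq_fintype_card, Nat.card_eq_fintype_card, hG, Set.ncard_eq_toFinset_card']
  ring

variable {R S β : Type*} [CommRing R] [CommRing S] {Φ : β → R →+* S}
  {V W : AddSubgroup R}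

/-- The maps `Φ b`, for `b` in `J`, jointly map `V` onto all families in `S`. -/
def JointlySurjective (Φ : β → R →+* S) (V : AddSubgroup R) (J : Finset β) : Prop :=
  ∀ y : β → S, ∃ v ∈ V, ∀ b ∈ J, Φ b v = y b

/-- The elements of `V` whose image under each `Φ b`, for `b` in `J`, lies in `T`. -/
def blockSet (Φ : β → R →+* S) (V : AddSubgroup R) (J : Finset β) (T : Set S) : Set R :=
  {v | v ∈ V ∧ ∀ b ∈ J, Φ b v ∈ T}

theorem JointlySurjective.mono {J : Finset β} (h : JointlySurjective Φ V J) (hVW : V ≤ W) :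
    JointlySurjective Φ W J := fun y => (h y).imp fun _ hv => ⟨hVW hv.1, hv.2⟩

theorem JointlySurjective.ncard_blockSet [Finite S] {J : Finset β} [Finite V] (h : JointlySurjective Φ V J)
    (T : Set S) :
    (blockSet Φ V J T).ncard * Nat.card S ^ J.card = Nat.card V * T.ncard ^ J.card := by
  classical
  let f : V →+ (J → S) := AddMonoidHom.pi fun b => (Φ b : R →+ S).comp V.subtype
  have hf : Function.Surjective f := fun y => by
    obtain ⟨v, hv, hvy⟩ := h fun b => if hb : b ∈ J then y ⟨b, hb⟩ else 0
    refine ⟨⟨v, hv⟩, funext fun b => ?_⟩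
    change Φ b v = y b
    simpa using hvy b b.2
  have key := f.card_preimage_mul_card hf (Set.univ.pi fun _ => T)
  have h1 : (blockSet Φ V J T) = V.subtype '' (f ⁻¹' Set.univ.pi fun _ => T) := by
    ext v
    simp [blockSet, f, Set.mem_pi]
    tauto
  have h2 : (Set.univ.pi fun _ : J => T).ncard = T.ncard ^ J.card := by
    have := Fintype.ofFinite S
    rw [← Nat.card_coe_set_eq, Nat.card_congr (Equiv.Set.univPi fun _ : J => T), Nat.card_pi]
    simp [Nat.card_coe_set_eq, -Nat.card_eq_fintype_card]
  rw [h1, Set.ncard_image_of_injective _ V.subtype_injective, ← h2, ← key, Nat.card_fun]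
  simp

theorem blockSet_add_subset {J : Finset β} {T : Set S} :
    blockSet Φ V J T + blockSet Φ V J T ⊆ V := by
  rintro _ ⟨v, hv, u, hu, rfl⟩
  exact V.add_mem hv.1 hu.1

theorem blockSet_mul_subset {J : Finset β} {T : Set S} (hVW : ∀ v ∈ V, ∀ u ∈ V, v * u ∈ W) :
    blockSet Φ V J T * blockSet Φ V J T ⊆ blockSet Φ W J (T * T) := by
  rintro _ ⟨v, hv, u, hu, rfl⟩
  exact ⟨hVW v hv.1 u hu.1, fun b hb => by
    rw [map_mul]
    exact Set.mul_mem_mul (hv.2 b hb) (hu.2 b hb)⟩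

theorem AddMonoidHom.card_inf_ker_mul_card_map {G H : Type*} [AddGroup G] [AddGroup H]
    (f : G →+ H) (U : AddSubgroup G) :
    Nat.card (U ⊓ f.ker : AddSubgroup G) * Nat.card (U.map f) = Nat.card U := by
  rw [← AddSubgroup.relIndex_ker, ← AddSubgroup.relIndex_bot_left, ← AddSubgroup.relIndex_bot_left,
    ← AddSubgroup.inf_relIndex_left U f.ker,
    AddSubgroup.relIndex_mul_relIndex _ _ _ bot_le inf_le_left]

/-- The elements of `V` which vanish under each `Φ b`, for `b` in `s`. -/
def commonKer (Φ : β → R →+* S) (V : AddSubgroup R) (s : Finset β) : AddSubgroup R where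
  carrier := {v | v ∈ V ∧ ∀ b ∈ s, Φ b v = 0}
  zero_mem' := ⟨V.zero_mem, fun b _ => map_zero _⟩
  add_mem' hu hv := ⟨V.add_mem hu.1 hv.1, fun b hb => by rw [map_add, hu.2 b hb, hv.2 b hb, add_zero]⟩
  neg_mem' hu := ⟨V.neg_mem hu.1, fun b hb => by rw [map_neg, hu.2 b hb, neg_zero]⟩

theorem mem_commonKer {s : Finset β} {v : R} :
    v ∈ commonKer Φ V s ↔ v ∈ V ∧ ∀ b ∈ s, Φ b v = 0 := Iff.rfl

theorem commonKer_insert [DecidableEq β] {s : Finset β} {b : β} :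
    commonKer Φ V (insert b s) = commonKer Φ V s ⊓ (Φ b : R →+ S).ker := by
  ext v
  simp [mem_commonKer, AddMonoidHom.mem_ker]
  tauto

theorem JointlySurjective.insert [DecidableEq β] {J : Finset β} {b : β}
    (h : JointlySurjective Φ V J) (hb : (commonKer Φ V J).map (Φ b : R →+ S) = ⊤) :
    JointlySurjective Φ V (insert b J) := fun y => by
  obtain ⟨v, hv, hvy⟩ := h y
  obtain ⟨u, hu, huy⟩ : y b - Φ b v ∈ (commonKer Φ V J).map (Φ b : R →+ S) := hb ▸ trivial
  refine ⟨v + u, V.add_mem hv hu.1, fun c hc => ?_⟩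
  obtain rfl | hc := Finset.mem_insert.1 hc
  · change Φ c u = _ at huy
    rw [map_add, huy, add_sub_cancel]
  · rw [map_add, hvy c hc, hu.2 c hc, add_zero]

/-- A subset of the maps which is jointly surjective, omitting few maps when few elements of `V`
vanish under all of them. -/
theorem exists_jointlySurjective [Finite S] [DecidableEq β] [Finite V] (s : Finset β) :
    ∃ J ⊆ s, JointlySurjective Φ V J ∧ Nat.card V * 2 ^ (s.card - J.card) ≤
      Nat.card (commonKer Φ V s) * Nat.card S ^ s.card := by
  induction s using Finset.induction_on with
  | empty =>
    refine ⟨∅, subset_rfl, fun y => ⟨0, V.zero_mem, by simp⟩, ?_⟩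
    have : commonKer Φ V ∅ = V := by
      ext v
      simp [mem_commonKer]
    rw [this]
    simp
  | insert b s hb ih =>
    obtain ⟨J, hJs, hJ, hcard⟩ := ih
    have hmul := (Φ b : R →+ S).card_inf_ker_mul_card_map (commonKer Φ V s)
    rw [← commonKer_insert] at hmul
    have hJle := Finset.card_le_card hJs
    rw [Finset.card_insert_of_notMem hb]
    by_cases htop : (commonKer Φ V J).map (Φ b : R →+ S) = ⊤
    · refine ⟨insert b J, Finset.insert_subset_insert b hJs, hJ.insert htop, ?_⟩
      rw [Finset.card_insert_of_notMem (fun h => hb (hJs h)), Nat.add_sub_add_right]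
      have hle : Nat.card ((commonKer Φ V s).map (Φ b : R →+ S)) ≤ Nat.card S :=
        Nat.card_le_card_of_injective _ Subtype.val_injective
      calc _ ≤ _ := hcard
        _ ≤ Nat.card (commonKer Φ V (insert b s)) * Nat.card S * Nat.card S ^ s.card := by
          rw [← hmul]
          gcongr
        _ = _ := by ring
    · refine ⟨J, hJs.trans (Finset.subset_insert b s), hJ, ?_⟩
      have hle : 2 * Nat.card ((commonKer Φ V s).map (Φ b : R →+ S)) ≤ Nat.card S := by
        have h1 : Nat.card ((commonKer Φ V s).map (Φ b : R →+ S)) ≤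
            Nat.card ((commonKer Φ V J).map (Φ b : R →+ S)) :=
          AddSubgroup.card_le_of_le (AddSubgroup.map_mono fun v hv =>
            ⟨hv.1, fun c hc => hv.2 c (hJs hc)⟩)
        have h2 := ((commonKer Φ V J).map (Φ b : R →+ S)).card_mul_index
        have h3 := AddSubgroup.one_lt_index_of_ne_top htop
        nlinarith
      rw [Nat.sub_add_comm hJle, pow_succ]
      calc _ = (Nat.card V * 2 ^ (s.card - J.card)) * 2 := by ring
        _ ≤ Nat.card (commonKer Φ V s) * Nat.card S ^ s.card * 2 := by gcongr
        _ = Nat.card (commonKer Φ V (insert b s)) *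
            (2 * Nat.card ((commonKer Φ V s).map (Φ b : R →+ S))) * Nat.card S ^ s.card := by
          rw [← hmul]
          ring
        _ ≤ Nat.card (commonKer Φ V (insert b s)) * Nat.card S * Nat.card S ^ s.card := by
          gcongr
        _ = _ := by ring

end Counting

section DualNumbers

variable (F : Type*) [Field F]

/-- The pairs of dual numbers at least one of which is infinitesimal. -/
def crossSet : Set (DualNumber F × DualNumber F) := {z | z.1.fst = 0 ∨ z.2.fst = 0}

variable {F} [Finite F]

instance : Finite (DualNumber F) := inferInstanceAs (Finite (F × F))

omit [Field F] [Finite F] in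
theorem DualNumber.card : Nat.card (DualNumber F) = Nat.card F ^ 2 := by
  rw [sq]
  exact Nat.card_prod F F

omit [Finite F] in
theorem ncard_infinitesimal : {z : DualNumber F | z.fst = 0}.ncard = Nat.card F := by
  have h : {z : DualNumber F | z.fst = 0} = Set.range (TrivSqZeroExt.inr : F → DualNumber F) := by
    ext z
    refine ⟨fun hz => ⟨z.snd, TrivSqZeroExt.ext ?_ ?_⟩, ?_⟩
    · exact hz.symm
    · rfl
    · rintro ⟨y, rfl⟩
      rfl
  rw [h, ← Set.image_univ, Set.ncard_image_of_injective _ TrivSqZeroExt.inr_injective, Set.ncard_univ]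

theorem ncard_crossSet : (crossSet F).ncard + Nat.card F ^ 2 = 2 * Nat.card F ^ 3 := by
  set Z := {z : DualNumber F | z.fst = 0} with hZ
  have h1 : crossSet F = Z ×ˢ Set.univ ∪ Set.univ ×ˢ Z := by
    ext z
    simp [crossSet, hZ]
  have h2 : (Z ×ˢ Set.univ ∩ Set.univ ×ˢ Z : Set (DualNumber F × DualNumber F)) = Z ×ˢ Z := by
    ext z
    simp
  have h := Set.ncard_union_add_ncard_inter (Z ×ˢ Set.univ) (Set.univ ×ˢ Z)
  rw [h2, ← h1, Set.ncard_prod, Set.ncard_prod, Set.ncard_prod, Set.ncard_univ, DualNumber.card,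
    ncard_infinitesimal] at h
  rw [sq, h]
  ring

theorem ncard_crossSet_mul_crossSet_le : (crossSet F * crossSet F).ncard ≤ 3 * Nat.card F ^ 2 := by
  set Z := {z : DualNumber F | z.fst = 0} with hZ
  have hmul : ∀ u ∈ Z, ∀ v ∈ Z, u * v = 0 := fun u hu v hv =>
    TrivSqZeroExt.ext (by simp [show u.fst = 0 from hu]) (by
      simp [show u.fst = 0 from hu, show v.fst = 0 from hv])
  have hsub : crossSet F * crossSet F ⊆ {0} ×ˢ Set.univ ∪ Set.univ ×ˢ {0} ∪ Z ×ˢ Z := by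
    rintro _ ⟨u, hu | hu, v, hv | hv, rfl⟩
    · exact Or.inl (Or.inl ⟨hmul _ hu _ hv, trivial⟩)
    · exact Or.inr ⟨by simp [hZ, hu], by simp [hZ, hv]⟩
    · exact Or.inr ⟨by simp [hZ, hv], by simp [hZ, hu]⟩
    · exact Or.inl (Or.inr ⟨trivial, hmul _ hu _ hv⟩)
  refine (Set.ncard_le_ncard hsub).trans ((Set.ncard_union_le _ _).trans
    ((add_le_add_left (Set.ncard_union_le _ _) _).trans_eq ?_))
  rw [Set.ncard_prod, Set.ncard_prod, Set.ncard_prod, Set.ncard_univ, DualNumber.card,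
    ncard_infinitesimal, Set.ncard_singleton]
  ring

theorem ncard_crossSet_ineq (hF : 16 ≤ Nat.card F) :
    5 * ((crossSet F * crossSet F).ncard * Nat.card F ^ 4) ≤ 4 * (crossSet F).ncard ^ 2 := by
  have h1 := ncard_crossSet (F := F)
  have h2 := ncard_crossSet_mul_crossSet_le (F := F)
  set q := Nat.card F
  have h3 : ((crossSet F).ncard : ℤ) = q ^ 2 * (2 * q - 1) := by
    have : ((crossSet F).ncard : ℤ) + q ^ 2 = 2 * q ^ 3 := by exact_mod_cast h1
    linear_combination this
  have h4 : 5 * ((crossSet F * crossSet F).ncard * q ^ 4) ≤ 5 * (3 * q ^ 2 * q ^ 4) := by gcongr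
  refine h4.trans ?_
  zify
  rw [h3]
  have hq : (16 : ℤ) ≤ q := by exact_mod_cast hF
  have h5 : 15 * (q : ℤ) ^ 2 ≤ 4 * (2 * q - 1) ^ 2 := by nlinarith
  calc (5 * (3 * q ^ 2 * q ^ 4) : ℤ) = q ^ 4 * (15 * q ^ 2) := by ring
    _ ≤ q ^ 4 * (4 * (2 * q - 1) ^ 2) := by gcongr
    _ = _ := by ring

end DualNumbers

section Combine

open Polynomial

variable {p : ℕ} {F : Type*} [Field F] {ι : Type} [Fintype ι]
  {K : Type*} [Field K] [Algebra (ZMod p) K] {Q m : ℕ} {x : ℕ → K}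
  {Γ : Type*} [LinearOrderedCommGroupWithZero Γ] {w : Valuation K Γ}

theorem AddSubgroup.card_comap_subtype {R : Type*} [Ring R] (R₀ : Subring R) {V : AddSubgroup R}
    (hV : ∀ v ∈ V, v ∈ R₀) : Nat.card (V.comap (R₀.subtype : R₀ →+ R)) = Nat.card V :=
  Nat.card_congr ⟨fun v => ⟨v.1, v.2⟩, fun v => ⟨⟨v, hV v v.2⟩, v.2⟩, fun _ => rfl, fun _ => rfl⟩

theorem AddSubgroup.card_le_of_forall_exists_mul {K : Type*} [Field K] {U V : AddSubgroup K} [Finite V]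
    {s : K} (h : ∀ u ∈ U, ∃ v ∈ V, u = s * v) : Nat.card U ≤ Nat.card V := by
  choose g hg hug using fun u : U => h u u.2
  refine Nat.card_le_card_of_injective (fun u => (⟨g u, hg u⟩ : V)) fun u u' huu => Subtype.ext ?_
  rw [hug, hug u', Subtype.mk.inj huu]

variable [Algebra (ZMod p) F] [Fact p.Prime] [Fintype F]

theorem IsTower.exists_set (T : IsTower Q m x) (hQ : 2 ≤ Q) (hadd : ∀ a b : K, (a + b) ^ Q = a ^ Q + b ^ Q)
    (hcard : Fintype.card F = Q ^ 2) (k : ℕ) (hp : Q = p ^ k) (hF : 16 ≤ Q ^ 2) (hx : 1 < w (x 0))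
    (hw : BoundsPoles p w (w (x m))) {a : ι × Bool → F}
    (hinj : Function.Injective fun i => minpoly (ZMod p) (a i)) (hne : ∀ i, a i ^ Q + a i ≠ 0)
    (hd : ∀ i, (minpoly (ZMod p) (a i)).natDegree = 2 * k) {E : ℕ} (hE : Q ≤ E)
    (hE' : Fintype.card ι * (8 * k) ≤ E) :
    ∃ A : Set K, ∃ J ≤ Fintype.card ι * Q ^ m, A.Finite ∧ A.ncard ≤ p ^ (Q ^ m * E + 1) ∧
      (A + A).ncard ≤ p ^ (Q ^ m * E + 1) ∧ p ^ (Q ^ m * (E - Q)) ≤ A.ncard * p ^ (2 * k * J) ∧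
      2 ^ (Fintype.card ι * Q ^ m - J) ≤ p ^ (Q ^ m * Q + 1) ∧
      (A * A).ncard * 5 ^ J ≤ p ^ (Q ^ m * (2 * Q) + 1) * 4 ^ J * A.ncard ^ 2 := by
  classical
  let R := towerRing p Q x m
  obtain ⟨Ψ, hΨ⟩ := T.exists_homs hQ hcard k hp hx hinj hne
  let Φ : ι × (Fin m → Fin Q) → R →+* DualNumber F × DualNumber F :=
    fun b => (Ψ ((b.1, false), b.2)).prod (Ψ ((b.1, true), b.2))
  obtain ⟨hVfin, hVcard⟩ := T.card_poleSpace_le hQ hx hw E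
  obtain ⟨hWfin, hWcard⟩ := T.card_poleSpace_le hQ hx hw (E + E)
  set V := poleSpace p Q m x w E with hV
  set V' := V.comap (R.subtype : R →+ K) with hV'
  set W' := (poleSpace p Q m x w (E + E)).comap (R.subtype : R →+ K) with hW'
  have hVc : Nat.card V' = Nat.card V := AddSubgroup.card_comap_subtype R fun v hv => hv.1
  have hWc : Nat.card W' = Nat.card (poleSpace p Q m x w (E + E)) :=
    AddSubgroup.card_comap_subtype R fun v hv => hv.1
  have hV'fin : Finite V' := Nat.finite_of_card_ne_zero (hVc ▸ Nat.card_pos.ne')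
  have hW'fin : Finite W' := Nat.finite_of_card_ne_zero (hWc ▸ Nat.card_pos.ne')
  have hVlow : p ^ (Q ^ m * (E - Q)) ≤ Nat.card V' := hVc ▸ T.le_card_poleSpace hQ hadd hx hE
  have hVW : V' ≤ W' := fun v hv => ⟨hv.1, hv.2.1, hv.2.2.trans (pow_le_pow_right₀ hx.le (by omega))⟩
  obtain ⟨J, -, hJ, hJcard⟩ := exists_jointlySurjective (Φ := Φ) (V := V') Finset.univ
  have hp0 : 0 < p := (Fact.out : p.Prime).pos
  have hdeg : (doubledPoints p a).natDegree = Fintype.card ι * (8 * k) := by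
    rw [natDegree_doubledPoints hd, Fintype.card_prod, Fintype.card_bool]
    ring
  have hcardF : Nat.card F = p ^ (2 * k) := by
    rw [Nat.card_eq_fintype_card, hcard, hp]
    ring
  have hS : Nat.card (DualNumber F × DualNumber F) = Nat.card F ^ 4 := by
    rw [Nat.card_prod, DualNumber.card]
    ring
  have hker : Nat.card (commonKer Φ V' Finset.univ) ≤
      p ^ (Q ^ m * (E - Fintype.card ι * (8 * k)) + 1) := by
    obtain ⟨hUfin, hUcard⟩ := T.card_poleSpace_le hQ hx hw (E - (doubledPoints p a).natDegree)
    rw [← hdeg]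
    refine le_trans ?_ hUcard
    rw [← AddSubgroup.card_map_of_injective (K := commonKer Φ V' Finset.univ)
      (f := (R.subtype : R →+ K)) (show Function.Injective (R.subtype : R →+ K) from Subtype.val_injective)]
    refine AddSubgroup.card_le_of_forall_exists_mul (s := aeval (x 0) (doubledPoints p a)) ?_
    rintro _ ⟨f, hf, rfl⟩
    obtain ⟨g, hg, hfg⟩ := hΨ f fun i => by
      obtain ⟨⟨i, b⟩, s⟩ := i
      have h := hf.2 (i, s) (Finset.mem_univ _)
      cases b
      · exact congrArg Prod.fst h
      · exact congrArg Prod.snd h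
    refine ⟨g, T.mem_poleSpace_of_aeval_mul_mem hQ hx (doubledPoints_ne_zero) (isCoprime_doubledPoints hne)
      (hdeg ▸ hE') hg (hfg ▸ hf.1), hfg⟩
  have hβ : (Finset.univ : Finset (ι × (Fin m → Fin Q))).card = Fintype.card ι * Q ^ m := by simp
  have hJle : J.card ≤ Fintype.card ι * Q ^ m := hβ ▸ Finset.card_le_univ J
  rw [hβ] at hJcard
  have hA := hJ.ncard_blockSet (crossSet F)
  have hAA := (hJ.mono hVW).ncard_blockSet (crossSet F * crossSet F)
  rw [hS] at hA hAA hJcard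
  have hsub := blockSet_mul_subset (Φ := Φ) (J := J) (T := crossSet F) (W := W') (V := V')
    fun v hv u hu => mul_mem_poleSpace hv hu
  set A := blockSet Φ V' J (crossSet F) with hAdef
  have hAV : A ⊆ V' := fun v hv => hv.1
  have hAAcard : (A * A).ncard ≤ (blockSet Φ W' J (crossSet F * crossSet F)).ncard :=
    Set.ncard_le_ncard hsub ((Set.toFinite (W' : Set R)).subset fun v hv => hv.1)
  have hinjR : Function.Injective R.subtype := Subtype.val_injective
  have hle : ∀ B : Set R, B ⊆ V' → B.ncard ≤ p ^ (Q ^ m * E + 1) := fun B hB =>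
    (Set.ncard_le_ncard hB).trans (by
      rw [← Nat.card_coe_set_eq]
      exact hVc.le.trans hVcard)
  refine ⟨R.subtype '' A, J.card, hJle, ((Set.toFinite (V' : Set R)).subset hAV).image _, ?_, ?_, ?_, ?_, ?_⟩
  · rw [Set.ncard_image_of_injective _ hinjR]
    exact hle A hAV
  · rw [← Set.image_add, Set.ncard_image_of_injective _ hinjR]
    exact hle _ blockSet_add_subset
  · rw [Set.ncard_image_of_injective _ hinjR, pow_mul p (2 * k), ← hcardF]
    refine hVlow.trans ?_
    have hT : Nat.card F ^ 3 ≤ (crossSet F).ncard := by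
      have h1 := ncard_crossSet (F := F)
      have h2 : Nat.card F ^ 2 ≤ Nat.card F ^ 3 := Nat.pow_le_pow_right Nat.card_pos (by omega)
      omega
    have hpos : 0 < (Nat.card F ^ 3) ^ J.card := pow_pos (pow_pos Nat.card_pos _) _
    refine Nat.le_of_mul_le_mul_right ?_ hpos
    calc Nat.card V' * (Nat.card F ^ 3) ^ J.card ≤ Nat.card V' * (crossSet F).ncard ^ J.card := by
          gcongr
      _ = _ := by
        rw [← hA, mul_assoc, ← mul_pow]
        ring
  · have h1 : p ^ (Q ^ m * (E - Q)) * 2 ^ (Fintype.card ι * Q ^ m - J.card) ≤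
        p ^ (Q ^ m * (E - Q)) * p ^ (Q ^ m * Q + 1) := by
      refine (Nat.mul_le_mul_right _ hVlow).trans (hJcard.trans ((Nat.mul_le_mul_right _ hker).trans_eq ?_))
      rw [hcardF, ← pow_mul, ← pow_mul, ← pow_add, ← pow_add]
      have h2 : Q ^ m * (E - Q) + Q ^ m * Q = Q ^ m * E := by rw [← mul_add, Nat.sub_add_cancel hE]
      have h3 : Q ^ m * (E - Fintype.card ι * (8 * k)) + Q ^ m * (Fintype.card ι * (8 * k)) =
          Q ^ m * E := by rw [← mul_add, Nat.sub_add_cancel hE']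
      congr 1
      linarith
    exact Nat.le_of_mul_le_mul_left h1 (pow_pos hp0 _)
  · rw [← Set.image_mul, Set.ncard_image_of_injective _ hinjR, Set.ncard_image_of_injective _ hinjR]
    have hW : Nat.card W' ≤ p ^ (Q ^ m * (2 * Q) + 1) * Nat.card V' ^ 2 := by
      rw [hWc]
      refine hWcard.trans (le_trans (le_of_eq ?_) (Nat.mul_le_mul_left _ (Nat.pow_le_pow_left hVlow 2)))
      obtain ⟨e, rfl⟩ := Nat.exists_eq_add_of_le hE
      rw [← pow_mul, ← pow_add, Nat.add_sub_cancel_left]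
      congr 1
      ring
    have hineq := Nat.pow_le_pow_left (ncard_crossSet_ineq (F := F) (by
      rwa [Nat.card_eq_fintype_card, hcard])) J.card
    set q := Nat.card F
    have hpos : 0 < (q ^ 4) ^ J.card := pow_pos (pow_pos Nat.card_pos _) _
    have hVpos : 0 < Nat.card V' := Nat.card_pos
    have hpos' : 0 < ((q ^ 4) ^ J.card) ^ 2 * Nat.card V' ^ 2 := by positivity
    refine Nat.le_of_mul_le_mul_right ?_ hpos'
    calc (A * A).ncard * 5 ^ J.card * (((q ^ 4) ^ J.card) ^ 2 * Nat.card V' ^ 2)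
        ≤ (blockSet Φ W' J (crossSet F * crossSet F)).ncard * 5 ^ J.card *
            (((q ^ 4) ^ J.card) ^ 2 * Nat.card V' ^ 2) := by gcongr
      _ = (blockSet Φ W' J (crossSet F * crossSet F)).ncard * (q ^ 4) ^ J.card *
            (5 ^ J.card * (q ^ 4) ^ J.card * Nat.card V' ^ 2) := by ring
      _ = Nat.card W' * (5 * ((crossSet F * crossSet F).ncard * q ^ 4)) ^ J.card *
            Nat.card V' ^ 2 := by
          rw [hAA, mul_pow, mul_pow]
          ring
      _ ≤ p ^ (Q ^ m * (2 * Q) + 1) * Nat.card V' ^ 2 * (4 * (crossSet F).ncard ^ 2) ^ J.card *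
            Nat.card V' ^ 2 := by gcongr
      _ = p ^ (Q ^ m * (2 * Q) + 1) * 4 ^ J.card * (Nat.card V' * (crossSet F).ncard ^ J.card) ^ 2 *
            Nat.card V' ^ 2 := by
          rw [mul_pow 4, mul_pow (Nat.card V'), ← pow_mul, ← pow_mul, mul_comm 2 J.card]
          ring
      _ = _ := by
          rw [← hA]
          ring

end Combine

section Points

open Polynomial

variable {p : ℕ} {F : Type*} [Field F] [Algebra (ZMod p) F] [Fact p.Prime] [Fintype F]

theorem pow_eq_self_of_natDegree_minpoly_dvd {a : F} {n : ℕ}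
    (h : (minpoly (ZMod p) a).natDegree ∣ n) : a ^ p ^ n = a := by
  have h_int : IsIntegral (ZMod p) a := IsIntegral.of_finite _ a
  obtain ⟨e, rfl⟩ := h
  let L := IntermediateField.adjoin (ZMod p) {a}
  have := Fintype.ofFinite L
  have hcard : Fintype.card L = p ^ (minpoly (ZMod p) a).natDegree := by
    rw [Module.card_eq_pow_finrank (K := ZMod p) (V := L), IntermediateField.adjoin.finrank h_int,
      ZMod.card]
  have := FiniteField.pow_card_pow e (IntermediateField.AdjoinSimple.gen (ZMod p) a : L)
  rw [hcard, ← pow_mul] at this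
  simpa using congrArg (algebraMap L F) this

theorem card_filter_minpoly_eq_le [DecidableEq F] (s : Finset F) (P : (ZMod p)[X]) :
    (s.filter fun a => minpoly (ZMod p) a = P).card ≤ P.natDegree := by
  classical
  by_cases h : P = 0
  · have : (s.filter fun a => minpoly (ZMod p) a = P) = ∅ := Finset.filter_eq_empty_iff.2
      fun a _ ha => minpoly.ne_zero (IsIntegral.of_finite (ZMod p) a) (ha.trans h)
    simp [this]
  · refine le_trans (Finset.card_le_card (t := (P.aroots F).toFinset) fun a ha => ?_)
      ((Multiset.toFinset_card_le _).trans ((card_roots' _).trans natDegree_map_le))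
    rw [Multiset.mem_toFinset, mem_aroots]
    exact ⟨h, (Finset.mem_filter.1 ha).2 ▸ minpoly.aeval _ a⟩

theorem card_pow_add_mul_eq_zero_le [DecidableEq F] {Q : ℕ} (hQ : 2 ≤ Q) (c : F) :
    (Finset.univ.filter fun a : F => a ^ Q + c * a = 0).card ≤ Q := by
  have hdeg : (X ^ Q + C c * X : F[X]).natDegree = Q := by
    rw [natDegree_add_eq_left_of_natDegree_lt, natDegree_X_pow]
    rw [natDegree_X_pow]
    exact (natDegree_C_mul_le c X).trans_lt (by rw [natDegree_X]; omega)
  have h0 : (X ^ Q + C c * X : F[X]) ≠ 0 := fun h => by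
    rw [h, natDegree_zero] at hdeg
    omega
  refine (Finset.card_le_card (t := (X ^ Q + C c * X : F[X]).roots.toFinset) fun a ha => ?_).trans
    ((Multiset.toFinset_card_le _).trans ((card_roots' _).trans hdeg.le))
  rw [Multiset.mem_toFinset, mem_roots h0]
  simpa using ha

theorem exists_points {κ : Type} [Fintype κ] {Q r : ℕ} (hQ : 2 ≤ Q) (hp : Q = p ^ 2 ^ r)
    (hcard : Fintype.card F = Q ^ 2) (hκ : Fintype.card κ * 2 ^ (r + 1) + 2 * Q ≤ Q ^ 2) :
    ∃ a : κ → F, (Function.Injective fun i => minpoly (ZMod p) (a i)) ∧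
      (∀ i, a i ^ Q + a i ≠ 0) ∧ ∀ i, (minpoly (ZMod p) (a i)).natDegree = 2 * 2 ^ r := by
  classical
  set good := Finset.univ.filter fun a : F => a ^ Q + 1 * a ≠ 0 ∧ a ^ Q + -1 * a ≠ 0 with hgood
  have hrank : Module.finrank (ZMod p) F = 2 ^ (r + 1) := by
    have h := Module.card_eq_pow_finrank (K := ZMod p) (V := F)
    rw [hcard, ZMod.card, hp, ← pow_mul] at h
    rw [pow_succ]
    exact (Nat.pow_right_injective (Fact.out : p.Prime).two_le h).symm
  have hdeg : ∀ a ∈ good, (minpoly (ZMod p) a).natDegree = 2 ^ (r + 1) := fun a ha => by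
    have hdvd := minpoly.degree_dvd (K := ZMod p) (IsIntegral.of_finite (ZMod p) a)
    rw [hrank] at hdvd
    obtain ⟨s, hs, hs'⟩ := (Nat.dvd_prime_pow Nat.prime_two).1 hdvd
    obtain rfl | hlt := hs.eq_or_lt
    · exact hs'
    · refine absurd (pow_eq_self_of_natDegree_minpoly_dvd (n := 2 ^ r)
        (hs' ▸ pow_dvd_pow 2 (Nat.le_of_lt_succ hlt))) fun h => ?_
      refine (Finset.mem_filter.1 ha).2.2 ?_
      rw [hp, h]
      ring
  have hgoodcard : Q ^ 2 ≤ good.card + 2 * Q := by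
    have h1 := card_pow_add_mul_eq_zero_le hQ (1 : F)
    have h2 := card_pow_add_mul_eq_zero_le hQ (-1 : F)
    have h3 : Finset.univ ⊆ good ∪ ((Finset.univ.filter fun a : F => a ^ Q + 1 * a = 0) ∪
        Finset.univ.filter fun a : F => a ^ Q + -1 * a = 0) := fun a _ => by
      simp only [hgood, Finset.mem_union, Finset.mem_filter, Finset.mem_univ, true_and]
      tauto
    have h4 := Finset.card_le_card h3
    rw [Finset.card_univ, hcard] at h4
    have h5 := h4.trans ((Finset.card_union_le _ _).trans
      (Nat.add_le_add_left (Finset.card_union_le _ _) _))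
    omega
  have himage : Fintype.card κ ≤ (good.image (minpoly (ZMod p))).card := by
    have h := Finset.card_le_mul_card_image (f := minpoly (ZMod p)) good (2 ^ (r + 1)) fun P hP => by
      obtain ⟨a, ha, rfl⟩ := Finset.mem_image.1 hP
      exact (card_filter_minpoly_eq_le good _).trans (hdeg a ha).le
    have hpos : 0 < 2 ^ (r + 1) := by positivity
    refine Nat.le_of_mul_le_mul_left ?_ hpos
    linarith
  obtain ⟨f⟩ : Nonempty (κ ↪ good.image (minpoly (ZMod p))) :=
    Function.Embedding.nonempty_of_card_le (by simpa using himage)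
  choose a ha hfa using fun i => Finset.mem_image.1 (f i).2
  refine ⟨a, fun i j hij => f.injective (Subtype.ext ?_), fun i => ?_, fun i => ?_⟩
  · rw [← hfa, ← hfa]
    exact hij
  · simpa using (Finset.mem_filter.1 (ha i)).2.1
  · rw [hdeg _ (ha i), pow_succ']

end Points

section PowerSeriesTower

open PowerSeries

/-- In a power series ring in which `z ↦ z ^ Q` is additive, `z ^ Q + z = u` has a solution. -/
theorem PowerSeries.exists_pow_add_eq {R : Type*} [CommRing R] {Q : ℕ} (hQ : 2 ≤ Q)
    (hadd : ∀ a b : R⟦X⟧, (a + b) ^ Q = a ^ Q + b ^ Q) {u : R⟦X⟧} (hu : X ∣ u) :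
    ∃ z, X ∣ z ∧ z ^ Q + z = u := by
  have hsub : ∀ a b : R⟦X⟧, a ^ Q - b ^ Q = (a - b) ^ Q := fun a b => by
    rw [sub_eq_iff_eq_add, ← hadd, sub_add_cancel]
  obtain ⟨s, hs0, hs⟩ : ∃ s : ℕ → R⟦X⟧, s 0 = 0 ∧ ∀ n, s (n + 1) = u - s n ^ Q :=
    ⟨fun n => n.rec 0 fun _ a => u - a ^ Q, rfl, fun _ => rfl⟩
  have hstep : ∀ n, X ^ (n + 1) ∣ s (n + 1) - s n := by
    intro n
    induction n with
    | zero => simpa [hs, hs0, zero_pow (by omega : Q ≠ 0)] using hu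
    | succ n ih =>
      have h : s (n + 1 + 1) - s (n + 1) = -(s (n + 1) - s n) ^ Q := by
        rw [hs (n + 1), ← hsub]
        linear_combination -hs n
      rw [h, dvd_neg]
      refine dvd_trans ?_ (pow_dvd_pow_of_dvd ih Q)
      rw [← pow_mul]
      exact pow_dvd_pow _ (by nlinarith)
  have hcoeff : ∀ n k, coeff n (s (n + k)) = coeff n (s n) := by
    intro n k
    induction k with
    | zero => rfl
    | succ k ih =>
      rw [← ih, ← sub_eq_zero, ← map_sub]
      exact X_pow_dvd_iff.1 (hstep (n + k)) n (by omega)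
  have hz : ∀ N, X ^ (N + 1) ∣ mk (fun n => coeff n (s n)) - s N := fun N =>
    X_pow_dvd_iff.2 fun n hn => by
      obtain ⟨k, rfl⟩ := Nat.exists_eq_add_of_le (Nat.le_of_lt_succ hn)
      rw [map_sub, coeff_mk, hcoeff, sub_self]
  set z := mk fun n => coeff n (s n)
  refine ⟨z, by simpa [hs0] using hz 0, ?_⟩
  rw [← sub_eq_zero]
  ext N
  have h : z ^ Q + z - u = (z - s N) ^ Q + (z - s N) - (s (N + 1) - s N) := by
    rw [← hsub, hs]
    ring
  exact X_pow_dvd_iff.1 (h ▸ dvd_sub (dvd_add (dvd_pow (hz N) (by omega)) (hz N)) (hstep N)) N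
    (Nat.lt_succ_self N)

theorem PowerSeries.exists_tower {k : Type*} [Field k] {Q : ℕ} (hQ : 2 ≤ Q)
    (hadd : ∀ a b : k⟦X⟧, (a + b) ^ Q = a ^ Q + b ^ Q) :
    ∃ y : ℕ → k⟦X⟧, y 0 = X ∧ (∀ i, X ∣ y i) ∧ (∀ i, y i ≠ 0) ∧
      ∀ i, (y (i + 1) ^ Q + y (i + 1)) * (1 + y i ^ (Q - 1)) = y i ^ Q := by
  have key : ∀ y : {y : k⟦X⟧ // X ∣ y}, ∃ z : {z : k⟦X⟧ // X ∣ z},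
      ((z : k⟦X⟧) ^ Q + z) * (1 + (y : k⟦X⟧) ^ (Q - 1)) = (y : k⟦X⟧) ^ Q := by
    rintro ⟨y, hy⟩
    obtain ⟨z, hz, hzu⟩ := exists_pow_add_eq hQ hadd
      (u := y ^ Q * (1 + y ^ (Q - 1))⁻¹) (dvd_mul_of_dvd_left (dvd_pow hy (by omega)) _)
    refine ⟨⟨z, hz⟩, ?_⟩
    change (z ^ Q + z) * (1 + y ^ (Q - 1)) = y ^ Q
    rw [hzu, mul_assoc, PowerSeries.inv_mul_cancel, mul_one]
    have h0 : constantCoeff y = 0 := X_dvd_iff.1 hy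
    rw [map_add, map_pow, h0, zero_pow (by omega)]
    simp
  choose g hg using key
  obtain ⟨y, hy0, hy⟩ : ∃ y : ℕ → {y : k⟦X⟧ // X ∣ y}, y 0 = ⟨X, dvd_rfl⟩ ∧ ∀ n, y (n + 1) = g (y n) :=
    ⟨fun n => n.rec ⟨X, dvd_rfl⟩ fun _ => g, rfl, fun _ => rfl⟩
  have hrel : ∀ i, ((y (i + 1) : k⟦X⟧) ^ Q + y (i + 1)) * (1 + (y i : k⟦X⟧) ^ (Q - 1)) =
      (y i : k⟦X⟧) ^ Q := fun i => by rw [hy, hg]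
  refine ⟨fun i => y i, congrArg Subtype.val hy0, fun i => (y i).2, fun i => ?_, hrel⟩
  induction i with
  | zero =>
    change (y 0 : k⟦X⟧) ≠ 0
    rw [hy0]
    exact X_ne_zero
  | succ i ih =>
    intro h
    change (y (i + 1) : k⟦X⟧) = 0 at h
    have := hrel i
    rw [h, zero_pow (by omega), add_zero, zero_mul] at this
    exact pow_ne_zero _ ih this.symm

end PowerSeriesTower

section LaurentSeriesTower

open PowerSeries WithZero

variable (k : Type*) [Field k]

theorem LaurentSeries.v_coe_lt_one {y : k⟦X⟧} (hy : X ∣ y) :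
    Valued.v (HahnSeries.ofPowerSeries ℤ k y) < 1 := by
  obtain ⟨g, rfl⟩ := hy
  have hX : Valued.v (HahnSeries.ofPowerSeries ℤ k X) = exp (-1 : ℤ) := by
    simpa using LaurentSeries.valuation_X_pow k 1
  rw [map_mul, map_mul, hX]
  have hg : Valued.v (HahnSeries.ofPowerSeries ℤ k g) ≤ 1 := (idealX k).valuation_le_one g
  calc _ ≤ exp (-1 : ℤ) * 1 := mul_le_mul_right hg _
    _ < 1 := by
      rw [mul_one, ← exp_zero, exp_lt_exp]
      norm_num

variable {k} in
theorem inv_tower_relation {a b : k} {Q : ℕ} (hQ : 1 ≤ Q) (ha : a ≠ 0) (hb : b ≠ 0)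
    (h : (b ^ Q + b) * (1 + a ^ (Q - 1)) = a ^ Q) :
    (a⁻¹ ^ Q + a⁻¹) * unitFactor Q b⁻¹ = b⁻¹ ^ Q := by
  obtain ⟨r, rfl⟩ := Nat.exists_eq_add_of_le' hQ
  rw [Nat.add_sub_cancel] at h
  rw [unitFactor, Nat.add_sub_cancel]
  simp only [pow_succ, inv_pow] at h ⊢
  have hA := pow_ne_zero r ha
  have hB := pow_ne_zero r hb
  generalize a ^ r = A at *
  generalize b ^ r = B at *
  field_simp
  linear_combination h

theorem LaurentSeries.exists_isTower {Q : ℕ} (hQ : 2 ≤ Q)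
    (hadd : ∀ a b : k⟦X⟧, (a + b) ^ Q = a ^ Q + b ^ Q) (m : ℕ) :
    ∃ x : ℕ → LaurentSeries k, IsTower Q m x ∧ 1 < Valued.v (x 0) ∧
      Valued.v (x m) = exp (1 : ℤ) := by
  obtain ⟨y, hy0, hdvd, hne, hrel⟩ := exists_tower hQ hadd
  have hne' : ∀ i, HahnSeries.ofPowerSeries ℤ k (y i) ≠ 0 := fun i h =>
    hne i (HahnSeries.ofPowerSeries_injective (by rw [h, map_zero]))
  refine ⟨fun j => (HahnSeries.ofPowerSeries ℤ k (y (m - j)))⁻¹, ⟨fun j hj => inv_ne_zero (hne' _), ?_⟩, ?_, ?_⟩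
  · intro j hj
    obtain ⟨i, rfl⟩ := Nat.exists_eq_add_of_lt hj
    have h := congrArg (HahnSeries.ofPowerSeries ℤ k) (hrel i)
    rw [show j + i + 1 - j = i + 1 by omega, show j + i + 1 - (j + 1) = i by omega]
    have h1 := hne' i
    have h2 := hne' (i + 1)
    simp only [map_mul, map_add, map_pow, map_one] at h
    exact inv_tower_relation (by omega) h1 h2 h
  · rw [map_inv₀]
    exact (one_lt_inv₀ (by
      rw [zero_lt_iff]
      exact (Valuation.ne_zero_iff _).2 (hne' _))).2 (v_coe_lt_one k (hdvd _))
  · rw [map_inv₀, Nat.sub_self, hy0]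
    have hX : Valued.v (HahnSeries.ofPowerSeries ℤ k X) = exp (-1 : ℤ) := by
      simpa using LaurentSeries.valuation_X_pow k 1
    rw [hX, ← exp_neg, neg_neg]

theorem LaurentSeries.boundsPoles (p : ℕ) [Fact p.Prime] :
    BoundsPoles p (Valued.v : Valuation (LaurentSeries (ZMod p)) ℤᵐ⁰) (exp (1 : ℤ)) := by
  intro V n hV
  let φ : V → Fin (n + 1) → ZMod p := fun f i => (f : LaurentSeries (ZMod p)).coeff (-(i : ℤ))
  have hφ : Function.Injective φ := by
    intro f g hfg
    by_contra hne
    obtain ⟨h1, h2⟩ := hV (f - g) (V.sub_mem f.2 g.2) (sub_ne_zero.2 fun h => hne (Subtype.ext h))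
    rw [← exp_nsmul, show n • (1 : ℤ) = -(-(n : ℤ)) by simp, valuation_le_iff_coeff_lt_eq_zero] at h2
    have h3 : Valued.v ((f : LaurentSeries (ZMod p)) - g) ≤ exp (-1 : ℤ) := by
      rw [valuation_le_iff_coeff_lt_eq_zero]
      intro i hi
      by_cases hin : i < -(n : ℤ)
      · exact h2 i hin
      · have := congrFun hfg ⟨(-i).toNat, by omega⟩
        simp only [φ, Int.toNat_of_nonneg (show 0 ≤ -i by omega), neg_neg] at this
        rw [HahnSeries.coeff_sub, this, sub_self]
    refine absurd (h1.trans h3) (not_le.2 ?_)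
    rw [← exp_zero, exp_lt_exp]
    norm_num
  refine ⟨Finite.of_injective φ hφ, (Nat.card_le_card_of_injective φ hφ).trans_eq ?_⟩
  simp

end LaurentSeriesTower

section Numerics

variable {p Y n s t J : ℕ}

theorem pow_le_of_pow_le_mul_pow (hp : 2 ≤ p) (hJ : J ≤ 100 * p * Y)
    (h : p ^ (25600 * p * Y - Y) ≤ n * p ^ (32 * J)) : p ^ Y ≤ n := by
  have hpos : 0 < p ^ (32 * J) := by positivity
  refine Nat.le_of_mul_le_mul_right (le_trans ?_ h) hpos
  rw [← pow_add]
  refine Nat.pow_le_pow_right (by omega) ?_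
  have : 2 * Y ≤ p * Y := Nat.mul_le_mul_right _ hp
  rw [mul_assoc] at *
  omega

/-- The exponents of the construction combine, after taking logarithms, to a saving of a constant
amount per unit of `Z`. -/
theorem log_bounds {L Z Y J N S T : ℝ} (hL : Real.log 2 ≤ L) (hY : 1 ≤ Y) (hYZ : 2 * Y ≤ Z)
    (hYL : Y * L ≤ Z * Real.log 2) (hJ : J ≤ 100 * Z)
    (e1 : N ≤ (25600 * Z + 1) * L) (e2 : S ≤ (25600 * Z + 1) * L)
    (e3 : (25600 * Z - Y) * L ≤ N + 32 * J * L)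
    (e4 : (100 * Z - J) * Real.log 2 ≤ (Y + 1) * L)
    (e5 : T + J * Real.log 5 ≤ (2 * Y + 1) * L + J * Real.log 4 + 2 * N) :
    S ≤ (2 - (1 / 2000) / L) * N ∧ T ≤ (2 - (1 / 2000) / L) * N := by
  have l2 := Real.log_two_gt_d9
  have l2' := Real.log_two_lt_d9
  have l54 : 1 / 5 ≤ Real.log 5 - Real.log 4 := by
    rw [← Real.log_div (by norm_num) (by norm_num)]
    have := Real.one_sub_inv_le_log_of_pos (x := 5 / 4) (by norm_num)
    norm_num at this ⊢
    exact this
  have hL0 : 0 < L := by linarith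
  have hZ2 : 2 ≤ Z := by linarith
  have hc : (1 / 2000) / L * N ≤ (1 / 2000) * (25600 * Z + 1) := by
    rw [div_mul_eq_mul_div, div_le_iff₀ hL0, mul_assoc]
    linarith
  have hLYL : 1 * L ≤ Y * L := mul_le_mul_of_nonneg_right hY hL0.le
  have hYZL : 2 * Y * L ≤ Z * L := mul_le_mul_of_nonneg_right hYZ hL0.le
  have hJZL : J * L ≤ 100 * Z * L := mul_le_mul_of_nonneg_right hJ hL0.le
  have hZ0 : 0 ≤ Z := by linarith
  have hZl : Z * 0.69 ≤ Z * Real.log 2 := mul_le_mul_of_nonneg_left (by linarith) hZ0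
  have hZl' : Z * Real.log 2 ≤ Z * 0.7 := mul_le_mul_of_nonneg_left (by linarith) hZ0
  have hZL : Z * Real.log 2 ≤ Z * L := mul_le_mul_of_nonneg_left hL hZ0
  have hJlow : 98 * Z ≤ J := by
    have h : (100 * Z - J) * Real.log 2 ≤ 2 * Z * Real.log 2 := by linarith
    have := le_of_mul_le_mul_right h (by linarith)
    linarith
  have hJ54 : J * (1 / 5) ≤ J * (Real.log 5 - Real.log 4) :=
    mul_le_mul_of_nonneg_left l54 (by linarith)
  rw [sub_mul]
  constructor <;> linarith

/-- The exponents of the construction combine to a saving in the exponent of order `1 / log p`. -/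
theorem max_le_rpow (hp : 2 ≤ p) (hY : 1 ≤ Y) (hJ : J ≤ 100 * p * Y) (ht : 0 < t) (hs : 0 < s)
    (h1 : n ≤ p ^ (25600 * p * Y + 1)) (h2 : s ≤ p ^ (25600 * p * Y + 1))
    (h3 : p ^ (25600 * p * Y - Y) ≤ n * p ^ (32 * J)) (h4 : 2 ^ (100 * p * Y - J) ≤ p ^ (Y + 1))
    (h5 : t * 5 ^ J ≤ p ^ (2 * Y + 1) * 4 ^ J * n ^ 2) :
    max (s : ℝ) (t : ℝ) ≤ (n : ℝ) ^ ((2 : ℝ) - (1 / 2000) / Real.log p) := by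
  have hn : 0 < n := lt_of_lt_of_le (by positivity) (pow_le_of_pow_le_mul_pow hp hJ h3)
  have hYle : Y ≤ 25600 * p * Y := Nat.le_mul_of_pos_left _ (by omega)
  generalize ha : 25600 * p * Y = a at *
  generalize hb : 100 * p * Y = b at *
  have ha' : (a : ℝ) = 25600 * (p * Y) := by rw [← ha]; push_cast; ring
  have hb' : (b : ℝ) = 100 * (p * Y) := by rw [← hb]; push_cast; ring
  have hp0 : (0 : ℝ) < p := by exact_mod_cast (by omega : 0 < p)
  have hn0 : (0 : ℝ) < n := by exact_mod_cast hn
  have ht0 : (0 : ℝ) < t := by exact_mod_cast ht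
  have hs0 : (0 : ℝ) < s := by exact_mod_cast hs
  have hp2 : (2 : ℝ) ≤ p := by exact_mod_cast hp
  have hY1 : (1 : ℝ) ≤ Y := by exact_mod_cast hY
  have hJ' : (J : ℝ) ≤ b := by exact_mod_cast hJ
  have hL : Real.log 2 ≤ Real.log p := Real.log_le_log (by norm_num) hp2
  have hLp : Real.log p ≤ p * Real.log 2 := by
    rw [← Real.log_pow]
    exact Real.log_le_log hp0 (by exact_mod_cast Nat.lt_two_pow_self.le)
  have e1 : Real.log n ≤ (a + 1) * Real.log p := by
    have h : (n : ℝ) ≤ (p : ℝ) ^ (a + 1) := by exact_mod_cast h1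
    simpa using Real.log_le_log hn0 h
  have e2 : Real.log s ≤ (a + 1) * Real.log p := by
    have h : (s : ℝ) ≤ (p : ℝ) ^ (a + 1) := by exact_mod_cast h2
    simpa using Real.log_le_log hs0 h
  have e3 : (a - Y) * Real.log p ≤ Real.log n + 32 * J * Real.log p := by
    have h : (p : ℝ) ^ (a - Y) ≤ n * (p : ℝ) ^ (32 * J) := by exact_mod_cast h3
    have h' := Real.log_le_log (by positivity) h
    rw [Real.log_mul hn0.ne' (by positivity), Real.log_pow, Real.log_pow, Nat.cast_sub hYle] at h'
    simpa using h'
  have e4 : (b - J) * Real.log 2 ≤ (Y + 1) * Real.log p := by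
    have h : (2 : ℝ) ^ (b - J) ≤ (p : ℝ) ^ (Y + 1) := by exact_mod_cast h4
    have h' := Real.log_le_log (by positivity) h
    rw [Real.log_pow, Real.log_pow, Nat.cast_sub hJ] at h'
    simpa using h'
  have e5 : Real.log t + J * Real.log 5 ≤
      (2 * Y + 1) * Real.log p + J * Real.log 4 + 2 * Real.log n := by
    have h : (t : ℝ) * 5 ^ J ≤ (p : ℝ) ^ (2 * Y + 1) * 4 ^ J * n ^ 2 := by exact_mod_cast h5
    have h' := Real.log_le_log (by positivity) h
    rw [Real.log_mul ht0.ne' (by positivity), Real.log_mul (by positivity) (by positivity),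
      Real.log_mul (by positivity) (by positivity), Real.log_pow, Real.log_pow, Real.log_pow,
      Real.log_pow] at h'
    simpa using h'
  rw [ha'] at e1 e2 e3
  rw [hb'] at e4 hJ'
  have hYL : (Y : ℝ) * Real.log p ≤ p * Y * Real.log 2 :=
    (mul_le_mul_of_nonneg_left hLp (by linarith)).trans_eq (by ring)
  obtain ⟨hS, hT⟩ := log_bounds hL hY1 (mul_le_mul_of_nonneg_right hp2 (by linarith)) hYL hJ'
    e1 e2 e3 e4 e5
  have hlog : ∀ {r : ℝ}, 0 < r → Real.log r ≤ (2 - (1 / 2000) / Real.log p) * Real.log n →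
      r ≤ (n : ℝ) ^ ((2 : ℝ) - (1 / 2000) / Real.log p) := fun hr h => by
    rw [← Real.log_le_log_iff hr (by positivity), Real.log_rpow hn0]
    exact h
  exact max_le (hlog hs0 hS) (hlog ht0 hT)

end Numerics

section Transfer

/-- The map on Laurent series applying a ring homomorphism to every coefficient. -/
def LaurentSeries.mapRingHom {R S : Type*} [CommRing R] [CommRing S] (f : R →+* S) :
    LaurentSeries R →+* LaurentSeries S where
  toFun x := x.map f
  map_one' := HahnSeries.map_one f.toMonoidWithZeroHom
  map_mul' _ _ := HahnSeries.map_mul (f : R →ₙ+* S)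
  map_zero' := HahnSeries.ext (funext fun _ => map_zero f)
  map_add' _ _ := HahnSeries.map_add (f : R →+ S)

theorem LaurentSeries.mapRingHom_injective {R S : Type*} [CommRing R] [CommRing S] {f : R →+* S}
    (hf : Function.Injective f) : Function.Injective (mapRingHom f) := fun _ _ h =>
  HahnSeries.ext (funext fun i => hf (congrFun (congrArg HahnSeries.coeff h) i))

theorem exists_set_laurentSeries (p : ℕ) [Fact p.Prime] (N : ℕ) :
    ∃ A : Set (LaurentSeries (ZMod p)), A.Finite ∧ N ≤ A.ncard ∧
      max ((A + A).ncard : ℝ) ((A * A).ncard : ℝ) ≤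
        (A.ncard : ℝ) ^ ((2 : ℝ) - (1 / 2000) / Real.log p) := by
  have hp : 2 ≤ p := (Fact.out : p.Prime).two_le
  obtain ⟨Q, hQp⟩ : ∃ Q, Q = p ^ 16 := ⟨_, rfl⟩
  have hQlarge : 2 ^ 15 * p ≤ Q := by
    rw [hQp, pow_succ p 15]
    exact Nat.mul_le_mul_right _ (Nat.pow_le_pow_left hp 15)
  have hQ : 2 ≤ Q := by omega
  have hchar : CharP (PowerSeries (ZMod p)) p :=
    charP_of_injective_ringHom (f := PowerSeries.C (R := ZMod p)) PowerSeries.C_injective p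
  have hchar' : CharP (LaurentSeries (ZMod p)) p :=
    charP_of_injective_ringHom (f := HahnSeries.C (R := ZMod p)) HahnSeries.C_injective p
  obtain ⟨x, T, hx, hxm⟩ := LaurentSeries.exists_isTower (ZMod p) hQ
    (fun a b => by rw [hQp]; exact add_pow_char_pow a b p 16) N
  let F := GaloisField p 32
  have := Fintype.ofFinite F
  have hcard : Fintype.card F = Q ^ 2 := by
    rw [← Nat.card_eq_fintype_card, GaloisField.card p 32 (by norm_num), hQp, ← pow_mul]
  have hQQ : 100 * Q * p * 2 * 2 ^ (4 + 1) + 2 * Q ≤ Q ^ 2 :=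
    calc
      _ = Q * (6400 * p + 2) := by ring
      _ ≤ Q * Q := Nat.mul_le_mul_left _ (by omega)
      _ = Q ^ 2 := (sq Q).symm
  obtain ⟨a, hinj, hne, hd⟩ := exists_points (p := p) (F := F) (κ := Fin (100 * Q * p) × Bool)
    (r := 4) hQ hQp hcard (by
      rw [Fintype.card_prod, Fintype.card_fin, Fintype.card_bool]
      linarith)
  obtain ⟨A, J, hJ, hfin, h1, h2, h3, h4, h5⟩ := T.exists_set (p := p) (F := F) hQ
    (fun a b => by rw [hQp]; exact add_pow_char_pow a b p 16) hcard 16 hQp (by nlinarith) hx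
    (hxm ▸ LaurentSeries.boundsPoles p) hinj hne hd (E := 25600 * Q * p) (by nlinarith) (by
      rw [Fintype.card_fin]
      nlinarith)
  rw [Fintype.card_fin] at hJ h4
  obtain ⟨Y, hY⟩ : ∃ Y, Y = Q ^ N * Q := ⟨_, rfl⟩
  have r1 : 100 * Q * p * Q ^ N = 100 * p * Y := by rw [hY]; ring
  have r2 : Q ^ N * (25600 * Q * p) = 25600 * p * Y := by rw [hY]; ring
  have r3 : Q ^ N * (25600 * Q * p - Q) = 25600 * p * Y - Y := by
    rw [Nat.mul_sub, r2, hY]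
  have r4 : Q ^ N * (2 * Q) = 2 * Y := by rw [hY]; ring
  rw [r1] at hJ h4
  rw [r2] at h1 h2
  rw [r3] at h3
  rw [← hY] at h4
  rw [r4] at h5
  have hNY : N ≤ Y := by
    rw [hY]
    exact (Nat.lt_pow_self (by omega)).le.trans (Nat.le_mul_of_pos_right _ (by omega))
  have hYpos : 1 ≤ Y := by
    rw [hY]
    exact Nat.mul_pos (pow_pos (by omega) _) (by omega)
  have hYn : Y < A.ncard :=
    (Nat.lt_pow_self (by omega)).trans_le (pow_le_of_pow_le_mul_pow hp hJ h3)
  have hA : A.Nonempty := (Set.ncard_pos hfin).1 (by omega)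
  exact ⟨A, hfin, hNY.trans hYn.le, max_le_rpow hp hYpos hJ ((Set.ncard_pos (hfin.mul hfin)).2 (hA.mul hA))
    ((Set.ncard_pos (hfin.add hfin)).2 (hA.add hA)) h1 h2 h3 h4 h5⟩

end Transfer

/-- There exists an absolute constant `c > 0` such that for any prime `p` and any power
`q` of `p`, there exist arbitrarily large finite `A ⊆ 𝔽_q((t))` with
`max(|A+A|, |AA|) ≤ |A|^{2 - c/log p}`. -/
theorem statement9 :
    ∃ c : ℝ, 0 < c ∧
      ∀ p : ℕ, p.Prime →
        ∀ (F : Type) [Field F] [Fintype F],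
          (∃ n : ℕ, 1 ≤ n ∧ Fintype.card F = p ^ n) →
          ∀ N : ℕ, ∃ A : Set (LaurentSeries F), A.Finite ∧ N ≤ A.ncard ∧
            max ((A + A).ncard : ℝ) ((A * A).ncard : ℝ) ≤
              (A.ncard : ℝ) ^ ((2 : ℝ) - c / Real.log p) := by
  refine ⟨1 / 2000, by norm_num, fun p hp F _ _ ⟨n, hn, hcard⟩ N => ?_⟩
  have : Fact p.Prime := ⟨hp⟩
  have : CharP F p := charP_of_card_eq_prime_pow hcard
  obtain ⟨A, hfin, hN, hA⟩ := exists_set_laurentSeries p N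
  let f := LaurentSeries.mapRingHom (ZMod.castHom dvd_rfl F : ZMod p →+* F)
  have hf : Function.Injective f :=
    LaurentSeries.mapRingHom_injective (ZMod.castHom dvd_rfl F : ZMod p →+* F).injective
  refine ⟨f '' A, hfin.image f, ?_, ?_⟩
  · rwa [Set.ncard_image_of_injective _ hf]
  · rwa [← Set.image_add, ← Set.image_mul, Set.ncard_image_of_injective _ hf,
      Set.ncard_image_of_injective _ hf, Set.ncard_image_of_injective _ hf]
end
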